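/- Let β_{ζ,0} = sup{Re ρ : ζ(ρ) = 0, 0 < Re ρ < 1} and E_ζ(x) = (log x / x^{β_{ζ,0}})(π(x) − Li(x)). Then E_ζ admits a limiting logarithmic distribution μ_ζ on ℝ; there exists a constant C > 0 such that μ_ζ(ℝ ∖ [−A, A]) ≪ exp(−C√A) for all A > 0; and the mean ∫_ℝ t dμ_ζ(t) equals −1 if β_{ζ,0} = 1/2 and equals 0 otherwise. -/

import Mathlib

open MeasureTheory Filter Topology

noncomputable section

/-- `F : ℝ → ℝ` admits the Borel probability measure `μ` as limiting logarithmic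
distribution: for every bounded Lipschitz `g : ℝ → ℝ`,
`(1/Y) ∫₂^Y g(F(e^y)) dy → ∫ g dμ` as `Y → ∞`. -/
def HasLimitingLogDistribution (F : ℝ → ℝ) (μ : Measure ℝ) : Prop :=
  IsProbabilityMeasure μ ∧
  ∀ g : ℝ → ℝ, (∃ C, LipschitzWith C g) → (∃ B, ∀ x, |g x| ≤ B) →
    Tendsto (fun Y : ℝ => (1 / Y) * ∫ y in (2:ℝ)..Y, g (F (Real.exp y)))
      atTop (𝓝 (∫ t, g t ∂μ))

/-- The number of primes `≤ x`. -/
def primeCount (x : ℝ) : ℕ := ((Finset.range (⌊x⌋₊ + 1)).filter Nat.Prime).card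

/-- The logarithmic integral `Li(x) = ∫₂^x dt / log t`. -/
def Li (x : ℝ) : ℝ := ∫ t in (2:ℝ)..x, 1 / Real.log t

/-- `β_{ζ,0}`: the supremum of the real parts of the zeros of `ζ` in the critical strip. -/
def betaZeta : ℝ :=
  sSup {b : ℝ | ∃ ρ : ℂ, riemannZeta ρ = 0 ∧ 0 < ρ.re ∧ ρ.re < 1 ∧ ρ.re = b}

/-- `E_ζ(x) = (log x / x^{β_{ζ,0}}) (π(x) − Li(x))`. -/
def Ezeta (x : ℝ) : ℝ := (Real.log x / x ^ betaZeta) * ((primeCount x : ℝ) - Li x)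

section
open MeasureTheory Filter Topology

noncomputable section

namespace Zd

/-! ## Part A: local factorisation on discs -/

/-- product of linear factors -/
def PL (L : List ℂ) (z : ℂ) : ℂ := (L.map (fun ρ => z - ρ)).prod

/-- product of Blaschke numerators -/
def BL (R : ℝ) (L : List ℂ) (z : ℂ) : ℂ :=
  (L.map (fun ρ => ((R:ℂ)^2 - (starRingEnd ℂ) ρ * z) / R)).prod

lemma PL_cons (a : ℂ) (L : List ℂ) (z : ℂ) : PL (a :: L) z = (z - a) * PL L z := by
  simp [PL]

lemma BL_cons (R : ℝ) (a : ℂ) (L : List ℂ) (z : ℂ) :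
    BL R (a :: L) z = (((R:ℂ)^2 - (starRingEnd ℂ) a * z) / R) * BL R L z := by
  simp [BL]

lemma PL_diff (L : List ℂ) : Differentiable ℂ (PL L) := by
  induction L with
  | nil =>
    have : PL [] = fun _ => 1 := by funext z; simp [PL]
    rw [this]; exact differentiable_const _
  | cons a L ih =>
    have : PL (a :: L) = fun z => (z - a) * PL L z := by funext z; exact PL_cons a L z
    rw [this]; fun_prop

lemma BL_diff (R : ℝ) (L : List ℂ) : Differentiable ℂ (BL R L) := by
  induction L with
  | nil =>
    have : BL R [] = fun _ => 1 := by funext z; simp [BL]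
    rw [this]; exact differentiable_const _
  | cons a L ih =>
    have : BL R (a :: L) = fun z => (((R:ℂ)^2 - (starRingEnd ℂ) a * z) / R) * BL R L z := by
      funext z; exact BL_cons R a L z
    rw [this]; fun_prop

lemma norm_BL_eq {R : ℝ} (hR : 0 < R) (L : List ℂ) {z : ℂ} (hz : ‖z‖ = R) :
    ‖BL R L z‖ = ‖PL L z‖ := by
  induction L with
  | nil => simp [BL, PL]
  | cons a L ih =>
    rw [BL_cons, PL_cons, norm_mul, norm_mul, ih]
    congr 1
    have h1 : (R:ℂ)^2 = z * (starRingEnd ℂ) z := by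
      rw [Complex.mul_conj, Complex.normSq_eq_norm_sq, hz]; push_cast; rfl
    have h2 : (R:ℂ)^2 - (starRingEnd ℂ) a * z = z * (starRingEnd ℂ) (z - a) := by
      rw [h1, map_sub]; ring
    rw [h2, norm_div, norm_mul, hz, RCLike.norm_conj]
    simp only [Complex.norm_real, Real.norm_eq_abs, abs_of_pos hR]
    field_simp

lemma BL_zero {R : ℝ} (hR : 0 < R) (L : List ℂ) : BL R L 0 = (R:ℂ) ^ L.length := by
  induction L with
  | nil => simp [BL]
  | cons a L ih =>
    rw [BL_cons, ih, List.length_cons, pow_succ]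
    have : (R:ℂ) ≠ 0 := by exact_mod_cast hR.ne'
    field_simp; ring

lemma norm_PL_zero_le {r : ℝ} (L : List ℂ) (hL : ∀ ρ ∈ L, ‖ρ‖ ≤ r) (hr : 0 ≤ r) :
    ‖PL L 0‖ ≤ r ^ L.length := by
  induction L with
  | nil => simp [PL]
  | cons a L ih =>
    rw [PL_cons, norm_mul, List.length_cons, pow_succ, mul_comm]
    have h1 := ih (fun ρ h => hL ρ (List.mem_cons_of_mem _ h))
    have h2 := hL a List.mem_cons_self
    simp only [zero_sub, norm_neg]
    gcongr

lemma BL_ne_zero {r R : ℝ} (hR : 0 < R) (hr : r < R) (L : List ℂ) (hL : ∀ ρ ∈ L, ‖ρ‖ ≤ r)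
    {z : ℂ} (hz : ‖z‖ < R) : BL R L z ≠ 0 := by
  induction L with
  | nil => simp [BL]
  | cons a L ih =>
    rw [BL_cons]
    refine mul_ne_zero (div_ne_zero ?_ (by exact_mod_cast hR.ne'))
      (ih (fun ρ h => hL ρ (List.mem_cons_of_mem _ h)))
    intro h0
    have h2 := hL a List.mem_cons_self
    have h3 : (R:ℂ)^2 = (starRingEnd ℂ) a * z := by linear_combination h0
    have h4 := congrArg norm h3
    rw [norm_mul, RCLike.norm_conj, norm_pow, Complex.norm_real, Real.norm_eq_abs,
      abs_of_pos hR] at h4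
    nlinarith [norm_nonneg a, norm_nonneg z]

lemma PL_ne_zero (L : List ℂ) {z : ℂ} (hz : z ∉ L) : PL L z ≠ 0 := by
  induction L with
  | nil => simp [PL]
  | cons a L ih =>
    rw [PL_cons]
    simp only [List.mem_cons, not_or] at hz
    exact mul_ne_zero (sub_ne_zero.2 hz.1) (ih hz.2)

lemma PL_eq_zero (L : List ℂ) {z : ℂ} (hz : z ∈ L) : PL L z = 0 := by
  induction L with
  | nil => simp at hz
  | cons a L ih =>
    rw [PL_cons]
    rcases List.mem_cons.1 hz with h | h
    · simp [h]
    · simp [ih h]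

lemma logDeriv_PL (L : List ℂ) {z : ℂ} (hz : z ∉ L) :
    logDeriv (PL L) z = (L.map (fun ρ => 1 / (z - ρ))).sum := by
  induction L with
  | nil =>
    have : PL [] = fun _ => 1 := by funext z; simp [PL]
    rw [this]; simp [logDeriv]
  | cons a L ih =>
    have : PL (a :: L) = fun z => (z - a) * PL L z := by funext z; exact PL_cons a L z
    simp only [List.mem_cons, not_or] at hz
    rw [this, logDeriv_mul (f := fun z => z - a) (g := PL L) z (sub_ne_zero.2 hz.1) (PL_ne_zero L hz.2) (by fun_prop) (PL_diff L z),
      ih hz.2]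
    simp [logDeriv]

lemma norm_logDeriv_BL {r R : ℝ} (hR : 0 < R) (hr : r < R) (hr0 : 0 < r) (L : List ℂ)
    (hL : ∀ ρ ∈ L, ‖ρ‖ ≤ r) {z : ℂ} (hz : ‖z‖ ≤ r) :
    ‖logDeriv (BL R L) z‖ ≤ L.length * (r / (R^2 - r^2)) := by
  induction L with
  | nil =>
    have : BL R [] = fun _ => 1 := by funext z; simp [BL]
    rw [this]; simp [logDeriv]
  | cons a L ih =>
    have : BL R (a :: L) = fun z => (((R:ℂ)^2 - (starRingEnd ℂ) a * z) / R) * BL R L z := by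
      funext z; exact BL_cons R a L z
    have hL' := (fun ρ h => hL ρ (List.mem_cons_of_mem a h))
    have h2 := hL a List.mem_cons_self
    have hb := BL_ne_zero hR hr (a :: L) hL (z := z) (by linarith)
    rw [BL_cons] at hb
    have hb1 := left_ne_zero_of_mul hb
    rw [this, logDeriv_mul z hb1 (right_ne_zero_of_mul hb) (by fun_prop) (BL_diff R L z)]
    have hd : deriv (fun z => ((R:ℂ)^2 - (starRingEnd ℂ) a * z) / R) z = -(starRingEnd ℂ) a / R := by
      have : HasDerivAt (fun z => ((R:ℂ)^2 - (starRingEnd ℂ) a * z) / R) ((0 - (starRingEnd ℂ) a * 1) / R) z :=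
        ((hasDerivAt_const z _).sub ((hasDerivAt_id z).const_mul _)).div_const _
      rw [this.deriv]; ring
    have hpos : 0 < R^2 - r^2 := by nlinarith
    have h1 : ‖logDeriv (fun z => ((R:ℂ)^2 - (starRingEnd ℂ) a * z) / R) z‖ ≤ r / (R^2 - r^2) := by
      have hRc : (R:ℂ) ≠ 0 := by exact_mod_cast hR.ne'
      have hn : ((R:ℂ)^2 - (starRingEnd ℂ) a * z) ≠ 0 := by
        intro h; apply hb1; rw [h]; simp
      have e : -(starRingEnd ℂ) a / R / (((R:ℂ)^2 - (starRingEnd ℂ) a * z) / R)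
          = -(starRingEnd ℂ) a / ((R:ℂ)^2 - (starRingEnd ℂ) a * z) := by
        field_simp
      rw [logDeriv_apply, hd, e, norm_div, norm_neg, RCLike.norm_conj]
      have h5 : R^2 - r^2 ≤ ‖(R:ℂ)^2 - (starRingEnd ℂ) a * z‖ := by
        have := norm_sub_norm_le ((R:ℂ)^2) ((starRingEnd ℂ) a * z)
        rw [norm_mul, RCLike.norm_conj, norm_pow, Complex.norm_real, Real.norm_eq_abs,
          abs_of_pos hR] at this
        have h6 : ‖a‖ * ‖z‖ ≤ r * r := by gcongr
        nlinarith
      gcongr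
    calc _ ≤ _ := norm_add_le _ _
      _ ≤ r / (R^2 - r^2) + L.length * (r / (R^2 - r^2)) := add_le_add h1 (ih hL')
      _ = _ := by rw [List.length_cons]; push_cast; ring

lemma order_PL_mul (L : List ℂ) {g : ℂ → ℂ} (hg : Differentiable ℂ g) {a : ℂ} (ha : g a ≠ 0) :
    analyticOrderAt (fun z => PL L z * g z) a = L.count a := by
  induction L with
  | nil =>
    have : (fun z => PL [] z * g z) = g := by funext z; simp [PL]
    rw [this, List.count_nil]
    exact (hg.analyticAt a).analyticOrderAt_eq_zero.2 ha
  | cons b L ih =>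
    have : (fun z => PL (b :: L) z * g z) = (fun z => z - b) * (fun z => PL L z * g z) := by
      funext z; simp [PL_cons, mul_assoc]
    have hd : Differentiable ℂ (fun z => PL L z * g z) := (PL_diff L).mul hg
    rw [this, analyticOrderAt_mul (by fun_prop) (hd.analyticAt a), ih]
    by_cases hab : b = a
    · subst hab
      have := analyticOrderAt_centeredMonomial (n := 1) (z₀ := b)
      rw [List.count_cons_self]
      have e : (fun z => z - b) = ((fun z => z - b) ^ 1) := by simp
      have e2 : analyticOrderAt (fun z => z - b) b = 1 := by rw [e]; exact_mod_cast this
      rw [e2]; push_cast; ring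
    · rw [List.count_cons_of_ne hab]
      have : analyticOrderAt (fun z => z - b) a = 0 :=
        (AnalyticAt.analyticOrderAt_eq_zero (by fun_prop)).2 (sub_ne_zero.2 (Ne.symm hab))
      rw [this, zero_add]

lemma BL_max {R M : ℝ} (hR : 0 < R) (L : List ℂ) {f g : ℂ → ℂ} (hg : Differentiable ℂ g)
    (hfg : ∀ z, f z = PL L z * g z) (hM : ∀ z, ‖z‖ = R → ‖f z‖ ≤ M) {z : ℂ} (hz : ‖z‖ ≤ R) :
    ‖BL R L z * g z‖ ≤ M := by
  refine Complex.norm_le_of_forall_mem_frontier_norm_le (f := fun z => BL R L z * g z)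
    (U := Metric.ball 0 R) Metric.isBounded_ball
    (((BL_diff R L).mul hg).diffContOnCl) ?_ ?_
  · intro w hw
    rw [frontier_ball _ hR.ne', mem_sphere_zero_iff_norm] at hw
    have := hM w hw
    rw [hfg w, norm_mul] at this
    rwa [norm_mul, norm_BL_eq hR L hw]
  · rw [closure_ball _ hR.ne']; simpa using hz

/-- Existence of the full factorisation on the closed ball of radius `r`. -/
lemma exists_fac {r R M : ℝ} (hr0 : 0 < r) (hr : r < R) {f : ℂ → ℂ} (hf : Differentiable ℂ f)
    (hf0 : 1 ≤ ‖f 0‖) (hM : ∀ z, ‖z‖ = R → ‖f z‖ ≤ M) :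
    ∃ (L : List ℂ) (g : ℂ → ℂ), Differentiable ℂ g ∧ (∀ z, f z = PL L z * g z) ∧
      (∀ ρ ∈ L, ‖ρ‖ ≤ r) ∧ (∀ z, ‖z‖ ≤ r → g z ≠ 0) ∧ (R / r) ^ L.length ≤ M := by
  have hR : 0 < R := hr0.trans hr
  have key : ∀ (L : List ℂ) (g : ℂ → ℂ), Differentiable ℂ g → (∀ z, f z = PL L z * g z) →
      (∀ ρ ∈ L, ‖ρ‖ ≤ r) → (R / r) ^ L.length ≤ M := by
    intro L g hg hfg hL
    have h1 := BL_max hR L hg hfg hM (z := 0) (by simpa using hR.le)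
    rw [BL_zero hR, norm_mul, norm_pow, Complex.norm_real, Real.norm_eq_abs, abs_of_pos hR] at h1
    have h2 := norm_PL_zero_le L hL hr0.le
    rw [hfg 0, norm_mul] at hf0
    have h3 : 1 ≤ r ^ L.length * ‖g 0‖ := hf0.trans (by gcongr)
    rw [div_pow, div_le_iff₀ (by positivity)]
    calc R ^ L.length ≤ R ^ L.length * (r ^ L.length * ‖g 0‖) := le_mul_of_one_le_right (by positivity) h3
      _ = (R ^ L.length * ‖g 0‖) * r ^ L.length := by ring
      _ ≤ _ := by gcongr
  let Q : ℕ → Prop := fun n => ∃ (L : List ℂ) (g : ℂ → ℂ), L.length = n ∧ Differentiable ℂ g ∧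
      (∀ z, f z = PL L z * g z) ∧ (∀ ρ ∈ L, ‖ρ‖ ≤ r)
  have hQ0 : Q 0 := ⟨[], f, rfl, hf, by simp [PL], by simp⟩
  obtain ⟨B, hB⟩ := pow_unbounded_of_one_lt M ((one_lt_div hr0).2 hr)
  have hQB : ∀ n, Q n → n ≤ B := by
    rintro n ⟨L, g, rfl, hg, hfg, hL⟩
    by_contra hcon
    have h1 := key L g hg hfg hL
    have h2 : (R / r) ^ B ≤ (R / r) ^ L.length :=
      pow_le_pow_right₀ ((one_lt_div hr0).2 hr).le (by omega)
    linarith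
  classical
  have hfin := Nat.findGreatest_spec (P := Q) (Nat.zero_le B) hQ0
  have hmax : ¬ Q (Nat.findGreatest Q B + 1) := by
    intro h
    have := Nat.le_findGreatest (hQB _ h) h
    omega
  obtain ⟨L, g, hlen, hg, hfg, hL⟩ := hfin
  refine ⟨L, g, hg, hfg, hL, ?_, key L g hg hfg hL⟩
  intro z hz hgz
  apply hmax
  refine ⟨z :: L, dslope g z, by simp [hlen], ?_, ?_, ?_⟩
  · rw [← differentiableOn_univ] at hg ⊢
    exact (Complex.differentiableOn_dslope Filter.univ_mem).2 hg
  · intro w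
    have := sub_smul_dslope g z w
    rw [smul_eq_mul, hgz, sub_zero] at this
    rw [hfg w, PL_cons, ← this]; ring
  · intro ρ h
    rcases List.mem_cons.1 h with h | h
    · rw [h]; exact hz
    · exact hL ρ h

/-- Bound of the logarithmic derivative of a zero free function. -/
lemma logDeriv_bound {r1 r2 B : ℝ} (h1 : 0 < r1) (h2 : r1 < r2) (hB : 0 < B) {k : ℂ → ℂ}
    (hk : Differentiable ℂ k) (hk0 : ∀ z, ‖z‖ < r2 → k z ≠ 0) (h0 : 1 ≤ ‖k 0‖)
    (hM : ∀ z, ‖z‖ < r2 → ‖k z‖ ≤ Real.exp B) {z : ℂ} (hz : ‖z‖ ≤ r1) :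
    ‖logDeriv k z‖ ≤ 8 * B * r2 / (r2 - r1) ^ 2 := by
  have hlog : DifferentiableOn ℂ (logDeriv k) (Metric.ball 0 r2) := by
    intro w hw
    rw [mem_ball_zero_iff] at hw
    exact ((hk.deriv w).div (hk w) (hk0 w hw)).differentiableWithinAt
  obtain ⟨l0, hl0⟩ := hlog.isExactOn_ball
  set l : ℂ → ℂ := fun w => l0 w - l0 0 with hl
  have hld : ∀ w, ‖w‖ < r2 → HasDerivAt l (logDeriv k w) w := by
    intro w hw
    exact (hl0 w (by simpa using hw)).sub_const _
  have hldiff : DifferentiableOn ℂ l (Metric.ball 0 r2) := fun w hw =>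
    (hld w (by simpa using hw)).differentiableAt.differentiableWithinAt
  have hl00 : l 0 = 0 := by simp [hl]
  have hconst : ∀ w, ‖w‖ < r2 → k w = k 0 * Complex.exp (l w) := by
    intro w hw
    have hd : ∀ u ∈ Metric.ball (0:ℂ) r2, HasDerivAt (fun u => k u * Complex.exp (-l u)) 0 u := by
      intro u hu
      rw [mem_ball_zero_iff] at hu
      have := (hk u).hasDerivAt.mul ((hld u hu).neg.cexp)
      have hku := hk0 u hu
      have e : deriv k u * Complex.exp ((-l) u) + k u * (Complex.exp ((-l) u) * -logDeriv k u) = 0 := by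
        rw [logDeriv_apply]; field_simp; ring
      rw [e] at this
      exact this
    have := IsOpen.is_const_of_deriv_eq_zero Metric.isOpen_ball
      ((convex_ball (0:ℂ) r2).isPreconnected)
      (f := fun u => k u * Complex.exp (-l u))
      (fun u hu => (hd u hu).differentiableAt.differentiableWithinAt)
      (fun u hu => (hd u hu).deriv) (x := w) (y := 0) (by simpa using hw) (by simp; linarith)
    simp only [hl00, neg_zero, Complex.exp_zero, mul_one] at this
    rw [← this, mul_assoc, ← Complex.exp_add]; simp
  have hre : Set.MapsTo l (Metric.ball 0 r2) {z | z.re ≤ B} := by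
    intro w hw
    rw [mem_ball_zero_iff] at hw
    have := hM w hw
    rw [hconst w hw, norm_mul, Complex.norm_exp] at this
    have h3 : Real.exp (l w).re ≤ Real.exp B :=
      (le_mul_of_one_le_left (Real.exp_pos _).le h0).trans this
    exact Real.exp_le_exp.1 h3
  have hr2 : 0 < r2 := h1.trans h2
  set d := (r2 - r1) / 2 with hd
  have hdpos : 0 < d := by rw [hd]; linarith
  have hsub : ∀ w ∈ Metric.closedBall z d, ‖w‖ ≤ r1 + d := by
    intro w hw
    rw [mem_closedBall_iff_norm] at hw
    have := norm_add_le (w - z) z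
    rw [sub_add_cancel] at this
    linarith
  have hcb := Complex.norm_deriv_le_of_forall_mem_sphere_norm_le (f := l) (c := z) (R := d)
    (C := 2 * B * r2 / d) hdpos
    (by
      apply DifferentiableOn.diffContOnCl
      rw [closure_ball _ hdpos.ne']
      exact hldiff.mono (fun w hw => by
        have := hsub w hw
        rw [mem_ball_zero_iff]; linarith))
    (by
      intro w hw
      have hw1 := hsub w (Metric.sphere_subset_closedBall hw)
      have := Complex.borelCaratheodory_zero hB hldiff hre hr2 (z := w)
        (by rw [mem_ball_zero_iff]; linarith) hl00
      refine this.trans ?_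
      have : d ≤ r2 - ‖w‖ := by linarith
      have : ‖w‖ ≤ r2 := by linarith
      gcongr)
  rw [(hld z (by linarith)).deriv] at hcb
  refine hcb.trans (le_of_eq ?_)
  have : r2 - r1 ≠ 0 := by linarith
  rw [hd]; field_simp; ring

/-- The local lemma at centre `0`. -/
lemma local_zero {r1 r2 R : ℝ} (h1 : 0 < r1) (h2 : r1 < r2) (h3 : r2 < R) :
    ∃ C : ℝ, 0 < C ∧ ∀ (f : ℂ → ℂ) (B : ℝ), Differentiable ℂ f → 0 < B → 1 ≤ ‖f 0‖ →
      (∀ z, ‖z‖ = R → ‖f z‖ ≤ Real.exp B) →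
      ∃ S : Finset ℂ, (∀ ρ, ρ ∈ S ↔ f ρ = 0 ∧ ‖ρ‖ ≤ r2) ∧
        (∑ ρ ∈ S, (analyticOrderNatAt f ρ : ℝ)) ≤ C * B ∧
        ∀ z, ‖z‖ ≤ r1 → f z ≠ 0 →
          ‖logDeriv f z - ∑ ρ ∈ S, (analyticOrderNatAt f ρ : ℂ) / (z - ρ)‖ ≤ C * B := by
  have hr2 : 0 < r2 := h1.trans h2
  have hR : 0 < R := hr2.trans h3
  have hq : 0 < Real.log (R / r2) := Real.log_pos ((one_lt_div hr2).2 h3)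
  have hpos : 0 < R^2 - r2^2 := by nlinarith
  set C1 := 1 / Real.log (R / r2) with hC1
  set C2 := r2 / (R^2 - r2^2) with hC2
  set C3 := 8 * r2 / (r2 - r1) ^ 2 with hC3
  have hC1p : 0 < C1 := by positivity
  have hC2p : 0 < C2 := by positivity
  have hC3p : 0 < C3 := by
    have : 0 < r2 - r1 := by linarith
    positivity
  refine ⟨C1 + C1 * C2 + C3, by positivity, ?_⟩
  intro f B hf hB hf0 hM
  obtain ⟨L, g, hg, hfg, hL, hgn, hlen⟩ := exists_fac hr2 h3 hf hf0 hM
  have hlenB : (L.length : ℝ) ≤ C1 * B := by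
    have := Real.log_le_log (by positivity) hlen
    rw [Real.log_pow, Real.log_exp] at this
    rw [hC1, one_div, inv_mul_eq_div, le_div_iff₀ hq]; exact this
  have hord : ∀ ρ, ‖ρ‖ ≤ r2 → analyticOrderNatAt f ρ = L.count ρ := by
    intro ρ hρ
    have : f = fun z => PL L z * g z := funext hfg
    rw [analyticOrderNatAt, this, order_PL_mul L hg (hgn ρ hρ)]; simp
  have hmem : ∀ ρ, ρ ∈ L.toFinset ↔ f ρ = 0 ∧ ‖ρ‖ ≤ r2 := by
    intro ρ
    rw [List.mem_toFinset]
    constructor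
    · intro h
      exact ⟨by rw [hfg, PL_eq_zero L h, zero_mul], hL ρ h⟩
    · rintro ⟨h, hρ⟩
      by_contra hn
      rw [hfg] at h
      exact mul_ne_zero (PL_ne_zero L hn) (hgn ρ hρ) h
  refine ⟨L.toFinset, hmem, ?_, ?_⟩
  · have : (∑ ρ ∈ L.toFinset, (analyticOrderNatAt f ρ : ℝ)) = L.length := by
      rw [← List.sum_toFinset_count_eq_length L]
      push_cast
      exact Finset.sum_congr rfl (fun ρ h => by rw [hord ρ ((hmem ρ).1 h).2])
    rw [this]
    refine hlenB.trans ?_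
    have : 0 ≤ (C1 * C2 + C3) * B := by positivity
    nlinarith
  · intro z hz hfz
    have hzL : z ∉ L := fun h => hfz (by rw [hfg, PL_eq_zero L h, zero_mul])
    have hsum : ∑ ρ ∈ L.toFinset, (analyticOrderNatAt f ρ : ℂ) / (z - ρ)
        = (L.map (fun ρ => 1 / (z - ρ))).sum := by
      rw [Finset.sum_list_map_count]
      exact Finset.sum_congr rfl (fun ρ h => by
        rw [hord ρ ((hmem ρ).1 h).2, nsmul_eq_mul]; ring)
    have hgz := hgn z (by linarith)
    have hfe : f = fun z => PL L z * g z := funext hfg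
    have e1 : logDeriv f z = logDeriv (PL L) z + logDeriv g z := by
      conv_lhs => rw [hfe]
      exact logDeriv_mul z (PL_ne_zero L hzL) hgz (PL_diff L z) (hg z)
    have hbz := BL_ne_zero hR h3 L hL (z := z) (by linarith)
    have e2 : logDeriv (fun z => BL R L z * g z) z = logDeriv (BL R L) z + logDeriv g z :=
      logDeriv_mul z hbz hgz (BL_diff R L z) (hg z)
    rw [hsum, e1, logDeriv_PL L hzL, add_sub_cancel_left]
    have b1 := norm_logDeriv_BL hR h3 hr2 L hL (z := z) (by linarith)
    have b2 := logDeriv_bound h1 h2 hB (k := fun z => BL R L z * g z) ((BL_diff R L).mul hg)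
      (fun w hw => mul_ne_zero (BL_ne_zero hR h3 L hL (by linarith)) (hgn w hw.le))
      (by
        have hle := norm_PL_zero_le L hL hr2.le
        have h5 : r2 ^ L.length ≤ R ^ L.length := by gcongr
        rw [norm_mul, BL_zero hR, norm_pow, Complex.norm_real, Real.norm_eq_abs, abs_of_pos hR]
        rw [hfg 0, norm_mul] at hf0
        refine hf0.trans ?_
        gcongr
        exact hle.trans h5)
      (fun w hw => BL_max hR L hg hfg hM (by linarith)) hz
    have e3 : logDeriv g z = logDeriv (fun z => BL R L z * g z) z - logDeriv (BL R L) z := by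
      rw [e2]; ring
    rw [e3]
    calc _ ≤ _ := norm_sub_le _ _
      _ ≤ 8 * B * r2 / (r2 - r1) ^ 2 + L.length * C2 := add_le_add b2 b1
      _ ≤ C3 * B + (C1 * B) * C2 := by
          apply add_le_add
          · apply le_of_eq; rw [hC3]; ring
          · gcongr
      _ ≤ _ := by nlinarith [mul_pos hC1p hB]

/-- The local lemma at centre `c`. -/
lemma local_center {r1 r2 R : ℝ} (h1 : 0 < r1) (h2 : r1 < r2) (h3 : r2 < R) :
    ∃ C : ℝ, 0 < C ∧ ∀ (f : ℂ → ℂ) (c : ℂ) (B : ℝ), Differentiable ℂ f → 0 < B → f c ≠ 0 →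
      (∀ z, ‖z - c‖ = R → ‖f z‖ ≤ Real.exp B * ‖f c‖) →
      ∃ S : Finset ℂ, (∀ ρ, ρ ∈ S ↔ f ρ = 0 ∧ ‖ρ - c‖ ≤ r2) ∧
        (∑ ρ ∈ S, (analyticOrderNatAt f ρ : ℝ)) ≤ C * B ∧
        ∀ z, ‖z - c‖ ≤ r1 → f z ≠ 0 →
          ‖logDeriv f z - ∑ ρ ∈ S, (analyticOrderNatAt f ρ : ℂ) / (z - ρ)‖ ≤ C * B := by
  obtain ⟨C, hC, H⟩ := local_zero h1 h2 h3
  refine ⟨C, hC, ?_⟩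
  intro f c B hf hB hfc hM
  set k : ℂ → ℂ := fun z => (f c)⁻¹ * f (z + c) with hk
  have hkd : Differentiable ℂ k := by
    have : Differentiable ℂ (fun z => f (z + c)) := hf.comp (by fun_prop)
    exact this.const_mul _
  have hk0 : 1 ≤ ‖k 0‖ := by simp [hk, hfc]
  obtain ⟨S, hS1, hS2, hS3⟩ := H k B hkd hB hk0 (by
    intro z hz
    have := hM (z + c) (by simpa using hz)
    rw [hk]; simp only [norm_mul, norm_inv]
    rw [inv_mul_le_iff₀ (norm_pos_iff.2 hfc)]; linarith)
  have hord : ∀ z, analyticOrderNatAt k z = analyticOrderNatAt f (z + c) := by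
    intro z
    have e : k = (fun _ => (f c)⁻¹) * (f ∘ (fun z => z + c)) := by funext z; simp [hk]
    have hfa : AnalyticAt ℂ f (z + c) := hf.analyticAt _
    have hcomp : AnalyticAt ℂ (f ∘ (fun z => z + c)) z :=
      AnalyticAt.comp (g := f) (f := fun z => z + c) hfa (by fun_prop)
    rw [analyticOrderNatAt, analyticOrderNatAt, e, analyticOrderAt_mul analyticAt_const hcomp,
      analyticOrderAt_comp_of_deriv_ne_zero (by fun_prop) (by simp),
      analyticAt_const.analyticOrderAt_eq_zero.2 (inv_ne_zero hfc), zero_add]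
  have hinj : Function.Injective (fun z : ℂ => z + c) := add_left_injective c
  have hlog : ∀ z, logDeriv k z = logDeriv f (z + c) := by
    intro z
    have hfd := (hf (z + c)).hasDerivAt.comp_add_const z c
    have : HasDerivAt k ((f c)⁻¹ * deriv f (z + c)) z := hfd.const_mul _
    rw [logDeriv_apply, logDeriv_apply, this.deriv]
    simp only [hk]
    rw [mul_div_mul_left _ _ (inv_ne_zero hfc)]
  refine ⟨S.map ⟨_, hinj⟩, ?_, ?_, ?_⟩
  · intro ρ
    simp only [Finset.mem_map, Function.Embedding.coeFn_mk]
    constructor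
    · rintro ⟨a, ha, rfl⟩
      have := (hS1 a).1 ha
      simp only [hk, mul_eq_zero, inv_eq_zero, hfc, false_or] at this
      simpa using this
    · rintro ⟨h, h'⟩
      exact ⟨ρ - c, (hS1 _).2 ⟨by simp [hk, h], h'⟩, by simp⟩
  · simpa [hord] using hS2
  · intro z hz hfz
    have := hS3 (z - c) hz (by simpa [hk, hfc] using hfz)
    rw [hlog] at this
    simp only [sub_add_cancel, hord] at this
    have hsum : ∑ ρ ∈ S.map ⟨_, hinj⟩, (analyticOrderNatAt f ρ : ℂ) / (z - ρ)
        = ∑ x ∈ S, (analyticOrderNatAt f (x + c) : ℂ) / (z - c - x) := by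
      rw [Finset.sum_map]
      refine Finset.sum_congr rfl (fun ρ _ => ?_)
      simp only [Function.Embedding.coeFn_mk]
      rw [show z - (ρ + c) = z - c - ρ by ring]
    rw [hsum]
    exact this

end Zd
end

end

section
open MeasureTheory Filter Topology

noncomputable section
namespace Zd

/-- `(s-1) ζ(s)`, completed at `s = 1`. -/
def Fz : ℂ → ℂ := Function.update (fun s => (s - 1) * riemannZeta s) 1 1

lemma Fz_one : Fz 1 = 1 := by simp [Fz]

lemma Fz_of_ne {s : ℂ} (hs : s ≠ 1) : Fz s = (s - 1) * riemannZeta s := by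
  simp [Fz, Function.update_of_ne hs]

lemma Fz_diff : Differentiable ℂ Fz := by
  intro s
  by_cases hs : s = 1
  · subst hs
    refine (Complex.analyticAt_of_differentiable_on_punctured_nhds_of_continuousAt ?_ ?_).differentiableAt
    · filter_upwards [self_mem_nhdsWithin] with z hz
      have h1 : DifferentiableAt ℂ (fun s => (s - 1) * riemannZeta s) z :=
        (by fun_prop : DifferentiableAt ℂ (fun s : ℂ => s - 1) z).mul (differentiableAt_riemannZeta hz)
      refine h1.congr_of_eventuallyEq ?_
      filter_upwards [isOpen_ne.mem_nhds hz] with w hw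
      exact Fz_of_ne hw
    · exact continuousAt_update_same.2 riemannZeta_residue_one
  · have h1 : DifferentiableAt ℂ (fun s => (s - 1) * riemannZeta s) s :=
        (by fun_prop : DifferentiableAt ℂ (fun s : ℂ => s - 1) s).mul (differentiableAt_riemannZeta hs)
    refine h1.congr_of_eventuallyEq ?_
    filter_upwards [isOpen_ne.mem_nhds hs] with w hw
    exact Fz_of_ne hw

/-- fractional part, cut to `x > 1` -/
def gfr : ℝ → ℂ := (Set.Ioi (1:ℝ)).indicator (fun x => ((Int.fract x : ℝ) : ℂ))

lemma gfr_meas : Measurable gfr :=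
  (Complex.measurable_ofReal.comp measurable_fract).indicator measurableSet_Ioi

lemma gfr_norm_le (x : ℝ) : ‖gfr x‖ ≤ 1 := by
  unfold gfr
  by_cases hx : x ∈ Set.Ioi (1:ℝ)
  · rw [Set.indicator_of_mem hx, Complex.norm_real, Real.norm_of_nonneg (Int.fract_nonneg x)]
    exact (Int.fract_lt_one x).le
  · rw [Set.indicator_of_notMem hx]; simp

lemma gfr_locint : LocallyIntegrableOn gfr (Set.Ioi 0) := by
  apply LocallyIntegrable.locallyIntegrableOn
  have : LocallyIntegrable (fun _ : ℝ => (1:ℝ)) := locallyIntegrable_const _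
  exact this.mono gfr_meas.aestronglyMeasurable (Eventually.of_forall fun x => by simpa using gfr_norm_le x)

lemma gfr_top : gfr =O[atTop] (fun x : ℝ => x ^ (-(0:ℝ))) := by
  simp only [neg_zero, Real.rpow_zero]
  exact Asymptotics.isBigO_of_le _ (fun x => by simpa using gfr_norm_le x)

lemma gfr_bot (b : ℝ) : gfr =O[𝓝[>] 0] (fun x : ℝ => x ^ (-b)) := by
  refine Asymptotics.IsBigO.congr' (Asymptotics.isBigO_zero _ _) ?_ EventuallyEq.rfl
  have : Set.Iio (1:ℝ) ∈ 𝓝[>] (0:ℝ) := mem_nhdsWithin_of_mem_nhds (Iio_mem_nhds one_pos)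
  filter_upwards [this] with x hx
  have hx' : x < 1 := hx
  simp [gfr, hx'.le]

def Wz (s : ℂ) : ℂ := mellin gfr (-s)

lemma Wz_diff {s : ℂ} (hs : 0 < s.re) : DifferentiableAt ℂ Wz s := by
  have : DifferentiableAt ℂ (mellin gfr) (-s) :=
    mellin_differentiableAt_of_isBigO_rpow gfr_locint gfr_top (by simpa using hs)
      (gfr_bot (-s.re - 1)) (by simp)
  exact this.comp s differentiable_neg.differentiableAt

lemma Wz_eq (s : ℂ) : Wz s = ∫ x in Set.Ioi (1:ℝ), (x:ℂ) ^ (-s - 1) * ((Int.fract x : ℝ) : ℂ) := by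
  unfold Wz mellin
  have : ∀ x : ℝ, (x:ℂ) ^ (-s - 1) • gfr x
      = (Set.Ioi (1:ℝ)).indicator (fun x : ℝ => (x:ℂ) ^ (-s - 1) * ((Int.fract x : ℝ) : ℂ)) x := by
    intro x
    unfold gfr
    by_cases hx : x ∈ Set.Ioi (1:ℝ)
    · rw [Set.indicator_of_mem hx, Set.indicator_of_mem hx, smul_eq_mul]
    · rw [Set.indicator_of_notMem hx, Set.indicator_of_notMem hx]; simp
  simp_rw [this]
  rw [setIntegral_indicator measurableSet_Ioi]
  congr 2
  ext x; simp

lemma Wz_norm {s : ℂ} (hs : 0 < s.re) : ‖Wz s‖ ≤ 1 / s.re := by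
  rw [Wz_eq]
  have hI := integral_Ioi_rpow_of_lt (a := -s.re - 1) (by linarith) one_pos
  have : (1:ℝ) / s.re = ∫ t in Set.Ioi (1:ℝ), t ^ (-s.re - 1) := by
    rw [hI]; simp
  rw [this]
  refine norm_integral_le_of_norm_le (integrableOn_Ioi_rpow_of_lt (by linarith) one_pos) ?_
  filter_upwards [ae_restrict_mem measurableSet_Ioi] with x hx
  have hx0 : (0:ℝ) < x := lt_trans one_pos hx
  rw [norm_mul, Complex.norm_cpow_eq_rpow_re_of_pos hx0, Complex.norm_real,
    Real.norm_of_nonneg (Int.fract_nonneg x)]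
  have := (Int.fract_lt_one x).le
  simp only [Complex.sub_re, Complex.neg_re, Complex.one_re]
  exact mul_le_of_le_one_right (by positivity) this

lemma Wz_real_nonneg {x : ℝ} : ∃ w : ℝ, 0 ≤ w ∧ Wz x = w := by
  refine ⟨∫ t in Set.Ioi (1:ℝ), t ^ (-x - 1) * Int.fract t, ?_, ?_⟩
  · refine setIntegral_nonneg measurableSet_Ioi (fun t ht => ?_)
    have : (0:ℝ) < t := lt_trans one_pos ht
    exact mul_nonneg (by positivity) (Int.fract_nonneg t)
  · rw [Wz_eq, ← integral_complex_ofReal]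
    refine setIntegral_congr_fun measurableSet_Ioi (fun t ht => ?_)
    have : (0:ℝ) < t := lt_trans one_pos ht
    push_cast [Complex.ofReal_cpow this.le]
    rfl

lemma zeta_eq_W {s : ℂ} (hs : 1 < s.re) : riemannZeta s = s / (s - 1) - s * Wz s := by
  have hO : (fun n : ℕ => ∑ k ∈ Finset.Icc 1 n, ‖(1 : ℕ → ℂ) k‖) =O[atTop]
      fun n => (n : ℝ) ^ (1:ℝ) := by
    refine Asymptotics.isBigO_of_le _ (fun n => by simp)
  rw [← LSeries_one_eq_riemannZeta hs, LSeries_eq_mul_integral' 1 zero_le_one hs hO, Wz_eq]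
  have hs1 : s - 1 ≠ 0 := by
    intro h; rw [sub_eq_zero] at h; rw [h] at hs; simp at hs
  have h1 : ∫ t in Set.Ioi (1:ℝ), (∑ k ∈ Finset.Icc 1 ⌊t⌋₊, (1 : ℕ → ℂ) k) * (t:ℂ) ^ (-(s + 1))
      = (∫ t in Set.Ioi (1:ℝ), (t:ℂ) ^ (-s)) -
        ∫ x in Set.Ioi (1:ℝ), (x:ℂ) ^ (-s - 1) * ((Int.fract x : ℝ) : ℂ) := by
    rw [← integral_sub]
    · refine setIntegral_congr_fun measurableSet_Ioi (fun t ht => ?_)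
      have ht0 : (0:ℝ) < t := lt_trans one_pos ht
      have htc : (t:ℂ) ≠ 0 := by exact_mod_cast ht0.ne'
      simp only [Pi.one_apply, Finset.sum_const, Nat.card_Icc, add_tsub_cancel_right, nsmul_eq_mul, mul_one]
      have e1 : ((⌊t⌋₊ : ℕ) : ℂ) = (t:ℂ) - ((Int.fract t : ℝ) : ℂ) := by
        have : ((⌊t⌋₊ : ℕ) : ℝ) = t - Int.fract t := by
          rw [natCast_floor_eq_intCast_floor ht0.le]; rw [Int.self_sub_fract]
        rw [← Complex.ofReal_sub, ← this]; simp
      have e2 : (t:ℂ) ^ (-s) = t * (t:ℂ) ^ (-s - 1) := by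
        rw [show -s = 1 + (-s - 1) by ring, Complex.cpow_add _ _ htc, Complex.cpow_one]
        congr 2; ring
      rw [e1, e2, show -(s + 1) = -s - 1 by ring]; ring
    · exact integrableOn_Ioi_cpow_of_lt (by simpa using hs) one_pos
    · have : IntegrableOn (fun t : ℝ => t ^ (-s.re - 1)) (Set.Ioi 1) :=
        integrableOn_Ioi_rpow_of_lt (by linarith) one_pos
      refine this.mono' ?_ ?_
      · refine AEStronglyMeasurable.mul ?_ (Complex.measurable_ofReal.comp measurable_fract).aestronglyMeasurable
        exact (integrableOn_Ioi_cpow_of_lt (a := -s - 1) (by simp; linarith) one_pos).aestronglyMeasurable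
      · filter_upwards [ae_restrict_mem measurableSet_Ioi] with x hx
        have hx0 : (0:ℝ) < x := lt_trans one_pos hx
        rw [norm_mul, Complex.norm_cpow_eq_rpow_re_of_pos hx0, Complex.norm_real,
          Real.norm_of_nonneg (Int.fract_nonneg x)]
        have := (Int.fract_lt_one x).le
        simp only [Complex.sub_re, Complex.neg_re, Complex.one_re]
        exact mul_le_of_le_one_right (by positivity) this
  rw [h1, integral_Ioi_cpow_of_lt (by simpa using hs) one_pos, mul_sub]
  congr 1
  have : -s + 1 ≠ 0 := by intro h; apply hs1; linear_combination -h
  simp only [Complex.ofReal_one, Complex.one_cpow]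
  field_simp
  ring

lemma Fz_eq_W {s : ℂ} (hs : 0 < s.re) : Fz s = s - s * (s - 1) * Wz s := by
  set U : Set ℂ := {s | 0 < s.re}
  have hU : IsOpen U := isOpen_lt continuous_const Complex.continuous_re
  have hconv : IsPreconnected U := (convex_halfSpace_re_gt 0).isPreconnected
  have h1 : AnalyticOnNhd ℂ Fz U := Fz_diff.differentiableOn.analyticOnNhd hU
  have h2 : AnalyticOnNhd ℂ (fun s => s - s * (s - 1) * Wz s) U := by
    refine DifferentiableOn.analyticOnNhd ?_ hU
    intro z hz
    have := Wz_diff (s := z) hz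
    exact (DifferentiableAt.sub (by fun_prop)
      (DifferentiableAt.mul (by fun_prop) this)).differentiableWithinAt
  refine h1.eqOn_of_preconnected_of_eventuallyEq h2 hconv (z₀ := 2) (by simp [U]) ?_ hs
  have : {s : ℂ | 1 < s.re} ∈ 𝓝 (2:ℂ) :=
    (isOpen_lt continuous_const Complex.continuous_re).mem_nhds (by simp)
  filter_upwards [this] with z hz
  have hz1 : z ≠ 1 := by rintro rfl; simp at hz
  have : z - 1 ≠ 0 := sub_ne_zero.2 hz1
  rw [Fz_of_ne hz1, zeta_eq_W hz]
  field_simp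

lemma Fz_bound {s : ℂ} (hs : 1 / 5 ≤ s.re) : ‖Fz s‖ ≤ 6 * (‖s‖ + 2) ^ 2 := by
  have h0 : 0 < s.re := by linarith
  rw [Fz_eq_W h0]
  have hW : ‖Wz s‖ ≤ 5 := (Wz_norm h0).trans (by rw [div_le_iff₀ h0]; linarith)
  have h1 : ‖s - 1‖ ≤ ‖s‖ + 1 := (norm_sub_le _ _).trans (by simp)
  have hn := norm_nonneg s
  calc ‖s - s * (s - 1) * Wz s‖ ≤ ‖s‖ + ‖s‖ * ‖s - 1‖ * ‖Wz s‖ := by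
        refine (norm_sub_le _ _).trans ?_; rw [norm_mul, norm_mul]
    _ ≤ ‖s‖ + ‖s‖ * (‖s‖ + 1) * 5 := by gcongr
    _ ≤ _ := by nlinarith

lemma Fz_real_ne {x : ℝ} (h0 : 0 < x) (h1 : x < 1) : Fz x ≠ 0 := by
  obtain ⟨w, hw, e⟩ := Wz_real_nonneg (x := x)
  rw [Fz_eq_W (by simpa using h0), e]
  have : (x:ℂ) - x * (x - 1) * w = ((x - x * (x - 1) * w : ℝ) : ℂ) := by push_cast; ring
  rw [this]
  norm_cast
  have : 0 ≤ x * (1 - x) * w := by have := sub_pos.2 h1; positivity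
  nlinarith

lemma Fz_ne_of_one_le {s : ℂ} (hs : 1 ≤ s.re) : Fz s ≠ 0 := by
  by_cases h : s = 1
  · rw [h, Fz_one]; exact one_ne_zero
  · rw [Fz_of_ne h]
    exact mul_ne_zero (sub_ne_zero.2 h) (riemannZeta_ne_zero_of_one_le_re hs)

lemma Fz_zero_iff {s : ℂ} (h1 : s.re < 1) : Fz s = 0 ↔ riemannZeta s = 0 := by
  have h : s ≠ 1 := by rintro rfl; simp at h1
  rw [Fz_of_ne h, mul_eq_zero, sub_eq_zero]
  simp [h]

lemma zeta_two_sub_one (t : ℝ) : ‖riemannZeta (2 + t * Complex.I) - 1‖ ≤ Real.pi ^ 2 / 6 - 1 := by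
  have hs : 1 < (2 + t * Complex.I : ℂ).re := by simp
  have h := hasSum_zeta_two
  have h' : HasSum (fun n : ℕ => 1 / ((n:ℝ) + 1) ^ 2) (Real.pi ^ 2 / 6) := by
    have := (hasSum_nat_add_iff' 1).2 h
    simpa using this
  have h2 : HasSum (fun n : ℕ => 1 / ((n:ℝ) + 1 + 1) ^ 2) (Real.pi ^ 2 / 6 - 1) := by
    have := (hasSum_nat_add_iff' 1).2 h'
    simpa using this
  have hn : ∀ n : ℕ, ‖1 / ((n:ℂ) + 1) ^ (2 + t * Complex.I)‖ = 1 / ((n:ℝ) + 1) ^ 2 := by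
    intro n
    have : ((n:ℂ) + 1) = (((n:ℝ) + 1 : ℝ) : ℂ) := by push_cast; rfl
    rw [norm_div, this, Complex.norm_cpow_eq_rpow_re_of_pos (by positivity)]
    simp
  have hsum : Summable (fun n : ℕ => 1 / ((n:ℂ) + 1) ^ (2 + t * Complex.I)) := by
    refine Summable.of_norm ?_
    simp_rw [hn]; exact h'.summable
  rw [zeta_eq_tsum_one_div_nat_add_one_cpow hs, hsum.tsum_eq_zero_add]
  simp only [Nat.cast_zero, zero_add, Complex.one_cpow, div_one, add_sub_cancel_left]
  refine tsum_of_norm_bounded h2 (fun n => ?_)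
  rw [hn]; push_cast; rfl

lemma Fz_lower (t : ℝ) : 1 / 3 ≤ ‖Fz (2 + t * Complex.I)‖ := by
  have h := zeta_two_sub_one t
  have hpi := Real.pi_lt_d2
  have hp0 := Real.pi_pos
  have h1 : (2 + t * Complex.I : ℂ) ≠ 1 := by
    intro h; have := congrArg Complex.re h; simp at this
  rw [Fz_of_ne h1, norm_mul]
  have h2 : 1 ≤ ‖(2 + t * Complex.I - 1 : ℂ)‖ := by
    refine le_trans ?_ (Complex.abs_re_le_norm _)
    norm_num
  have h3 : 1 / 3 ≤ ‖riemannZeta (2 + t * Complex.I)‖ := by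
    have := norm_sub_norm_le (1:ℂ) (1 - riemannZeta (2 + t * Complex.I))
    rw [norm_sub_rev 1 (riemannZeta _)] at this
    simp at this
    nlinarith
  nlinarith

end Zd
end

end

section
open MeasureTheory Filter Topology

noncomputable section
namespace Zd

/-- multiplicity of a zero -/
def mz (ρ : ℂ) : ℕ := analyticOrderNatAt Fz ρ

lemma beta_bdd : BddAbove {x : ℝ | ∃ ρ : ℂ, riemannZeta ρ = 0 ∧ 0 < ρ.re ∧ ρ.re < 1 ∧ ρ.re = x} :=
  ⟨1, by rintro x ⟨ρ, -, -, h, rfl⟩; exact h.le⟩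

lemma re_le_beta {ρ : ℂ} (h : Fz ρ = 0) (h0 : 0 < ρ.re) : ρ.re ≤ betaZeta := by
  have h1 : ρ.re < 1 := by
    by_contra h'
    exact Fz_ne_of_one_le (not_lt.1 h') h
  unfold betaZeta
  exact le_csSup beta_bdd ⟨ρ, (Fz_zero_iff h1).1 h, h0, h1, rfl⟩

lemma windows : ∃ C > 0, ∀ τ : ℝ, ∃ S : Finset ℂ,
    (∀ ρ ∈ S, Fz ρ = 0 ∧ 0 < ρ.re ∧ ρ.re ≤ betaZeta ∧ |ρ.im - τ| ≤ 17 / 10) ∧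
    (∀ ρ, Fz ρ = 0 → ‖ρ - (2 + τ * Complex.I)‖ ≤ 17 / 10 → ρ ∈ S) ∧
    ∑ ρ ∈ S, (mz ρ : ℝ) ≤ C * Real.log (|τ| + 3) ∧
    ∀ s : ℂ, 1 / 2 ≤ s.re → s.re ≤ 2 → |s.im - τ| ≤ 1 / 2 → Fz s ≠ 0 →
      ‖logDeriv Fz s - ∑ ρ ∈ S, (mz ρ : ℂ) / (s - ρ)‖ ≤ C * Real.log (|τ| + 3) := by
  obtain ⟨C, hC, H⟩ := local_center (r1 := 8 / 5) (r2 := 17 / 10) (R := 9 / 5)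
    (by norm_num) (by norm_num) (by norm_num)
  refine ⟨C * 6, by positivity, fun τ => ?_⟩
  have hτ := abs_nonneg τ
  have hlog : 0 < Real.log (|τ| + 3) := Real.log_pos (by linarith)
  set c : ℂ := 2 + τ * Complex.I with hc
  have hlow := Fz_lower τ
  have hne : Fz c ≠ 0 := by
    intro h; rw [← hc, h] at hlow; simp at hlow; linarith
  have hcn : ‖c‖ ≤ 2 + |τ| := (norm_add_le _ _).trans (by simp)
  have hexp : Real.exp (6 * Real.log (|τ| + 3)) = (|τ| + 3) ^ 6 := by
    rw [mul_comm, ← Real.rpow_natCast, Real.rpow_def_of_pos (by linarith)]; norm_num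
  obtain ⟨S, h1, h2, h3⟩ := H Fz c (6 * Real.log (|τ| + 3)) Fz_diff (by positivity) hne (by
    intro z hz
    have hre : 1 / 5 ≤ z.re := by
      have := (Complex.abs_re_le_norm (z - c)).trans_eq hz
      rw [abs_le] at this
      simp [hc] at this
      linarith
    have hzn : ‖z‖ ≤ |τ| + 4 := by
      have := norm_sub_norm_le z c
      linarith
    rw [hexp]
    calc ‖Fz z‖ ≤ 6 * (‖z‖ + 2) ^ 2 := Fz_bound hre
      _ ≤ 6 * (2 * (|τ| + 3)) ^ 2 := by
          have := norm_nonneg z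
          gcongr; linarith
      _ = 72 * (|τ| + 3) ^ 2 * (1 / 3) := by ring
      _ ≤ (|τ| + 3) ^ 4 * (|τ| + 3) ^ 2 * ‖Fz c‖ := by
          have : (72:ℝ) ≤ (|τ| + 3) ^ 4 := by
            calc (72:ℝ) ≤ 3 ^ 4 := by norm_num
              _ ≤ _ := by gcongr; linarith
          gcongr
      _ = _ := by ring)
  refine ⟨S, ?_, ?_, ?_, ?_⟩
  · intro ρ hρ
    obtain ⟨hz, hd⟩ := (h1 ρ).1 hρ
    have ha := (Complex.abs_re_le_norm (ρ - c)).trans hd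
    have hb := (Complex.abs_im_le_norm (ρ - c)).trans hd
    simp [hc] at ha hb
    have h0 : 0 < ρ.re := by rw [abs_le] at ha; linarith
    exact ⟨hz, h0, re_le_beta hz h0, hb⟩
  · intro ρ hz hd
    exact (h1 ρ).2 ⟨hz, hd⟩
  · refine h2.trans (le_of_eq (by ring))
  · intro s hs1 hs2 hs3 hs
    refine (h3 s ?_ hs).trans (le_of_eq (by ring))
    rw [Complex.norm_eq_sqrt_sq_add_sq]
    apply Real.sqrt_le_iff.2 ⟨by norm_num, ?_⟩
    simp [hc]
    have : (s.im - τ) ^ 2 ≤ (1 / 2) ^ 2 := sq_le_sq' (by rw [abs_le] at hs3; linarith) (by rw [abs_le] at hs3; linarith)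
    nlinarith

end Zd
end

end

section
open MeasureTheory Filter Topology
open scoped Nat

noncomputable section
namespace Zd

/-- the entire completed function `s (s-1) Λ(s)` -/
def Xi (s : ℂ) : ℂ := s * (s - 1) * completedRiemannZeta₀ s + 1

lemma Xi_diff : Differentiable ℂ Xi := by
  unfold Xi
  have := differentiable_completedZeta₀
  fun_prop

lemma Xi_symm (s : ℂ) : Xi (1 - s) = Xi s := by
  unfold Xi; rw [completedRiemannZeta₀_one_sub]; ring

lemma Xi_eq {s : ℂ} (h0 : s ≠ 0) (h1 : s ≠ 1) : Xi s = s * (s - 1) * completedRiemannZeta s := by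
  unfold Xi
  rw [completedRiemannZeta_eq]
  have : s - 1 ≠ 0 := sub_ne_zero.2 h1
  have : 1 - s ≠ 0 := sub_ne_zero.2 h1.symm
  field_simp
  ring

lemma Xi_zero : Xi 0 = 1 := by simp [Xi]
lemma Xi_one : Xi 1 = 1 := by simp [Xi]

lemma completed_eq {s : ℂ} (h : 0 < s.re) :
    completedRiemannZeta s = Complex.Gammaℝ s * riemannZeta s := by
  have h0 : s ≠ 0 := by rintro rfl; simp at h
  rw [riemannZeta_def_of_ne_zero h0, mul_div_cancel₀]
  exact Complex.Gammaℝ_ne_zero_of_re_pos h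

lemma Xi_two : Xi 2 = (Real.pi / 3 : ℝ) := by
  rw [Xi_eq (by norm_num) (by norm_num), completed_eq (by norm_num), riemannZeta_two,
    Complex.Gammaℝ_def]
  have : (Real.pi : ℂ) ≠ 0 := by exact_mod_cast Real.pi_ne_zero
  norm_num [Complex.cpow_neg_one]
  field_simp
  norm_num

lemma norm_Gamma_le {s : ℂ} (h : 0 < s.re) : ‖Complex.Gamma s‖ ≤ Real.Gamma s.re := by
  rw [Complex.Gamma_eq_integral h, Real.Gamma_eq_integral h, Complex.GammaIntegral]
  refine norm_integral_le_of_norm_le (Real.GammaIntegral_convergent h) ?_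
  filter_upwards [ae_restrict_mem measurableSet_Ioi] with x hx
  have hx0 : (0:ℝ) < x := hx
  rw [norm_mul, Complex.norm_cpow_eq_rpow_re_of_pos hx0, Complex.norm_real, Real.norm_of_nonneg (Real.exp_pos _).le]
  simp

lemma Gamma_real_bound {x : ℝ} (hx : 1 / 4 ≤ x) :
    Real.Gamma x ≤ 4 * Real.exp (2 * (x + 2) ^ (3 / 2 : ℝ)) := by
  have hx0 : 0 < x := by linarith
  have e : Real.Gamma (x + 2) = (x + 1) * (x * Real.Gamma x) := by
    rw [← Real.Gamma_add_one hx0.ne', ← Real.Gamma_add_one (by linarith)]; congr 1; ring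
  have hG := Real.Gamma_pos_of_pos hx0
  set n := ⌈x⌉₊ + 1 with hn
  have hn1 : x + 1 ≤ n := by rw [hn]; push_cast; linarith [Nat.le_ceil x]
  have hn2 : (n:ℝ) ≤ x + 2 := by rw [hn]; push_cast; linarith [Nat.ceil_lt_add_one hx0.le]
  have h1 : Real.Gamma (x + 2) ≤ (n ! : ℝ) := by
    rw [← Real.Gamma_nat_eq_factorial]
    exact Real.Gamma_strictMonoOn_Ici.monotoneOn (by simp; linarith) (by simp; linarith) (by linarith)
  have hnpos : (0:ℝ) < n := by linarith
  have h2 : (n ! : ℝ) ≤ Real.exp (2 * (x + 2) ^ (3 / 2 : ℝ)) := by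
    have : (n ! : ℝ) ≤ (n:ℝ) ^ n := by exact_mod_cast Nat.factorial_le_pow n
    refine this.trans ?_
    rw [← Real.rpow_natCast, Real.rpow_def_of_pos hnpos]
    apply Real.exp_le_exp.2
    have hl := Real.log_le_rpow_div hnpos.le (ε := 1 / 2) (by norm_num)
    calc Real.log n * n ≤ (n:ℝ) ^ (1 / 2 : ℝ) / (1 / 2) * n := by gcongr
      _ = 2 * ((n:ℝ) ^ (1 / 2 : ℝ) * (n:ℝ) ^ (1:ℝ)) := by rw [Real.rpow_one]; ring
      _ = 2 * (n:ℝ) ^ (3 / 2 : ℝ) := by rw [← Real.rpow_add hnpos]; norm_num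
      _ ≤ _ := by gcongr
  have h3 : Real.Gamma x ≤ 4 * Real.Gamma (x + 2) := by rw [e]; nlinarith [mul_pos hx0 hG]
  linarith

lemma Xi_bound_half {s : ℂ} (hs : 1 / 2 ≤ s.re) :
    ‖Xi s‖ ≤ Real.exp (9 * (‖s‖ + 2) ^ (3 / 2 : ℝ)) := by
  have hn := norm_nonneg s
  set u := ‖s‖ + 2 with hu
  have hu2 : 2 ≤ u := by linarith
  have hpow : u ≤ u ^ (3 / 2 : ℝ) := by
    conv_lhs => rw [← Real.rpow_one u]
    exact Real.rpow_le_rpow_of_exponent_le (by linarith) (by norm_num)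
  by_cases h1 : s = 1
  · rw [h1, Xi_one]; simp; positivity
  have h0 : 0 < s.re := by linarith
  have hs0 : s ≠ 0 := by rintro rfl; simp at h0
  have hre : s.re ≤ ‖s‖ := (le_abs_self _).trans (Complex.abs_re_le_norm s)
  rw [Xi_eq hs0 h1, completed_eq h0]
  have e : s * (s - 1) * (Complex.Gammaℝ s * riemannZeta s) = s * Complex.Gammaℝ s * Fz s := by
    rw [Fz_of_ne h1]; ring
  rw [e, norm_mul, norm_mul]
  have hG : ‖Complex.Gammaℝ s‖ ≤ 4 * Real.exp (2 * u ^ (3 / 2 : ℝ)) := by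
    rw [Complex.Gammaℝ_def, norm_mul, Complex.norm_cpow_eq_rpow_re_of_pos Real.pi_pos]
    have a1 : Real.pi ^ (-s / 2).re ≤ 1 := by
      apply Real.rpow_le_one_of_one_le_of_nonpos (by linarith [Real.pi_gt_three])
      have : (-s / 2).re = -s.re / 2 := by simp
      rw [this]; linarith
    have hr2 : (s / 2).re = s.re / 2 := by simp
    have a2 : ‖Complex.Gamma (s / 2)‖ ≤ 4 * Real.exp (2 * u ^ (3 / 2 : ℝ)) := by
      refine (norm_Gamma_le (by rw [hr2]; linarith)).trans ?_
      rw [hr2]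
      refine (Gamma_real_bound (by linarith)).trans ?_
      gcongr
      linarith
    calc _ ≤ 1 * ‖Complex.Gamma (s / 2)‖ := by gcongr
      _ ≤ _ := by rw [one_mul]; exact a2
  have hF := Fz_bound (s := s) (by linarith)
  have h24 : (24:ℝ) ≤ Real.exp (4 * u ^ (3 / 2 : ℝ)) := by
    have : (24:ℝ) ≤ Real.exp 8 := by
      have := Real.exp_one_gt_d9
      have e8 : Real.exp 8 = Real.exp 1 ^ 8 := by rw [← Real.exp_nat_mul]; norm_num
      rw [e8]
      calc (24:ℝ) ≤ 2 ^ 8 := by norm_num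
        _ ≤ _ := by gcongr; linarith
    refine this.trans (Real.exp_le_exp.2 ?_)
    linarith
  have hu3 : u ^ 3 ≤ Real.exp (3 * u ^ (3 / 2 : ℝ)) := by
    calc u ^ 3 ≤ (Real.exp u) ^ 3 := by gcongr; linarith [Real.add_one_le_exp u]
      _ = Real.exp (3 * u) := by rw [← Real.exp_nat_mul]; norm_num
      _ ≤ _ := by gcongr
  calc ‖s‖ * ‖Complex.Gammaℝ s‖ * ‖Fz s‖
      ≤ u * (4 * Real.exp (2 * u ^ (3 / 2 : ℝ))) * (6 * u ^ 2) := by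
        gcongr; linarith
    _ = 24 * (u ^ 3 * Real.exp (2 * u ^ (3 / 2 : ℝ))) := by ring
    _ ≤ Real.exp (4 * u ^ (3 / 2 : ℝ)) * (Real.exp (3 * u ^ (3 / 2 : ℝ)) * Real.exp (2 * u ^ (3 / 2 : ℝ))) := by
        gcongr
    _ = _ := by rw [← Real.exp_add, ← Real.exp_add]; congr 1; ring

lemma Xi_bound (s : ℂ) : ‖Xi s‖ ≤ Real.exp (9 * (‖s‖ + 3) ^ (3 / 2 : ℝ)) := by
  have hn := norm_nonneg s
  by_cases h : 1 / 2 ≤ s.re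
  · refine (Xi_bound_half h).trans ?_
    gcongr; norm_num
  · rw [← Xi_symm]
    refine (Xi_bound_half (s := 1 - s) (by simp; linarith)).trans ?_
    have : ‖1 - s‖ ≤ 1 + ‖s‖ := (norm_sub_le _ _).trans (by simp)
    have h2 : ‖1 - s‖ + 2 ≤ ‖s‖ + 3 := by linarith
    exact Real.exp_le_exp.2 (by gcongr)

lemma Xi_ne_of_no_zero (H : ¬ ∃ ρ : ℂ, riemannZeta ρ = 0 ∧ 0 < ρ.re ∧ ρ.re < 1) (s : ℂ) :
    Xi s ≠ 0 := by
  have key : ∀ s : ℂ, 0 < s.re → Xi s ≠ 0 := by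
    intro s h hz
    by_cases h1 : s = 1
    · rw [h1, Xi_one] at hz; exact one_ne_zero hz
    have h0 : s ≠ 0 := by rintro rfl; simp at h
    rw [Xi_eq h0 h1, completed_eq h] at hz
    have : riemannZeta s = 0 := by
      simpa [h0, sub_ne_zero.2 h1, Complex.Gammaℝ_ne_zero_of_re_pos h] using hz
    by_cases h2 : s.re < 1
    · exact H ⟨s, this, h, h2⟩
    · exact riemannZeta_ne_zero_of_one_le_re (not_lt.1 h2) this
  by_cases h : 0 < s.re
  · exact key s h
  · rw [← Xi_symm]
    exact key _ (by simp; linarith)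

lemma exists_zero : ∃ ρ : ℂ, riemannZeta ρ = 0 ∧ 0 < ρ.re ∧ ρ.re < 1 := by
  by_contra H
  have hne := Xi_ne_of_no_zero H
  set q : ℂ → ℂ := logDeriv Xi with hq
  have hqd : Differentiable ℂ q := fun w => ((Xi_diff.deriv w).div (Xi_diff w) (hne w))
  have hb : ∀ R : ℝ, 3 ≤ R → ∀ z, ‖z‖ ≤ R → ‖q z‖ ≤ 144 * 6 * (R * R) ^ (1 / 4 : ℝ) := by
    intro R hR z hz
    have hR0 : 0 < R := by linarith
    have := logDeriv_bound (r1 := R) (r2 := 2 * R) (B := 9 * (2 * R + 3) ^ (3 / 2 : ℝ)) hR0 (by linarith)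
      (by positivity) Xi_diff (fun z _ => hne z) (by rw [Xi_zero]; simp) (by
        intro z hz
        refine (Xi_bound z).trans ?_
        gcongr) hz
    refine this.trans ?_
    have h1 : (2 * R + 3) ^ (3 / 2 : ℝ) ≤ 6 * R * R ^ (1 / 2 : ℝ) := by
      calc (2 * R + 3) ^ (3 / 2 : ℝ) ≤ (3 * R) ^ (3 / 2 : ℝ) := by gcongr; linarith
        _ = 3 * R * (3 * R) ^ (1 / 2 : ℝ) := by
            conv_rhs => rw [← Real.rpow_one_add' (by positivity) (by norm_num)]
            norm_num
        _ = 3 * R * (3 ^ (1 / 2 : ℝ) * R ^ (1 / 2 : ℝ)) := by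
            rw [Real.mul_rpow (by norm_num) hR0.le]
        _ ≤ 3 * R * (2 * R ^ (1 / 2 : ℝ)) := by
            gcongr
            rw [← Real.sqrt_eq_rpow]
            exact Real.sqrt_le_iff.2 ⟨by norm_num, by norm_num⟩
        _ = _ := by ring
    have h2 : (R * R) ^ (1 / 4 : ℝ) = R ^ (1 / 2 : ℝ) := by
      rw [← pow_two, ← Real.rpow_natCast, ← Real.rpow_mul hR0.le]; norm_num
    rw [h2, show 2 * R - R = R by ring, div_le_iff₀ (by positivity)]
    nlinarith [mul_le_mul_of_nonneg_left h1 hR0.le]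
  have hder : ∀ w, deriv q w = 0 := by
    intro w
    have hlim : Tendsto (fun R : ℝ => 144 * 6 * 2 * R ^ (-(1 / 2) : ℝ)) atTop (𝓝 (144 * 6 * 2 * 0)) :=
      (tendsto_rpow_neg_atTop (by norm_num)).const_mul _
    rw [mul_zero] at hlim
    have : ‖deriv q w‖ ≤ 0 := by
      refine ge_of_tendsto hlim ?_
      filter_upwards [eventually_ge_atTop (2 * ‖w‖ + 3)] with R hR
      have hw := norm_nonneg w
      have hR0 : 0 < R := by linarith
      have := Complex.norm_deriv_le_of_forall_mem_sphere_norm_le (f := q) (c := w) (R := R / 2)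
        (C := 144 * 6 * (R * R) ^ (1 / 4 : ℝ)) (by linarith) hqd.diffContOnCl (by
          intro z hz
          apply hb R (by linarith)
          have h1 : ‖z - w‖ = R / 2 := by simpa [dist_eq_norm] using hz
          have := norm_sub_norm_le z w
          linarith)
      refine this.trans (le_of_eq ?_)
      have h2 : (R * R) ^ (1 / 4 : ℝ) = R ^ (1 / 2 : ℝ) := by
        rw [← pow_two, ← Real.rpow_natCast, ← Real.rpow_mul hR0.le]; norm_num
      have h3 : R ^ (-(1 / 2) : ℝ) = R ^ (1 / 2 : ℝ) / R := by
        rw [← Real.rpow_sub_one hR0.ne']; norm_num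
      rw [h2, h3]; field_simp
    exact norm_le_zero_iff.1 this
  have hconst : ∀ w, q w = q 0 := fun w => is_const_of_deriv_eq_zero hqd hder w 0
  set a := q 0 with ha
  have hd : ∀ u, HasDerivAt (fun u => Xi u * Complex.exp (-(a * u))) 0 u := by
    intro u
    have h1 : HasDerivAt (fun u : ℂ => -(a * u)) (-a) u := by
      have := ((hasDerivAt_id u).const_mul a).neg
      rw [mul_one] at this
      exact this
    have := (Xi_diff u).hasDerivAt.mul h1.cexp
    have hX : deriv Xi u = a * Xi u := by
      rw [← hconst u, hq, logDeriv_apply, div_mul_cancel₀ _ (hne u)]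
    have e : deriv Xi u * Complex.exp (-(a * u)) + Xi u * (Complex.exp (-(a * u)) * -a) = 0 := by
      rw [hX]; ring
    rw [e] at this
    exact this
  have hcc := fun w => is_const_of_deriv_eq_zero (fun u => (hd u).differentiableAt)
    (fun u => (hd u).deriv) w 0
  have hX : ∀ w, Xi w = Complex.exp (a * w) := by
    intro w
    have := hcc w
    simp only [Xi_zero, mul_zero, neg_zero, Complex.exp_zero, mul_one] at this
    rw [Complex.exp_neg] at this
    field_simp at this
    exact this
  have h1 := hX 1
  have h2 := hX 2
  rw [Xi_one, mul_one] at h1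
  rw [mul_two, Complex.exp_add, ← h1, mul_one, Xi_two] at h2
  norm_cast at h2
  have := Real.pi_gt_d2
  linarith

lemma beta_ge : 1 / 2 ≤ betaZeta := by
  obtain ⟨ρ, h, h0, h1⟩ := exists_zero
  have hmem : ∀ ρ : ℂ, riemannZeta ρ = 0 → 0 < ρ.re → ρ.re < 1 → ρ.re ≤ betaZeta := by
    intro ρ h h0 h1
    exact re_le_beta ((Fz_zero_iff h1).2 h) h0
  have h2 : riemannZeta (1 - ρ) = 0 := by
    have e1 := completed_eq h0
    have e2 := completed_eq (s := 1 - ρ) (by simp; linarith)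
    rw [completedRiemannZeta_one_sub, e1, h, mul_zero] at e2
    have := Complex.Gammaℝ_ne_zero_of_re_pos (s := 1 - ρ) (by simp; linarith)
    simpa [this] using e2.symm
  have a := hmem ρ h h0 h1
  have b := hmem (1 - ρ) h2 (by simp; linarith) (by simp; linarith)
  simp at b
  linarith

lemma beta_le : betaZeta ≤ 1 := by
  unfold betaZeta
  obtain ⟨ρ, h, h0, h1⟩ := exists_zero
  refine csSup_le ⟨ρ.re, ρ, h, h0, h1, rfl⟩ ?_
  rintro x ⟨ρ, -, -, h, rfl⟩
  exact h.le

end Zd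
end

end

section
open MeasureTheory Filter Topology

noncomputable section
namespace Zd
open FourierTransform ContDiff SchwartzMap in
lemma plancherel {f : ℝ → ℂ} (h1 : Integrable f) (h2 : MemLp f 2) :
    Integrable (fun x => ‖𝓕 f x‖ ^ 2) ∧ ∫ x, ‖𝓕 f x‖ ^ 2 = ∫ x, ‖f x‖ ^ 2 := by
  set g : Lp ℂ 2 (volume : Measure ℝ) := h2.toLp f with hg
  have hgf : g =ᵐ[volume] f := h2.coeFn_toLp
  set G : Lp ℂ 2 (volume : Measure ℝ) := 𝓕 g with hG
  have hcont : Continuous (𝓕 f) :=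
    VectorFourier.fourierIntegral_continuous Real.continuous_fourierChar
      (by exact (continuous_inner : Continuous fun p : ℝ × ℝ => inner ℝ p.1 p.2)) h1
  have hae : ∀ᵐ x ∂(volume : Measure ℝ), G x = 𝓕 f x := by
    refine ae_eq_of_integral_contDiff_smul_eq ?_ hcont.locallyIntegrable ?_
    · exact (Lp.memLp G).locallyIntegrable (by norm_num)
    · intro φ hφ hs
      have hφc : ContDiff ℝ ∞ (fun x => (φ x : ℂ)) := Complex.ofRealCLM.contDiff.comp hφ
      have hsc : HasCompactSupport (fun x => (φ x : ℂ)) := hs.comp_left Complex.ofReal_zero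
      set Φ : 𝓢(ℝ, ℂ) := hsc.toSchwartzMap hφc with hΦ
      have a1 := congrArg (fun T => T Φ) (Lp.fourier_toTemperedDistribution_eq g)
      simp only [TemperedDistribution.fourier_apply, Lp.toTemperedDistribution_apply] at a1
      have a2 : ∫ x, (𝓕 Φ : 𝓢(ℝ, ℂ)) x • g x = ∫ x, (𝓕 Φ : 𝓢(ℝ, ℂ)) x • f x :=
        integral_congr_ae (by filter_upwards [hgf] with x hx; rw [hx])
      have a3 : ∫ x, (𝓕 Φ : 𝓢(ℝ, ℂ)) x • f x = ∫ x, Φ x • 𝓕 f x := by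
        have := VectorFourier.integral_fourierIntegral_smul_eq_flip (L := innerₗ ℝ) (μ := volume)
          (ν := volume) Real.continuous_fourierChar continuous_inner Φ.integrable h1
        simp only [flip_innerₗ] at this
        exact this
      have e1 : ∀ x, φ x • G x = Φ x • G x := fun x => by
        simp [hΦ]
      have e2 : ∀ x, φ x • 𝓕 f x = Φ x • 𝓕 f x := fun x => by
        simp [hΦ]
      simp_rw [e1, e2]
      rw [← a3, ← a2, a1]
  have hn : ‖G‖ = ‖g‖ := Lp.norm_fourier_eq g
  have hm : MemLp (𝓕 f) 2 := (memLp_congr_ae hae).1 (Lp.memLp G)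
  refine ⟨?_, ?_⟩
  · simpa using hm.integrable_norm_pow (by norm_num)
  · have hsq : ∀ u : Lp ℂ 2 (volume : Measure ℝ), ‖u‖ ^ 2 = ∫ x, ‖u x‖ ^ 2 := by
      intro u
      have := L2.inner_def (𝕜 := ℂ) u u
      rw [inner_self_eq_norm_sq_to_K] at this
      have h3 : ∀ x, inner ℂ (u x) (u x) = ((‖u x‖ ^ 2 : ℝ) : ℂ) := fun x => by
        rw [inner_self_eq_norm_sq_to_K]; simp
      simp_rw [h3] at this
      rw [integral_complex_ofReal] at this
      change ((‖u‖ : ℝ) : ℂ) ^ 2 = _ at this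
      rw [← Complex.ofReal_pow] at this
      exact Complex.ofReal_injective this
    have b1 := hsq G
    have b2 := hsq g
    rw [hn, b2] at b1
    calc ∫ x, ‖𝓕 f x‖ ^ 2 = ∫ x, ‖G x‖ ^ 2 :=
          integral_congr_ae (by filter_upwards [hae] with x hx; rw [hx])
      _ = ∫ x, ‖g x‖ ^ 2 := b1.symm
      _ = _ := integral_congr_ae (by filter_upwards [hgf] with x hx; rw [hx])
end Zd
end

end

section
open MeasureTheory Filter Topology

noncomputable section
namespace Zd

open FourierTransform in
lemma d_step1 {G : ℂ → ℂ} {h : ℝ → ℂ} {K : ℝ} (hm : Measurable h)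
    (hb : ∀ y > 0, ‖h y‖ ≤ K * Real.exp y)
    (hG : ∀ s : ℂ, 1 < s.re → s.re < 2 → G s = ∫ y in Set.Ioi (0:ℝ), h y * Complex.exp (-s * y))
    {σ : ℝ} (h1 : 1 < σ) (h2 : σ < 2) :
    IntegrableOn (fun y => ‖h y‖ ^ 2 * Real.exp (-2 * σ * y)) (Set.Ioi 0) ∧
    ∫ y in Set.Ioi (0:ℝ), ‖h y‖ ^ 2 * Real.exp (-2 * σ * y) =
      1 / (2 * Real.pi) * ∫ t : ℝ, ‖G (σ + t * Complex.I)‖ ^ 2 := by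
  set k : ℝ → ℂ := fun y => h y * Complex.exp (-σ * y) with hk
  set f : ℝ → ℂ := Set.indicator (Set.Ioi 0) k with hf
  have hkm : Measurable k := by fun_prop
  have hfm : Measurable f := hkm.indicator measurableSet_Ioi
  have hnorm : ∀ y : ℝ, ‖Complex.exp (-σ * y)‖ = Real.exp (-σ * y) := fun y => by
    rw [Complex.norm_exp]; simp
  have hkn : ∀ y, ‖k y‖ = ‖h y‖ * Real.exp (-σ * y) := fun y => by
    rw [hk]; simp only [norm_mul, hnorm]
  have hkb : ∀ y ∈ Set.Ioi (0:ℝ), ‖k y‖ ≤ K * Real.exp (-(σ-1) * y) := by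
    intro y hy
    rw [hkn]
    calc _ ≤ K * Real.exp y * Real.exp (-σ * y) := by gcongr; exact hb y hy
      _ = _ := by rw [mul_assoc, ← Real.exp_add]; ring_nf
  have hk1 : IntegrableOn k (Set.Ioi 0) := by
    refine Integrable.mono' ((exp_neg_integrableOn_Ioi 0 (b := σ-1) (by linarith)).const_mul K)
      hkm.aestronglyMeasurable ?_
    exact (ae_restrict_iff' measurableSet_Ioi).2 (ae_of_all _ hkb)
  have hk2 : IntegrableOn (fun y => ‖k y‖ ^ 2) (Set.Ioi 0) := by
    refine Integrable.mono' ((exp_neg_integrableOn_Ioi 0 (b := 2*(σ-1)) (by linarith)).const_mul (K^2))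
      (by fun_prop) ?_
    refine (ae_restrict_iff' measurableSet_Ioi).2 (ae_of_all _ fun y hy => ?_)
    rw [Real.norm_of_nonneg (by positivity)]
    calc _ ≤ (K * Real.exp (-(σ-1) * y))^2 := by gcongr; exact hkb y hy
      _ = _ := by rw [mul_pow, ← Real.exp_nat_mul]; push_cast; ring_nf
  have hf1 : Integrable f := (integrable_indicator_iff measurableSet_Ioi).2 hk1
  have hsq : (fun y => ‖f y‖^2) = Set.indicator (Set.Ioi 0) (fun y => ‖k y‖^2) := by
    ext y
    by_cases hy : y ∈ Set.Ioi (0:ℝ)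
    · simp only [hf, Set.indicator_of_mem hy]
    · simp only [hf, Set.indicator_of_notMem hy]; simp
  have hf2 : MemLp f 2 := by
    rw [memLp_two_iff_integrable_sq_norm hfm.aestronglyMeasurable, hsq]
    exact (integrable_indicator_iff measurableSet_Ioi).2 hk2
  obtain ⟨-, p2⟩ := plancherel hf1 hf2
  have hksq : (fun y => ‖k y‖^2) = fun y => ‖h y‖ ^ 2 * Real.exp (-2 * σ * y) := by
    ext y
    rw [hkn, mul_pow, ← Real.exp_nat_mul]; push_cast; ring_nf
  have hfour : ∀ ξ : ℝ, 𝓕 f ξ = G (σ + (2 * Real.pi * ξ : ℝ) * Complex.I) := by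
    intro ξ
    rw [hG _ (by simp; linarith) (by simp; linarith), Real.fourier_eq', hf]
    rw [← integral_indicator measurableSet_Ioi]
    congr 1
    ext y
    by_cases hy : y ∈ Set.Ioi (0:ℝ)
    · simp only [Set.indicator_of_mem hy, hk, smul_eq_mul]
      rw [mul_left_comm, ← Complex.exp_add]
      congr 2
      simp
      ring
    · simp only [Set.indicator_of_notMem hy]; simp
  refine ⟨hksq ▸ hk2, ?_⟩
  rw [← hksq, ← integral_indicator measurableSet_Ioi, ← hsq, ← p2]
  simp_rw [hfour]
  rw [Measure.integral_comp_mul_left (fun t : ℝ => ‖G (σ + (t:ℝ) * Complex.I)‖^2)]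
  rw [abs_of_pos (by positivity)]
  simp

lemma japanese_le (t u : ℝ) {y : ℝ} (hy : |u - t| ≤ y) :
    (1 + |u|) ^ (-(3/4:ℝ)) ≤ (1 + y) ^ (3/4:ℝ) * (1 + |t|) ^ (-(3/4:ℝ)) := by
  have hy0 : 0 ≤ y := (abs_nonneg _).trans hy
  rw [Real.rpow_neg (by positivity), Real.rpow_neg (by positivity), ← div_eq_mul_inv,
    ← one_div, div_le_div_iff₀ (by positivity) (by positivity), one_mul,
    ← Real.mul_rpow (by positivity) (by positivity)]
  apply Real.rpow_le_rpow (by positivity) _ (by norm_num)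
  have : |t| ≤ |u| + |u - t| := by
    have := abs_sub_abs_le_abs_sub t u
    rw [abs_sub_comm] at this; linarith
  nlinarith [abs_nonneg u, abs_nonneg t]

lemma d_holo {A B : ℂ → ℂ} {β : ℝ}
    (hA : DifferentiableOn ℂ A {z | β < z.re ∧ z.re < 2})
    (hB : DifferentiableOn ℂ B {z | β < z.re ∧ z.re < 2})
    (bA : ∀ σ > β, ∃ K, ∀ s : ℂ, σ ≤ s.re → s.re < 2 → ‖A s‖ ≤ K * (1 + |s.im|) ^ (-(3/4:ℝ)))
    (bB : ∀ σ > β, ∃ K, ∀ s : ℂ, σ ≤ s.re → s.re < 2 → ‖B s‖ ≤ K * (1 + |s.im|) ^ (-(3/4:ℝ))) :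
    DifferentiableOn ℂ (fun z => ∫ t : ℝ, A (z + t * Complex.I) * B (z - t * Complex.I))
      {z | β < z.re ∧ z.re < 2} := by
  have hopen : IsOpen {z : ℂ | β < z.re ∧ z.re < 2} :=
    (isOpen_lt continuous_const Complex.continuous_re).inter
      (isOpen_lt Complex.continuous_re continuous_const)
  intro z₀ hz₀
  obtain ⟨hz1, hz2⟩ := hz₀
  obtain ⟨δ, hδ, hδ1, hδ2, hδ3⟩ : ∃ δ : ℝ, 0 < δ ∧ β < z₀.re - 2*δ ∧ z₀.re + 2*δ < 2 ∧ 2*δ ≤ 1 := by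
    refine ⟨min (min ((z₀.re-β)/4) ((2-z₀.re)/4)) (1/2), by
      simp only [lt_min_iff]; refine ⟨⟨?_, ?_⟩, ?_⟩ <;> linarith, ?_, ?_, ?_⟩
    · have := (min_le_left (min ((z₀.re-β)/4) ((2-z₀.re)/4)) (1/2)).trans (min_le_left _ _)
      linarith
    · have := (min_le_left (min ((z₀.re-β)/4) ((2-z₀.re)/4)) (1/2)).trans (min_le_right _ _)
      linarith
    · have := min_le_right (min ((z₀.re-β)/4) ((2-z₀.re)/4)) (1/2)
      linarith
  obtain ⟨K, hK⟩ := bA (z₀.re - 2*δ) hδ1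
  obtain ⟨L, hL⟩ := bB (z₀.re - 2*δ) hδ1
  set M := (1 + (|z₀.im| + 1)) ^ (3/4:ℝ) with hM
  have hM0 : 0 < M := by positivity
  have key : ∀ (F : ℂ → ℂ) (K : ℝ), (∀ s : ℂ, z₀.re - 2*δ ≤ s.re → s.re < 2 →
      ‖F s‖ ≤ K * (1 + |s.im|) ^ (-(3/4:ℝ))) → 0 ≤ K ∧ ∀ (t : ℝ) (w : ℂ), ‖w - (z₀ + t * Complex.I)‖ ≤ 2*δ →
      (β < w.re ∧ w.re < 2) ∧ ‖F w‖ ≤ K * M * (1 + |t|) ^ (-(3/4:ℝ)) := by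
    intro F K hF
    have hK0 : 0 ≤ K := by
      by_contra hneg
      have := (norm_nonneg _).trans (hF z₀ (by linarith) hz2)
      have h2 : 0 < (1 + |z₀.im|) ^ (-(3/4:ℝ)) := by positivity
      nlinarith
    refine ⟨hK0, fun t w hw => ?_⟩
    have r1 := (Complex.abs_re_le_norm _).trans hw
    have r2 := (Complex.abs_im_le_norm _).trans hw
    simp at r1 r2
    rw [abs_le] at r1
    refine ⟨⟨by linarith, by linarith⟩, ?_⟩
    refine (hF w (by linarith) (by linarith)).trans ?_
    rw [mul_assoc]
    gcongr
    apply japanese_le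
    calc |w.im - t| = |(w.im - (z₀.im + t)) + z₀.im| := by ring_nf
      _ ≤ |w.im - (z₀.im + t)| + |z₀.im| := abs_add_le _ _
      _ ≤ _ := by linarith
  have kder : ∀ (F : ℂ → ℂ) (K : ℝ), DifferentiableOn ℂ F {z | β < z.re ∧ z.re < 2} →
      (∀ s : ℂ, z₀.re - 2*δ ≤ s.re → s.re < 2 →
      ‖F s‖ ≤ K * (1 + |s.im|) ^ (-(3/4:ℝ))) → ∀ (t : ℝ) (w : ℂ), ‖w - (z₀ + t * Complex.I)‖ < δ →
      ‖deriv F w‖ ≤ K * M * (1 + |t|) ^ (-(3/4:ℝ)) / δ := by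
    intro F K hF hb t w hw
    obtain ⟨hK0, h⟩ := key F K hb
    have hsub : ∀ v, ‖v - w‖ ≤ δ → ‖v - (z₀ + t * Complex.I)‖ ≤ 2*δ := fun v hv => by
      calc _ = ‖(v - w) + (w - (z₀ + t * Complex.I))‖ := by ring_nf
        _ ≤ _ := (norm_add_le _ _).trans (by linarith)
    refine Complex.norm_deriv_le_of_forall_mem_sphere_norm_le hδ ?_ ?_
    · apply DifferentiableOn.diffContOnCl
      rw [closure_ball _ hδ.ne']
      refine hF.mono fun v hv => (h t v (hsub v ?_)).1
      simpa [dist_eq_norm] using hv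
    · intro v hv
      refine (h t v (hsub v ?_)).2
      rw [mem_sphere_iff_norm] at hv; exact hv.le
  have negI : ∀ (t : ℝ) (z : ℂ), z - t * Complex.I = z + ((-t : ℝ) : ℂ) * Complex.I := fun t z => by
    push_cast; ring
  have hcur : ∀ (z : ℂ), z ∈ Metric.ball z₀ δ → ∀ t : ℝ, ‖(z + t * Complex.I) - (z₀ + t * Complex.I)‖ < δ :=
    fun z hz t => by simpa [dist_eq_norm] using hz
  have contl : ∀ (F : ℂ → ℂ), DifferentiableOn ℂ F {z | β < z.re ∧ z.re < 2} →
      ∀ z ∈ Metric.ball z₀ δ, Continuous (fun t : ℝ => F (z + t * Complex.I)) := by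
    intro F hF z hz
    have : ∀ t : ℝ, (z + t * Complex.I) ∈ {z : ℂ | β < z.re ∧ z.re < 2} := fun t =>
      ((key A K hK).2 t _ (by linarith [hcur z hz t])).1
    exact hF.continuousOn.comp_continuous (by fun_prop) this
  have cA := contl A hA
  have cB : ∀ z ∈ Metric.ball z₀ δ, Continuous (fun t : ℝ => B (z - t * Complex.I)) := by
    intro z hz
    simp_rw [negI]
    exact (contl B hB z hz).comp continuous_neg
  have hA' : DifferentiableOn ℂ (deriv A) {z | β < z.re ∧ z.re < 2} := hA.deriv hopen
  have hB' : DifferentiableOn ℂ (deriv B) {z | β < z.re ∧ z.re < 2} := hB.deriv hopen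
  have hz₀b : z₀ ∈ Metric.ball z₀ δ := Metric.mem_ball_self hδ
  have cA' := contl _ hA' z₀ hz₀b
  have cB' : Continuous (fun t : ℝ => deriv B (z₀ - t * Complex.I)) := by
    simp_rw [negI]
    exact (contl _ hB' z₀ hz₀b).comp continuous_neg
  have hInt : Integrable (fun t : ℝ => (1 + |t|) ^ (-(3/2:ℝ))) := by
    have := integrable_one_add_norm (E := ℝ) (μ := volume) (r := 3/2) (by simp; norm_num)
    simpa using this
  have sqj : ∀ t : ℝ, (1 + |t|) ^ (-(3/4:ℝ)) * (1 + |t|) ^ (-(3/4:ℝ)) = (1 + |t|) ^ (-(3/2:ℝ)) := fun t => by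
    rw [← Real.rpow_add (by positivity)]; norm_num
  have hAz : ∀ z ∈ Metric.ball z₀ δ, ∀ t : ℝ, ‖A (z + t * Complex.I)‖ ≤ K * M * (1 + |t|) ^ (-(3/4:ℝ)) :=
    fun z hz t => ((key A K hK).2 t _ (by linarith [hcur z hz t])).2
  have hBz : ∀ z ∈ Metric.ball z₀ δ, ∀ t : ℝ, ‖B (z - t * Complex.I)‖ ≤ L * M * (1 + |t|) ^ (-(3/4:ℝ)) :=
    fun z hz t => by
      rw [negI, ← abs_neg t]; exact ((key B L hL).2 (-t) _ (by linarith [hcur z hz (-t)])).2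
  have hA'z : ∀ z ∈ Metric.ball z₀ δ, ∀ t : ℝ, ‖deriv A (z + t * Complex.I)‖ ≤ K * M * (1 + |t|) ^ (-(3/4:ℝ)) / δ :=
    fun z hz t => kder A K hA hK t _ (hcur z hz t)
  have hB'z : ∀ z ∈ Metric.ball z₀ δ, ∀ t : ℝ, ‖deriv B (z - t * Complex.I)‖ ≤ L * M * (1 + |t|) ^ (-(3/4:ℝ)) / δ :=
    fun z hz t => by
      rw [negI, ← abs_neg t]; exact kder B L hB hL (-t) _ (hcur z hz (-t))
  have hK0 := (key A K hK).1
  have hL0 := (key B L hL).1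
  have := hasDerivAt_integral_of_dominated_loc_of_deriv_le (μ := (volume : Measure ℝ))
    (F := fun z (t : ℝ) => A (z + t * Complex.I) * B (z - t * Complex.I)) (x₀ := z₀)
    (F' := fun z (t : ℝ) => deriv A (z + t * Complex.I) * B (z - t * Complex.I) +
      A (z + t * Complex.I) * deriv B (z - t * Complex.I))
    (bound := fun t => (K * M * (L * M) / δ * 2) * (1 + |t|) ^ (-(3/2:ℝ)))
    (Metric.ball_mem_nhds z₀ hδ) ?_ ?_ ?_ ?_ (hInt.const_mul _) ?_
  · exact this.2.differentiableAt.differentiableWithinAt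
  · filter_upwards [Metric.ball_mem_nhds z₀ hδ] with z hz
    exact ((cA z hz).mul (cB z hz)).aestronglyMeasurable
  · refine Integrable.mono' (hInt.const_mul (K * M * (L * M)))
      ((cA z₀ hz₀b).mul (cB z₀ hz₀b)).aestronglyMeasurable (ae_of_all _ fun t => ?_)
    rw [norm_mul, ← sqj]
    calc _ ≤ (K * M * (1 + |t|) ^ (-(3/4:ℝ))) * (L * M * (1 + |t|) ^ (-(3/4:ℝ))) := by
          gcongr
          · exact hAz z₀ hz₀b t
          · exact hBz z₀ hz₀b t
      _ = _ := by ring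
  · exact ((cA'.mul (cB z₀ hz₀b)).add ((cA z₀ hz₀b).mul cB')).aestronglyMeasurable
  · refine ae_of_all _ fun t z hz => ?_
    rw [← sqj]
    calc _ ≤ (K * M * (1 + |t|) ^ (-(3/4:ℝ)) / δ) * (L * M * (1 + |t|) ^ (-(3/4:ℝ)))
          + (K * M * (1 + |t|) ^ (-(3/4:ℝ))) * (L * M * (1 + |t|) ^ (-(3/4:ℝ)) / δ) := by
          refine (norm_add_le _ _).trans ?_
          rw [norm_mul, norm_mul]
          gcongr
          · exact hA'z z hz t
          · exact hBz z hz t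
          · exact hAz z hz t
          · exact hB'z z hz t
      _ = _ := by ring
  · refine ae_of_all _ fun t z hz => ?_
    have e1 : HasDerivAt (fun z : ℂ => A (z + t * Complex.I)) (deriv A (z + t * Complex.I)) z := by
      have : DifferentiableAt ℂ A (z + t * Complex.I) :=
        hA.differentiableAt (hopen.mem_nhds ((key A K hK).2 t _ (by linarith [hcur z hz t])).1)
      exact this.hasDerivAt.comp_add_const z _
    have e2 : HasDerivAt (fun z : ℂ => B (z - t * Complex.I)) (deriv B (z - t * Complex.I)) z := by
      have : DifferentiableAt ℂ B (z - t * Complex.I) := by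
        rw [negI]
        exact hB.differentiableAt (hopen.mem_nhds ((key A K hK).2 (-t) _ (by linarith [hcur z hz (-t)])).1)
      exact this.hasDerivAt.comp_sub_const z _
    exact e1.mul e2
end Zd
end

end

section
open MeasureTheory Filter Topology

noncomputable section
namespace Zd

open ProbabilityTheory in
lemma d_main {G : ℂ → ℂ} {h : ℝ → ℂ} {K β : ℝ} (hm : Measurable h) (hβ : 1/2 ≤ β) (hβ1 : β ≤ 1)
    (hb : ∀ y > 0, ‖h y‖ ≤ K * Real.exp y)
    (hG : ∀ s : ℂ, 1 < s.re → s.re < 2 → G s = ∫ y in Set.Ioi (0:ℝ), h y * Complex.exp (-s * y))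
    (hd : DifferentiableOn ℂ G {z | β < z.re ∧ z.re < 2})
    (bG : ∀ σ > β, ∃ K, ∀ s : ℂ, σ ≤ s.re → s.re < 2 → ‖G s‖ ≤ K * (1 + |s.im|) ^ (-(3/4:ℝ)))
    {σ : ℝ} (h1 : β < σ) (h2 : σ ≤ 5/4) :
    IntegrableOn (fun y => ‖h y‖ ^ 2 * Real.exp (-2 * σ * y)) (Set.Ioi 0) ∧
    ∫ y in Set.Ioi (0:ℝ), ‖h y‖ ^ 2 * Real.exp (-2 * σ * y) =
      1 / (2 * Real.pi) * ∫ t : ℝ, ‖G (σ + t * Complex.I)‖ ^ 2 := by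
  set B : ℂ → ℂ := fun z => (starRingEnd ℂ) (G ((starRingEnd ℂ) z)) with hBdef
  have hopen : IsOpen {z : ℂ | β < z.re ∧ z.re < 2} :=
    (isOpen_lt continuous_const Complex.continuous_re).inter
      (isOpen_lt Complex.continuous_re continuous_const)
  have hB : DifferentiableOn ℂ B {z | β < z.re ∧ z.re < 2} := by
    intro z hz
    have : DifferentiableAt ℂ G ((starRingEnd ℂ) z) :=
      hd.differentiableAt (hopen.mem_nhds (by simpa using hz))
    have h := this.hasDerivAt.conj_conj
    simp only [RingHomCompTriple.comp_apply, RingHom.id_apply] at h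
    exact h.differentiableAt.differentiableWithinAt
  have bB : ∀ σ > β, ∃ K, ∀ s : ℂ, σ ≤ s.re → s.re < 2 → ‖B s‖ ≤ K * (1 + |s.im|) ^ (-(3/4:ℝ)) := by
    intro σ hσ
    obtain ⟨K, hK⟩ := bG σ hσ
    refine ⟨K, fun s a b => ?_⟩
    have := hK ((starRingEnd ℂ) s) (by simpa using a) (by simpa using b)
    simpa [hBdef] using this
  set R : ℂ → ℂ := fun z => (1/(2*Real.pi) : ℝ) • ∫ t : ℝ, G (z + t * Complex.I) * B (z - t * Complex.I) with hR
  have hRd : DifferentiableOn ℂ R {z | β < z.re ∧ z.re < 2} := by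
    have := (d_holo hd hB bG bB).const_smul ((1/(2*Real.pi) : ℝ))
    exact this
  have hRr : ∀ x : ℝ, R x = ((1 / (2 * Real.pi) * ∫ t : ℝ, ‖G (x + t * Complex.I)‖ ^ 2 : ℝ) : ℂ) := by
    intro x
    rw [hR]
    simp only [Complex.real_smul, Complex.ofReal_mul]
    congr 1
    rw [← integral_complex_ofReal]
    congr 1
    ext t
    have : (starRingEnd ℂ) ((x:ℂ) - t * Complex.I) = x + t * Complex.I := by
      simp
    simp only [hBdef]
    rw [this, Complex.mul_conj, Complex.normSq_eq_norm_sq]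
  set ν : Measure ℝ := (volume.restrict (Set.Ioi 0)).withDensity (fun y => ENNReal.ofReal (‖h y‖^2)) with hν
  set X : ℝ → ℝ := fun y => -2 * y with hX
  have dm : Measurable (fun y => ENNReal.ofReal (‖h y‖^2)) := by fun_prop
  have nuint : ∀ g : ℝ → ℝ, (Integrable g ν ↔ IntegrableOn (fun y => ‖h y‖^2 * g y) (Set.Ioi 0)) := by
    intro g
    rw [hν, integrable_withDensity_iff_integrable_smul' dm (by simp)]
    simp [IntegrableOn]
  have nuI : ∀ g : ℝ → ℝ, ∫ y, g y ∂ν = ∫ y in Set.Ioi 0, ‖h y‖^2 * g y := by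
    intro g
    rw [hν, integral_withDensity_eq_integral_toReal_smul dm (by simp)]
    simp
  have eX : ∀ (x y : ℝ), Real.exp (x * X y) = Real.exp (-2 * x * y) := fun x y => by
    simp only [hX]; ring_nf
  have hset : Set.Ioo (1:ℝ) 2 ⊆ integrableExpSet X ν := by
    intro x hx
    rw [integrableExpSet, Set.mem_ofPred_eq, nuint]
    simp_rw [eX]
    exact (d_step1 hm hb hG hx.1 hx.2).1
  have hInt : ∀ x ∈ Set.Ioo (1:ℝ) 2, x ∈ interior (integrableExpSet X ν) := fun x hx =>
    interior_mono hset (by rwa [isOpen_Ioo.interior_eq])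
  have hmgf : ∀ x ∈ Set.Ioo (1:ℝ) 2, complexMGF X ν x = R x := by
    intro x hx
    rw [complexMGF_ofReal, hRr, mgf, nuI]
    simp_rw [eX]
    rw [(d_step1 hm hb hG hx.1 hx.2).2]
  have h54 : (5/4:ℝ) ∈ Set.Ioo (1:ℝ) 2 := by constructor <;> norm_num
  have hev : complexMGF X ν =ᶠ[𝓝 (((5/4:ℝ)):ℂ)] R := by
    refine (AnalyticAt.frequently_eq_iff_eventually_eq ?_ ?_).1 ?_
    · exact analyticAt_complexMGF (by simpa using hInt _ h54)
    · refine hRd.analyticAt (hopen.mem_nhds ⟨?_, ?_⟩)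
      · rw [Complex.ofReal_re]; linarith
      · rw [Complex.ofReal_re]; norm_num
    · have ht : Tendsto (fun x : ℝ => (x:ℂ)) (𝓝[≠] (5/4:ℝ)) (𝓝[≠] ((5/4:ℝ):ℂ)) := by
        refine tendsto_nhdsWithin_iff.2 ⟨?_, ?_⟩
        · exact (Complex.continuous_ofReal.tendsto _).mono_left nhdsWithin_le_nhds
        · filter_upwards [self_mem_nhdsWithin] with x hx
          simpa using fun h => hx (Complex.ofReal_injective (by simpa using h))
      apply ht.frequently
      apply Eventually.frequently
      filter_upwards [mem_nhdsWithin_of_mem_nhds (isOpen_Ioo.mem_nhds h54)] with x hx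
      exact hmgf x hx
  rcases eq_or_lt_of_le h2 with h2 | h2
  · rw [h2]; exact d_step1 hm hb hG h54.1 h54.2
  have hball : Metric.ball (((5/4:ℝ)):ℂ) (5/4-β) ⊆ {z | β < z.re ∧ z.re < 2} := by
    intro z hz
    rw [mem_ball_iff_norm] at hz
    have := (Complex.abs_re_le_norm _).trans_lt hz
    rw [Complex.sub_re, Complex.ofReal_re, abs_lt] at this
    exact ⟨by linarith, by linarith⟩
  have hσb : (σ:ℂ) ∈ Metric.ball (((5/4:ℝ)):ℂ) (5/4-β) := by
    rw [mem_ball_iff_norm, ← Complex.ofReal_sub, Complex.norm_real, Real.norm_eq_abs, abs_lt]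
    constructor <;> linarith
  have hsum := Complex.hasSum_taylorSeries_on_ball (hRd.mono hball) hσb
  set T : ℕ → ℝ → ℝ := fun n y => ((σ - 5/4) * X y)^n / (n.factorial : ℝ) * Real.exp (5/4 * X y) with hT
  have hterm : ∀ n : ℕ, ((n.factorial : ℂ))⁻¹ • ((σ:ℂ) - ((5/4:ℝ):ℂ))^n • iteratedDeriv n R ((5/4:ℝ):ℂ) =
      ((∫ y, T n y ∂ν : ℝ) : ℂ) := by
    intro n
    rw [← hev.iteratedDeriv_eq n, iteratedDeriv_complexMGF (by simpa using hInt _ h54), ← integral_complex_ofReal]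
    rw [smul_smul, ← integral_smul]
    congr 1
    ext y
    simp only [hT, smul_eq_mul]
    push_cast
    rw [mul_pow]
    ring
  have hTi : ∀ n, Integrable (T n) ν := by
    intro n
    have := integrable_pow_mul_exp_of_mem_interior_integrableExpSet (hInt _ h54) n
    refine (this.const_mul ((σ-5/4)^n / (n.factorial:ℝ))).congr (ae_of_all _ fun y => ?_)
    simp only [hT, mul_pow]; ring
  have hnuae : ∀ᵐ y ∂ν, 0 < y := by
    have : ν ≪ volume.restrict (Set.Ioi (0:ℝ)) := withDensity_absolutelyContinuous _ _
    exact this.ae_le (ae_restrict_mem measurableSet_Ioi)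
  have hT0 : ∀ n, ∫ y, ‖T n y‖ ∂ν = ∫ y, T n y ∂ν := by
    intro n
    refine integral_congr_ae ?_
    filter_upwards [hnuae] with y hy
    rw [Real.norm_of_nonneg]
    have : 0 ≤ (σ - 5/4) * X y := by simp only [hX]; nlinarith
    simp only [hT]; positivity
  simp_rw [hterm] at hsum
  rw [hRr] at hsum
  have hsum' := Complex.hasSum_ofReal.1 hsum
  have hs2 := hasSum_integral_of_summable_integral_norm hTi (by simp_rw [hT0]; exact hsum'.summable)
  have heq := hs2.unique hsum'
  have hexp : ∀ y, HasSum (fun n => T n y) (Real.exp (-2 * σ * y)) := by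
    intro y
    have := (NormedSpace.expSeries_div_hasSum_exp ((σ - 5/4) * X y)).mul_right (Real.exp (5/4 * X y))
    rw [← Real.exp_eq_exp_ℝ, ← Real.exp_add] at this
    have e : (σ - 5/4) * X y + 5/4 * X y = -2 * σ * y := by simp only [hX]; ring
    rw [e] at this
    exact this
  simp_rw [fun y => (hexp y).tsum_eq] at heq
  rw [nuI] at heq
  refine ⟨?_, heq⟩
  rw [← nuint]
  have hI : ∀ n, ∫⁻ y, ENNReal.ofReal (T n y) ∂ν = ENNReal.ofReal (∫ y, T n y ∂ν) := by
    intro n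
    rw [ofReal_integral_eq_lintegral_ofReal (hTi n)]
    filter_upwards [hnuae] with y hy
    have : 0 ≤ (σ - 5/4) * X y := by simp only [hX]; nlinarith
    simp only [hT, Pi.zero_apply]; positivity
  have hTn : ∀ n, 0 ≤ ∫ y, T n y ∂ν := fun n => by rw [← hT0]; positivity
  refine ⟨by fun_prop, ?_⟩
  rw [hasFiniteIntegral_iff_ofReal (ae_of_all _ fun y => by positivity)]
  calc ∫⁻ y, ENNReal.ofReal (Real.exp (-2 * σ * y)) ∂ν = ∫⁻ y, ∑' n, ENNReal.ofReal (T n y) ∂ν := by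
        refine lintegral_congr_ae ?_
        filter_upwards [hnuae] with y hy
        rw [← (hexp y).tsum_eq, ENNReal.ofReal_tsum_of_nonneg _ (hexp y).summable]
        intro n
        have : 0 ≤ (σ - 5/4) * X y := by simp only [hX]; nlinarith
        simp only [hT]; positivity
    _ = ∑' n, ∫⁻ y, ENNReal.ofReal (T n y) ∂ν := by
        rw [lintegral_tsum]
        intro n
        simp only [hT, hX]; fun_prop
    _ = ∑' n, ENNReal.ofReal (∫ y, T n y ∂ν) := by simp_rw [hI]
    _ < ⊤ := by
        rw [← ENNReal.ofReal_tsum_of_nonneg hTn hsum'.summable]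
        exact ENNReal.ofReal_lt_top
end Zd
end

end

section
open MeasureTheory Filter Topology

noncomputable section
namespace Zd

/-- ψ(e^y) - e^y -/
def hz (y : ℝ) : ℝ := Chebyshev.psi (Real.exp y) - Real.exp y

/-- corrected remainder -/
def HZ (Z : Finset ℂ) (y : ℝ) : ℂ := (hz y : ℂ) + ∑ ρ ∈ Z, (mz ρ : ℂ) / ρ * Complex.exp (ρ * y)

/-- its Laplace transform -/
def GZ (Z : Finset ℂ) (s : ℂ) : ℂ :=
  (-logDeriv Fz s - 1 + ∑ ρ ∈ Z, (mz ρ : ℂ) * (1 / ρ + 1 / (s - ρ))) / s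

lemma hz_meas : Measurable hz :=
  (Chebyshev.psi_mono.measurable.comp Real.measurable_exp).sub Real.measurable_exp

lemma HZ_meas (Z : Finset ℂ) : Measurable (HZ Z) := by
  unfold HZ
  have := hz_meas
  fun_prop

lemma hz_bound (y : ℝ) : |hz y| ≤ (Real.log 4 + 4) * Real.exp y := by
  unfold hz
  have h1 := Chebyshev.psi_nonneg (Real.exp y)
  have h2 := Chebyshev.psi_le_const_mul_self (Real.exp_pos y).le
  have h3 := Real.exp_pos y
  have h4 : 0 < Real.log 4 := Real.log_pos (by norm_num)
  rw [abs_le]; constructor <;> nlinarith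

lemma HZ_bound {Z : Finset ℂ} (hZ : ∀ ρ ∈ Z, ρ.re ≤ 1) :
    ∃ K, ∀ y > 0, ‖HZ Z y‖ ≤ K * Real.exp y := by
  refine ⟨(Real.log 4 + 4) + ∑ ρ ∈ Z, ‖(mz ρ : ℂ) / ρ‖, fun y hy => ?_⟩
  rw [add_mul, Finset.sum_mul]
  refine (norm_add_le _ _).trans (add_le_add ?_ ((norm_sum_le _ _).trans (Finset.sum_le_sum fun ρ hρ => ?_)))
  · rw [Complex.norm_real]; exact hz_bound y
  · rw [norm_mul, Complex.norm_exp]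
    gcongr
    simp
    nlinarith [hZ ρ hρ]

lemma psi_laplace {s : ℂ} (hs : 1 < s.re) :
    ∫ y in Set.Ioi (0:ℝ), (Chebyshev.psi (Real.exp y) : ℂ) * Complex.exp (-s * y) =
      -deriv riemannZeta s / riemannZeta s / s := by
  have hs0 : s ≠ 0 := by rintro rfl; simp at hs; linarith
  have h1 := LSeries_eq_mul_integral_of_nonneg (fun n => ArithmeticFunction.vonMangoldt n) (r := 1) zero_le_one hs ?_
    (fun n => ArithmeticFunction.vonMangoldt_nonneg)
  · rw [ArithmeticFunction.LSeries_vonMangoldt_eq_deriv_riemannZeta_div hs] at h1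
    rw [h1, mul_div_cancel_left₀ _ hs0]
    have him : Real.exp '' (Set.Ioi 0) = Set.Ioi 1 := by
      ext x; constructor
      · rintro ⟨y, hy, rfl⟩; exact Real.one_lt_exp_iff.2 hy
      · intro hx
        have hx : 1 < x := hx
        exact ⟨Real.log x, Real.log_pos hx, Real.exp_log (by linarith)⟩
    rw [← him, integral_image_eq_integral_abs_deriv_smul measurableSet_Ioi
      (fun x _ => (Real.hasDerivAt_exp x).hasDerivWithinAt) Real.exp_injective.injOn]
    refine setIntegral_congr_fun measurableSet_Ioi fun y hy => ?_
    have e1 : ((Real.exp y : ℝ) : ℂ) ^ (-(s+1)) = Complex.exp (-(s+1) * y) := by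
      rw [Complex.cpow_def_of_ne_zero (by exact_mod_cast (Real.exp_pos y).ne'), ← Complex.ofReal_log (Real.exp_pos y).le,
        Real.log_exp]; ring_nf
    simp only [e1, abs_of_pos (Real.exp_pos y), Complex.real_smul]
    rw [Chebyshev.psi]
    push_cast
    have e2 : Finset.Ioc 0 ⌊Real.exp y⌋₊ = Finset.Icc 1 ⌊Real.exp y⌋₊ := rfl
    rw [e2, mul_left_comm, ← Complex.exp_add]
    ring_nf
  · refine Asymptotics.IsBigO.of_bound (Real.log 4 + 4) (Eventually.of_forall fun n => ?_)
    have := Chebyshev.psi_le_const_mul_self (x := n) (by positivity)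
    have h0 := Chebyshev.psi_nonneg n
    rw [Chebyshev.psi, Nat.floor_natCast] at this h0
    change 0 ≤ ∑ k ∈ Finset.Icc 1 n, ArithmeticFunction.vonMangoldt k at h0
    rw [Real.rpow_one, Real.norm_of_nonneg h0, Real.norm_of_nonneg (by positivity)]
    exact this

lemma exp_laplace {s a : ℂ} (h : a.re < s.re) :
    IntegrableOn (fun y : ℝ => Complex.exp (a * y) * Complex.exp (-s * y)) (Set.Ioi 0) ∧
    ∫ y in Set.Ioi (0:ℝ), Complex.exp (a * y) * Complex.exp (-s * y) = 1 / (s - a) := by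
  have e : (fun y : ℝ => Complex.exp (a * y) * Complex.exp (-s * y)) = fun y : ℝ => Complex.exp ((a - s) * y) := by
    ext y; rw [← Complex.exp_add]; ring_nf
  have hr : (a - s).re < 0 := by simp; linarith
  rw [e]
  refine ⟨integrableOn_exp_mul_complex_Ioi hr 0, ?_⟩
  rw [integral_exp_mul_complex_Ioi hr 0]
  simp
  rw [← neg_sub s a, neg_div_neg_eq, one_div]

lemma logDeriv_Fz {s : ℂ} (hs : 1 < s.re) :
    logDeriv Fz s = 1 / (s - 1) + deriv riemannZeta s / riemannZeta s := by
  have hs1 : s ≠ 1 := by rintro rfl; simp at hs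
  have hz : riemannZeta s ≠ 0 := riemannZeta_ne_zero_of_one_le_re hs.le
  have hev : Fz =ᶠ[𝓝 s] fun z => (z - 1) * riemannZeta z := by
    filter_upwards [isOpen_ne.mem_nhds hs1] with z hz using Fz_of_ne hz
  have hd := (differentiableAt_riemannZeta hs1)
  have : deriv Fz s = riemannZeta s + (s - 1) * deriv riemannZeta s := by
    rw [hev.deriv_eq]
    have := ((hasDerivAt_id s).sub_const 1).mul hd.hasDerivAt
    have h2 := this.deriv
    simp only [id, one_mul] at h2
    exact h2
  rw [logDeriv_apply, this, Fz_of_ne hs1]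
  have : s - 1 ≠ 0 := sub_ne_zero.2 hs1
  field_simp

lemma HZ_laplace {Z : Finset ℂ} (hZ : ∀ ρ ∈ Z, ρ.re ≤ 1 ∧ ρ ≠ 0) {s : ℂ} (hs : 1 < s.re) :
    GZ Z s = ∫ y in Set.Ioi (0:ℝ), HZ Z y * Complex.exp (-s * y) := by
  have hs0 : s ≠ 0 := by rintro rfl; simp at hs; linarith
  have hs1 : s - 1 ≠ 0 := by intro h; rw [sub_eq_zero.1 h] at hs; simp at hs
  have i1 : IntegrableOn (fun y : ℝ => (Chebyshev.psi (Real.exp y) : ℂ) * Complex.exp (-s * y)) (Set.Ioi 0) := by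
    refine Integrable.mono' (((exp_laplace (s := s) (a := 1) (by simpa using hs)).1.norm).const_mul (Real.log 4 + 4)) ?_ ?_
    · have : Measurable fun y => Chebyshev.psi (Real.exp y) := Chebyshev.psi_mono.measurable.comp Real.measurable_exp
      exact Measurable.aestronglyMeasurable (by fun_prop)
    · refine ae_of_all _ fun y => ?_
      rw [norm_mul, norm_mul, Complex.norm_real, Real.norm_of_nonneg (Chebyshev.psi_nonneg _), ← mul_assoc]
      gcongr
      have := Chebyshev.psi_le_const_mul_self (Real.exp_pos y).le
      rw [Complex.norm_exp]
      simpa using this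
  obtain ⟨i2, v2⟩ := exp_laplace (s := s) (a := 1) (by simpa using hs)
  have hsplit : ∀ y : ℝ, HZ Z y * Complex.exp (-s * y) =
      ((Chebyshev.psi (Real.exp y) : ℂ) * Complex.exp (-s * y) - Complex.exp (1 * y) * Complex.exp (-s * y))
      + ∑ ρ ∈ Z, (mz ρ : ℂ) / ρ * (Complex.exp (ρ * y) * Complex.exp (-s * y)) := by
    intro y
    rw [HZ, hz, add_mul, Finset.sum_mul]
    push_cast
    congr 1
    · rw [one_mul]; ring
    · exact Finset.sum_congr rfl fun ρ _ => by ring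
  simp_rw [hsplit]
  have i3 : ∀ ρ ∈ Z, IntegrableOn (fun y : ℝ => (mz ρ : ℂ) / ρ * (Complex.exp (ρ * y) * Complex.exp (-s * y))) (Set.Ioi 0) :=
    fun ρ hρ => ((exp_laplace (lt_of_le_of_lt (hZ ρ hρ).1 hs)).1).const_mul _
  have i12 : IntegrableOn (fun y : ℝ => (Chebyshev.psi (Real.exp y) : ℂ) * Complex.exp (-s * y) -
    Complex.exp (1 * y) * Complex.exp (-s * y)) (Set.Ioi 0) := i1.sub i2
  rw [integral_add i12 (integrable_finsetSum _ i3), integral_sub i1 i2, integral_finsetSum _ i3,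
    psi_laplace hs, v2]
  have : ∀ ρ ∈ Z, ∫ y in Set.Ioi (0:ℝ), (mz ρ : ℂ) / ρ * (Complex.exp (ρ * y) * Complex.exp (-s * y)) =
      (mz ρ : ℂ) * (1 / ρ + 1 / (s - ρ)) / s := by
    intro ρ hρ
    rw [integral_const_mul, (exp_laplace (lt_of_le_of_lt (hZ ρ hρ).1 hs)).2]
    have h1 : s - ρ ≠ 0 := by
      intro h; rw [sub_eq_zero.1 h] at hs; linarith [(hZ ρ hρ).1]
    have h2 := (hZ ρ hρ).2
    field_simp
    ring
  rw [Finset.sum_congr rfl this, GZ, logDeriv_Fz hs, ← Finset.sum_div, add_div]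
  congr 1
  field_simp
  ring
end Zd
end

end

section
open MeasureTheory Filter Topology

noncomputable section
namespace Zd

/-- window constant -/
def Cw : ℝ := windows.choose
lemma Cw_pos : 0 < Cw := windows.choose_spec.1
/-- window zero sets -/
def Sw (τ : ℝ) : Finset ℂ := (windows.choose_spec.2 τ).choose
lemma Sw_mem {τ : ℝ} {ρ : ℂ} (h : ρ ∈ Sw τ) :
    Fz ρ = 0 ∧ 0 < ρ.re ∧ ρ.re ≤ betaZeta ∧ |ρ.im - τ| ≤ 17 / 10 :=
  (windows.choose_spec.2 τ).choose_spec.1 ρ h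
lemma mem_Sw {τ : ℝ} {ρ : ℂ} (h : Fz ρ = 0) (h2 : ‖ρ - (2 + τ * Complex.I)‖ ≤ 17 / 10) : ρ ∈ Sw τ :=
  (windows.choose_spec.2 τ).choose_spec.2.1 ρ h h2
lemma Sw_count (τ : ℝ) : ∑ ρ ∈ Sw τ, (mz ρ : ℝ) ≤ Cw * Real.log (|τ| + 3) :=
  (windows.choose_spec.2 τ).choose_spec.2.2.1
lemma Sw_ld {τ : ℝ} {s : ℂ} (h1 : 1 / 2 ≤ s.re) (h2 : s.re ≤ 2) (h3 : |s.im - τ| ≤ 1 / 2) (h4 : Fz s ≠ 0) :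
    ‖logDeriv Fz s - ∑ ρ ∈ Sw τ, (mz ρ : ℂ) / (s - ρ)‖ ≤ Cw * Real.log (|τ| + 3) :=
  (windows.choose_spec.2 τ).choose_spec.2.2.2 s h1 h2 h3 h4

lemma one_le_log {x : ℝ} (hx : 0 ≤ x) : 1 ≤ Real.log (x + 3) := by
  rw [Real.le_log_iff_exp_le (by linarith)]
  linarith [Real.exp_one_lt_d9]

lemma near_center {s : ℂ} {τ : ℝ} (h1 : 1 / 2 ≤ s.re) (h2 : s.re ≤ 2) (h3 : |s.im - τ| ≤ 1 / 2) :
    ‖s - (2 + τ * Complex.I)‖ ≤ 8 / 5 := by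
  rw [← abs_of_nonneg (norm_nonneg _), ← abs_of_nonneg (show (0:ℝ) ≤ 8/5 by norm_num)]
  apply sq_le_sq.1
  rw [← Complex.normSq_eq_norm_sq, Complex.normSq_apply]
  simp
  rw [abs_le] at h3
  nlinarith

lemma GZ_point {Z : Finset ℂ} (hZ : ∀ ρ ∈ Z, Fz ρ = 0) : ∃ K > 0, ∀ (τ : ℝ) (s : ℂ),
    1 / 2 ≤ s.re → s.re ≤ 2 → |s.im - τ| ≤ 1 / 2 → Fz s ≠ 0 →
    ‖s * GZ Z s‖ ≤ K * Real.log (|τ| + 3) + ‖∑ ρ ∈ Sw τ \ Z, (mz ρ : ℂ) / (s - ρ)‖ := by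
  have hK0 : 0 ≤ ∑ ρ ∈ Z, ((mz ρ : ℝ) * (1 / ‖ρ‖ + 10)) := Finset.sum_nonneg fun ρ _ => by positivity
  refine ⟨Cw + 1 + ∑ ρ ∈ Z, ((mz ρ : ℝ) * (1 / ‖ρ‖ + 10)), by linarith [Cw_pos], fun τ s h1 h2 h3 h4 => ?_⟩
  have hs0 : s ≠ 0 := by rintro rfl; simp at h1; linarith
  set L := Real.log (|τ| + 3)
  have hL : 1 ≤ L := one_le_log (abs_nonneg τ)
  have e1 : s * GZ Z s = -(logDeriv Fz s - ∑ ρ ∈ Sw τ, (mz ρ : ℂ) / (s - ρ)) - ∑ ρ ∈ Sw τ \ Z, (mz ρ : ℂ) / (s - ρ)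
      - 1 + (∑ ρ ∈ Z, (mz ρ : ℂ) / ρ + ∑ ρ ∈ Z \ Sw τ, (mz ρ : ℂ) / (s - ρ)) := by
    rw [GZ, mul_div_cancel₀ _ hs0]
    have a1 := Finset.sum_inter_add_sum_sdiff (Sw τ) Z (fun ρ => (mz ρ : ℂ) / (s - ρ))
    have a2 := Finset.sum_inter_add_sum_sdiff Z (Sw τ) (fun ρ => (mz ρ : ℂ) / (s - ρ))
    rw [Finset.inter_comm] at a2
    have a3 : ∑ ρ ∈ Z, (mz ρ : ℂ) * (1 / ρ + 1 / (s - ρ)) =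
        ∑ ρ ∈ Z, (mz ρ : ℂ) / ρ + ∑ ρ ∈ Z, (mz ρ : ℂ) / (s - ρ) := by
      rw [← Finset.sum_add_distrib]
      exact Finset.sum_congr rfl fun ρ _ => by ring
    rw [a3, ← a1, ← a2]
    ring
  have e2 : ‖∑ ρ ∈ Z, (mz ρ : ℂ) / ρ + ∑ ρ ∈ Z \ Sw τ, (mz ρ : ℂ) / (s - ρ)‖ ≤
      ∑ ρ ∈ Z, ((mz ρ : ℝ) * (1 / ‖ρ‖ + 10)) := by
    have b1 : ‖∑ ρ ∈ Z, (mz ρ : ℂ) / ρ‖ ≤ ∑ ρ ∈ Z, (mz ρ : ℝ) * (1 / ‖ρ‖) := by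
      refine (norm_sum_le _ _).trans (Finset.sum_le_sum fun ρ _ => ?_)
      rw [norm_div, Complex.norm_natCast, mul_one_div]
    have b2 : ‖∑ ρ ∈ Z \ Sw τ, (mz ρ : ℂ) / (s - ρ)‖ ≤ ∑ ρ ∈ Z, (mz ρ : ℝ) * 10 := by
      refine (norm_sum_le _ _).trans ?_
      refine le_trans (Finset.sum_le_sum (g := fun ρ => (mz ρ : ℝ) * 10) fun ρ hρ => ?_)
        (Finset.sum_le_sum_of_subset_of_nonneg Finset.sdiff_subset fun ρ _ _ => by positivity)
      rw [Finset.mem_sdiff] at hρ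
      have far : 17/10 < ‖ρ - (2 + τ * Complex.I)‖ := by
        by_contra hc
        exact hρ.2 (mem_Sw (hZ ρ hρ.1) (not_lt.1 hc))
      have nc := near_center h1 h2 h3
      have : 1/10 ≤ ‖s - ρ‖ := by
        have : ‖ρ - (2 + τ * Complex.I)‖ ≤ ‖s - (2 + τ * Complex.I)‖ + ‖s - ρ‖ := by
          calc _ = ‖(s - (2 + τ * Complex.I)) - (s - ρ)‖ := by ring_nf
            _ ≤ _ := norm_sub_le _ _
        linarith
      rw [norm_div, Complex.norm_natCast, div_eq_mul_inv]
      gcongr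
      rw [inv_le_comm₀ (by linarith) (by norm_num)]
      linarith
    refine (norm_add_le _ _).trans ((add_le_add b1 b2).trans_eq ?_)
    rw [← Finset.sum_add_distrib]
    exact Finset.sum_congr rfl fun ρ _ => by ring
  have e3 := Sw_ld h1 h2 h3 h4
  rw [e1]
  refine (norm_add_le _ _).trans ?_
  have e4 := norm_sub_le (-(logDeriv Fz s - ∑ ρ ∈ Sw τ, (mz ρ : ℂ) / (s - ρ)) - ∑ ρ ∈ Sw τ \ Z, (mz ρ : ℂ) / (s - ρ)) 1
  have e5 := norm_sub_le (-(logDeriv Fz s - ∑ ρ ∈ Sw τ, (mz ρ : ℂ) / (s - ρ))) (∑ ρ ∈ Sw τ \ Z, (mz ρ : ℂ) / (s - ρ))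
  rw [norm_neg] at e5
  rw [norm_one] at e4
  nlinarith

lemma Fz_ne_of_beta_lt {s : ℂ} (h : betaZeta < s.re) : Fz s ≠ 0 := fun h0 =>
  absurd (re_le_beta h0 (by linarith [beta_ge])) (not_le.2 h)

lemma GZ_diff {Z : Finset ℂ} (hZ : ∀ ρ ∈ Z, ρ.re ≤ betaZeta) :
    DifferentiableOn ℂ (GZ Z) {z | betaZeta < z.re ∧ z.re < 2} := by
  intro s hs
  apply DifferentiableAt.differentiableWithinAt
  have hs' : betaZeta < s.re := hs.1
  have hs0 : s ≠ 0 := by rintro rfl; simp at hs'; linarith [beta_ge]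
  unfold GZ
  have h1 : DifferentiableAt ℂ (logDeriv Fz) s := by
    unfold logDeriv
    refine DifferentiableAt.div ?_ Fz_diff.differentiableAt (Fz_ne_of_beta_lt hs')
    exact Fz_diff.contDiff.differentiable_deriv_two.differentiableAt
  refine DifferentiableAt.div ?_ differentiableAt_id hs0
  refine (h1.neg.sub_const 1).add (DifferentiableAt.fun_sum fun ρ hρ => ?_)
  have : s - ρ ≠ 0 := fun h => by rw [sub_eq_zero.1 h] at hs'; linarith [hZ ρ hρ]
  refine (DifferentiableAt.const_add _ ?_).const_mul _
  exact (differentiableAt_const _).div (differentiableAt_id.sub_const _) this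

lemma log_le_quarter {x : ℝ} (hx : 0 ≤ x) : Real.log (x + 3) ≤ 8 * (1 + x) ^ (1/4 : ℝ) := by
  have h := Real.log_le_rpow_div (x := x + 3) (by linarith) (show (0:ℝ) < 1/4 by norm_num)
  have h2 : (x + 3) ^ (1/4:ℝ) ≤ (16 * (1 + x)) ^ (1/4:ℝ) :=
    Real.rpow_le_rpow (by linarith) (by linarith) (by norm_num)
  rw [Real.mul_rpow (by norm_num) (by linarith)] at h2
  have h3 : (16:ℝ) ^ (1/4:ℝ) = 2 := by
    rw [show (16:ℝ) = 2 ^ (4:ℝ) by norm_num, ← Real.rpow_mul (by norm_num)]; norm_num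
  rw [h3] at h2
  rw [le_div_iff₀ (by norm_num)] at h
  linarith

lemma GZ_bd {Z : Finset ℂ} (hZ : ∀ ρ ∈ Z, Fz ρ = 0) {σ : ℝ} (hσ : betaZeta < σ) :
    ∃ K, ∀ s : ℂ, σ ≤ s.re → s.re < 2 → ‖GZ Z s‖ ≤ K * (1 + |s.im|) ^ (-(3/4:ℝ)) := by
  obtain ⟨K, hK, h⟩ := GZ_point hZ
  have hC := Cw_pos
  have hd : 0 < σ - betaZeta := by linarith
  refine ⟨3 * ((K + Cw / (σ - betaZeta)) * 8), fun s h1 h2 => ?_⟩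
  have hb := beta_ge
  have hs0 : s ≠ 0 := by rintro rfl; simp at h1; linarith
  have h3 := h s.im s (by linarith) h2.le (by simp) (Fz_ne_of_beta_lt (by linarith))
  have h4 : ‖∑ ρ ∈ Sw s.im \ Z, (mz ρ : ℂ) / (s - ρ)‖ ≤ Cw * Real.log (|s.im| + 3) / (σ - betaZeta) := by
    refine (norm_sum_le _ _).trans ?_
    have : ∑ ρ ∈ Sw s.im \ Z, ‖(mz ρ : ℂ) / (s - ρ)‖ ≤ ∑ ρ ∈ Sw s.im, (mz ρ : ℝ) / (σ - betaZeta) := by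
      refine le_trans (Finset.sum_le_sum (g := fun ρ => (mz ρ : ℝ) / (σ - betaZeta)) fun ρ hρ => ?_)
        (Finset.sum_le_sum_of_subset_of_nonneg Finset.sdiff_subset fun ρ _ _ => by positivity)
      rw [norm_div, Complex.norm_natCast]
      have := (Complex.re_le_norm (s - ρ))
      rw [Complex.sub_re] at this
      have := (Sw_mem (Finset.mem_sdiff.1 hρ).1).2.2.1
      gcongr
      linarith
    refine this.trans ?_
    rw [← Finset.sum_div]
    gcongr
    exact Sw_count _
  rw [norm_mul] at h3
  have h5 : 1 + |s.im| ≤ 3 * ‖s‖ := by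
    have := Complex.abs_im_le_norm s
    have := Complex.re_le_norm s
    linarith
  have h6 := log_le_quarter (abs_nonneg s.im)
  have hp : 0 < 1 + |s.im| := by positivity
  have e : (1 + |s.im|) ^ (-(3/4:ℝ)) = (1 + |s.im|) ^ (1/4:ℝ) / (1 + |s.im|) := by
    rw [← Real.rpow_sub_one hp.ne']; norm_num
  rw [e, mul_div_assoc', le_div_iff₀ hp]
  calc ‖GZ Z s‖ * (1 + |s.im|) ≤ ‖GZ Z s‖ * (3 * ‖s‖) := by gcongr
    _ = 3 * (‖s‖ * ‖GZ Z s‖) := by ring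
    _ ≤ 3 * ((K + Cw / (σ - betaZeta)) * Real.log (|s.im| + 3)) := by
        refine mul_le_mul_of_nonneg_left ?_ (by norm_num)
        calc _ ≤ _ := h3
          _ ≤ _ := add_le_add_right h4 _
          _ = _ := by ring
    _ ≤ 3 * ((K + Cw / (σ - betaZeta)) * (8 * (1 + |s.im|) ^ (1/4 : ℝ))) := by gcongr
    _ = _ := by ring

lemma GZ_L2 {Z : Finset ℂ} (hZ : ∀ ρ ∈ Z, Fz ρ = 0 ∧ ρ.re = betaZeta) {σ : ℝ} (h1 : betaZeta < σ) (h2 : σ ≤ 5/4) :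
    IntegrableOn (fun y => ‖HZ Z y‖ ^ 2 * Real.exp (-2 * σ * y)) (Set.Ioi 0) ∧
    ∫ y in Set.Ioi (0:ℝ), ‖HZ Z y‖ ^ 2 * Real.exp (-2 * σ * y) =
      1 / (2 * Real.pi) * ∫ t : ℝ, ‖GZ Z (σ + t * Complex.I)‖ ^ 2 := by
  have hle := beta_le
  have hge := beta_ge
  obtain ⟨K, hK⟩ := HZ_bound (Z := Z) fun ρ hρ => by rw [(hZ ρ hρ).2]; exact hle
  refine d_main (HZ_meas Z) beta_ge beta_le hK (fun s hs _ => HZ_laplace (fun ρ hρ => ⟨?_, ?_⟩) hs)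
    (GZ_diff fun ρ hρ => (hZ ρ hρ).2.le) (fun σ hσ => GZ_bd (fun ρ hρ => (hZ ρ hρ).1) hσ) h1 h2
  · rw [(hZ ρ hρ).2]; exact hle
  · rintro rfl
    have := (hZ 0 hρ).2
    simp at this; linarith
end Zd
end

end

section
open MeasureTheory Filter Topology

noncomputable section
namespace Zd

open Classical in
/-- zeros on the critical line `Re = β` up to height `N` -/
def Zn (N : ℕ) : Finset ℂ :=
  ((Finset.Icc (-(N:ℤ)) N).biUnion (fun n => Sw ((n:ℝ) + 1/2))).filter
    (fun ρ => ρ.re = betaZeta ∧ |ρ.im| ≤ N)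

lemma mem_Sw_floor {ρ : ℂ} (h : Fz ρ = 0) (h2 : ρ.re = betaZeta) : ρ ∈ Sw ((⌊ρ.im⌋ : ℝ) + 1/2) := by
  have hb := beta_ge
  have hb2 := beta_le
  refine mem_Sw h ((near_center (by linarith) (by linarith) ?_).trans (by norm_num))
  have h1 := Int.floor_le ρ.im
  have h2 := Int.lt_floor_add_one ρ.im
  rw [abs_le]; constructor <;> linarith

lemma mem_Zn {N : ℕ} {ρ : ℂ} : ρ ∈ Zn N ↔ Fz ρ = 0 ∧ ρ.re = betaZeta ∧ |ρ.im| ≤ N := by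
  unfold Zn
  simp only [Finset.mem_filter, Finset.mem_biUnion, Finset.mem_Icc]
  constructor
  · rintro ⟨⟨n, -, h⟩, h2⟩
    exact ⟨(Sw_mem h).1, h2⟩
  · rintro ⟨h1, h2, h3⟩
    refine ⟨⟨⌊ρ.im⌋, ⟨?_, ?_⟩, mem_Sw_floor h1 h2⟩, h2, h3⟩
    · rw [Int.le_floor]; push_cast; exact (abs_le.1 h3).1
    · have := (Int.floor_le ρ.im).trans (abs_le.1 h3).2
      exact_mod_cast this

lemma Zn_sum : ∃ C > 0, ∀ N : ℕ, ∑ ρ ∈ Zn N, (mz ρ : ℝ) / ‖ρ‖ ≤ C * Real.log (N + 4) ^ 2 := by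
  classical
  have hC := Cw_pos
  refine ⟨20 * Cw, by linarith, fun N => ?_⟩
  have hmaps : ∀ ρ ∈ Zn N, ⌊ρ.im⌋ ∈ Finset.Icc (-(N:ℤ)) N := by
    intro ρ hρ
    obtain ⟨h1, h2, h3⟩ := mem_Zn.1 hρ
    rw [Finset.mem_Icc]
    refine ⟨?_, ?_⟩
    · rw [Int.le_floor]; push_cast; exact (abs_le.1 h3).1
    · have := (Int.floor_le ρ.im).trans (abs_le.1 h3).2
      exact_mod_cast this
  rw [← Finset.sum_fiberwise_of_maps_to hmaps]
  have hlog1 : Real.log (N + 1) ≤ Real.log (N + 4) := Real.log_le_log (by positivity) (by linarith)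
  have hlog4 : 1 ≤ Real.log ((N:ℝ) + 4) := by
    have := one_le_log (x := (N:ℝ) + 1) (by positivity)
    rwa [show (N:ℝ) + 1 + 3 = N + 4 by ring] at this
  have inner : ∀ n ∈ Finset.Icc (-(N:ℤ)) N, ∑ ρ ∈ Zn N with ⌊ρ.im⌋ = n, (mz ρ : ℝ) / ‖ρ‖ ≤
      5 * Cw * Real.log (N + 4) * (1 / (1 + |(n:ℝ)|)) := by
    intro n hn
    have hnN : |(n:ℝ)| ≤ N := by
      rw [Finset.mem_Icc] at hn
      rw [abs_le]; exact ⟨by exact_mod_cast hn.1, by exact_mod_cast hn.2⟩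
    calc ∑ ρ ∈ Zn N with ⌊ρ.im⌋ = n, (mz ρ : ℝ) / ‖ρ‖
        ≤ ∑ ρ ∈ Zn N with ⌊ρ.im⌋ = n, (mz ρ : ℝ) * (5 / (1 + |(n:ℝ)|)) := by
          refine Finset.sum_le_sum fun ρ hρ => ?_
          rw [Finset.mem_filter] at hρ
          obtain ⟨h1, h2, h3⟩ := mem_Zn.1 hρ.1
          have hb := beta_ge
          have r1 := Complex.abs_re_le_norm ρ
          have r2 := Complex.abs_im_le_norm ρ
          rw [h2, abs_of_nonneg (by linarith)] at r1
          have f1 := Int.floor_le ρ.im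
          have f2 := Int.lt_floor_add_one ρ.im
          rw [hρ.2] at f1 f2
          have : |(n:ℝ)| ≤ |ρ.im| + 1 := by
            calc |(n:ℝ)| = |ρ.im + (n - ρ.im)| := by ring_nf
              _ ≤ |ρ.im| + |n - ρ.im| := abs_add_le _ _
              _ ≤ _ := by
                gcongr; rw [abs_le]; constructor <;> linarith
          rw [div_eq_mul_inv]
          gcongr
          rw [inv_le_comm₀ (by linarith) (by positivity), inv_div, div_le_iff₀ (by norm_num)]
          linarith
      _ ≤ ∑ ρ ∈ Sw ((n:ℝ) + 1/2), (mz ρ : ℝ) * (5 / (1 + |(n:ℝ)|)) := by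
          refine Finset.sum_le_sum_of_subset_of_nonneg (fun ρ hρ => ?_) fun ρ _ _ => by positivity
          rw [Finset.mem_filter] at hρ
          obtain ⟨h1, h2, h3⟩ := mem_Zn.1 hρ.1
          have := mem_Sw_floor h1 h2
          rwa [hρ.2] at this
      _ ≤ (Cw * Real.log (N + 4)) * (5 / (1 + |(n:ℝ)|)) := by
          rw [← Finset.sum_mul]
          gcongr
          refine (Sw_count _).trans ?_
          have := abs_add_le (n:ℝ) (1/2)
          rw [abs_of_pos (show (0:ℝ) < 1/2 by norm_num)] at this
          exact mul_le_mul_of_nonneg_left (Real.log_le_log (by positivity) (by linarith)) hC.le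
      _ = _ := by ring
  refine (Finset.sum_le_sum inner).trans ?_
  rw [← Finset.mul_sum]
  have hev : Function.Even (fun n : ℤ => 1 / (1 + |(n:ℝ)|)) := fun n => by simp
  rw [Finset.sum_Icc_of_even_eq_range hev N]
  have hh := harmonic_le_one_add_log (N + 1)
  have he : ((harmonic (N+1) : ℚ) : ℝ) = ∑ m ∈ Finset.range (N + 1), 1 / (1 + |((m:ℤ):ℝ)|) := by
    rw [harmonic]; push_cast
    refine Finset.sum_congr rfl fun i _ => ?_
    rw [Nat.abs_cast, one_div, add_comm]
  rw [he] at hh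
  push_cast at hh ⊢
  calc _ ≤ 5 * Cw * Real.log (N + 4) * (2 * (1 + Real.log (N + 1))) := by
        gcongr
        simp only [nsmul_eq_mul]; push_cast
        norm_num at hh ⊢
        linarith
    _ ≤ 5 * Cw * Real.log (N + 4) * (2 * (Real.log (N+4) + Real.log (N + 4))) := by gcongr
    _ = _ := by ring

lemma int_split {f : ℝ → ℝ} {a : ℤ → ℝ} (ha : Summable a)
    (h : ∀ n : ℤ, ∫ t in Set.Ioc (n:ℝ) (n+1), f t ≤ a n) (h0 : ∀ n, 0 ≤ a n) : ∫ t, f t ≤ ∑' n, a n := by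
  by_cases hf : Integrable f
  · have := hasSum_integral_iUnion (s := fun n : ℤ => Set.Ioc (n:ℝ) (n+1)) (f := f) (μ := volume)
      (fun _ => measurableSet_Ioc) (by exact Set.pairwise_disjoint_Ioc_intCast ℝ) (by rw [iUnion_Ioc_intCast]; exact hf.integrableOn)
    rw [iUnion_Ioc_intCast, setIntegral_univ] at this
    exact hasSum_le h this ha.hasSum
  · rw [integral_undef hf]; exact tsum_nonneg h0

lemma kernel_int {σ : ℝ} (hσ : 0 < σ) (γ : ℝ) : Integrable (fun t : ℝ => 1 / (σ^2 + (t - γ)^2)) ∧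
    ∫ t : ℝ, 1 / (σ^2 + (t - γ)^2) = Real.pi / σ := by
  have e : (fun t : ℝ => 1 / (σ^2 + (t - γ)^2)) = fun t => (1/σ^2) * (1 + ((t - γ)/σ)^2)⁻¹ := by
    ext t
    have : σ^2 + (t-γ)^2 ≠ 0 := by positivity
    have : 1 + ((t - γ)/σ)^2 ≠ 0 := by positivity
    field_simp
  rw [e]
  constructor
  · exact ((integrable_inv_one_add_sq.comp_div hσ.ne').comp_sub_right γ).const_mul _
  · rw [integral_const_mul, integral_sub_right_eq_self (fun t : ℝ => (1 + (t/σ)^2)⁻¹),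
      Measure.integral_comp_div (fun t : ℝ => (1 + t^2)⁻¹), integral_univ_inv_one_add_sq, abs_of_pos hσ]
    simp only [smul_eq_mul]
    field_simp

lemma win_q {T : Finset ℂ} {σ : ℝ} (hσ : 0 < σ) (hT : ∀ ρ ∈ T, ρ.re ≤ betaZeta) (n : ℤ) :
    ∃ q : ℝ → ℝ, IntegrableOn q (Set.Ioc (n:ℝ) (n+1)) ∧
    (∀ t : ℝ, ‖∑ ρ ∈ T, (mz ρ : ℂ) / (((betaZeta + σ : ℝ) + t * Complex.I) - ρ)‖ ^ 2 ≤ q t) ∧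
    ∫ t in Set.Ioc (n:ℝ) (n+1), q t ≤ (∑ ρ ∈ T, (mz ρ : ℝ))^2 * (Real.pi / σ) := by
  set q : ℝ → ℝ := fun t => (∑ ρ ∈ T, (mz ρ : ℝ)) * ∑ ρ ∈ T, (mz ρ : ℝ) * (1 / (σ^2 + (t - ρ.im)^2)) with hq
  have hi : Integrable q :=
    (integrable_finsetSum _ fun ρ _ => (kernel_int hσ ρ.im).1.const_mul _).const_mul _
  have hq0 : ∀ t, 0 ≤ q t := fun t => by
    simp only [hq]
    exact mul_nonneg (Finset.sum_nonneg fun _ _ => by positivity) (Finset.sum_nonneg fun _ _ => by positivity)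
  refine ⟨q, hi.integrableOn, fun t => ?_, ?_⟩
  · refine (pow_le_pow_left₀ (norm_nonneg _) (norm_sum_le _ _) 2).trans ?_
    refine Finset.sum_sq_le_sum_mul_sum_of_sq_le_mul T (fun _ _ => by positivity) (fun _ _ => by positivity) fun ρ hρ => ?_
    rw [norm_div, Complex.norm_natCast, div_pow]
    have : σ^2 + (t - ρ.im)^2 ≤ ‖((betaZeta + σ : ℝ) + t * Complex.I : ℂ) - ρ‖^2 := by
      rw [← Complex.normSq_eq_norm_sq, Complex.normSq_apply]
      simp
      nlinarith [hT ρ hρ]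
    calc _ ≤ (mz ρ : ℝ)^2 / (σ^2 + (t - ρ.im)^2) := by gcongr
      _ = _ := by ring
  · refine (setIntegral_le_integral hi (ae_of_all _ hq0)).trans_eq ?_
    simp only [hq]
    rw [integral_const_mul, integral_finsetSum _ fun ρ _ => (kernel_int hσ ρ.im).1.const_mul _]
    simp_rw [integral_const_mul, fun ρ : ℂ => (kernel_int hσ ρ.im).2]
    rw [← Finset.sum_mul]; ring

lemma win_q2 {T : Finset ℂ} {σ : ℝ} (hσ : 0 < σ) (hT : ∀ ρ ∈ T, ρ.re < betaZeta) (n : ℤ) :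
    ∃ q : ℝ → ℝ, IntegrableOn q (Set.Ioc (n:ℝ) (n+1)) ∧
    (∀ t : ℝ, ‖∑ ρ ∈ T, (mz ρ : ℂ) / (((betaZeta + σ : ℝ) + t * Complex.I) - ρ)‖ ^ 2 ≤ q t) ∧
    ∫ t in Set.Ioc (n:ℝ) (n+1), q t ≤ (∑ ρ ∈ T, (mz ρ : ℝ) / (betaZeta - ρ.re))^2 := by
  refine ⟨fun _ => (∑ ρ ∈ T, (mz ρ : ℝ) / (betaZeta - ρ.re))^2, by simp, fun t => ?_, by simp⟩
  refine (pow_le_pow_left₀ (norm_nonneg _) (norm_sum_le _ _) 2).trans ?_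
  refine pow_le_pow_left₀ (Finset.sum_nonneg fun _ _ => by positivity) (Finset.sum_le_sum fun ρ hρ => ?_) 2
  rw [norm_div, Complex.norm_natCast]
  have h1 := hT ρ hρ
  have := (Complex.re_le_norm (((betaZeta + σ : ℝ) + t * Complex.I : ℂ) - ρ))
  have e : ((((betaZeta + σ : ℝ) + t * Complex.I : ℂ) - ρ)).re = betaZeta + σ - ρ.re := by simp
  rw [e] at this
  exact div_le_div_of_nonneg_left (by positivity) (by linarith) (by linarith)

lemma win_int {Z : Finset ℂ} {K : ℝ} (hK : 0 < K) (h : ∀ (τ : ℝ) (s : ℂ),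
    1 / 2 ≤ s.re → s.re ≤ 2 → |s.im - τ| ≤ 1 / 2 → Fz s ≠ 0 →
    ‖s * GZ Z s‖ ≤ K * Real.log (|τ| + 3) + ‖∑ ρ ∈ Sw τ \ Z, (mz ρ : ℂ) / (s - ρ)‖)
    {σ : ℝ} (hσ : 0 < σ) (hσ1 : σ ≤ 1/8) (n : ℤ) {B : ℝ}
    (hq : ∃ q : ℝ → ℝ, IntegrableOn q (Set.Ioc (n:ℝ) (n+1)) ∧
    (∀ t : ℝ, ‖∑ ρ ∈ Sw ((n:ℝ)+1/2) \ Z, (mz ρ : ℂ) / (((betaZeta + σ : ℝ) + t * Complex.I) - ρ)‖ ^ 2 ≤ q t) ∧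
    ∫ t in Set.Ioc (n:ℝ) (n+1), q t ≤ B) :
    ∫ t in Set.Ioc (n:ℝ) (n+1), ‖GZ Z ((betaZeta + σ : ℝ) + t * Complex.I)‖^2 ≤
      28 / (1 + (n:ℝ)^2) * (K^2 * Real.log (|(n:ℝ)| + 4)^2 + B) := by
  obtain ⟨q, q1, q2, q3⟩ := hq
  have hge := beta_ge
  have hle := beta_le
  have key : ∫ t in Set.Ioc (n:ℝ) (n+1), ‖GZ Z ((betaZeta + σ : ℝ) + t * Complex.I)‖^2 ≤
      ∫ t in Set.Ioc (n:ℝ) (n+1), 28 / (1 + (n:ℝ)^2) * (K^2 * Real.log (|(n:ℝ)| + 4)^2 + q t) := by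
    refine integral_mono_of_nonneg (ae_of_all _ fun _ => by positivity)
      (((integrable_const _).add q1).const_mul _) ?_
    refine (ae_restrict_iff' measurableSet_Ioc).2 (ae_of_all _ fun t ht => ?_)
    set s : ℂ := (betaZeta + σ : ℝ) + t * Complex.I with hs
    have hsre : s.re = betaZeta + σ := by simp [hs]
    have hsim : s.im = t := by simp [hs]
    have h1 := h ((n:ℝ)+1/2) s (by rw [hsre]; linarith) (by rw [hsre]; linarith)
      (by rw [hsim, abs_le]; constructor <;> linarith [ht.1, ht.2])
      (Fz_ne_of_beta_lt (by rw [hsre]; linarith))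
    have hlog : Real.log (|(n:ℝ)+1/2| + 3) ≤ Real.log (|(n:ℝ)| + 4) := by
      have := abs_add_le (n:ℝ) (1/2)
      rw [abs_of_pos (show (0:ℝ) < 1/2 by norm_num)] at this
      exact Real.log_le_log (by positivity) (by linarith)
    have h2 : ‖s * GZ Z s‖ ≤ K * Real.log (|(n:ℝ)| + 4) + ‖∑ ρ ∈ Sw ((n:ℝ)+1/2) \ Z, (mz ρ : ℂ) / (s - ρ)‖ :=
      h1.trans (by gcongr)
    have h3 := q2 t
    rw [← hs] at h3
    set w := ‖∑ ρ ∈ Sw ((n:ℝ)+1/2) \ Z, (mz ρ : ℂ) / (s - ρ)‖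
    set L := Real.log (|(n:ℝ)| + 4)
    have h4 : ‖s * GZ Z s‖^2 ≤ 2 * (K^2 * L^2 + q t) := by
      calc _ ≤ (K * L + w)^2 := pow_le_pow_left₀ (norm_nonneg _) h2 2
        _ ≤ 2 * (K^2 * L^2 + w^2) := by nlinarith [sq_nonneg (K * L - w)]
        _ ≤ _ := by linarith
    have h5 : 1 + (n:ℝ)^2 ≤ 14 * ‖s‖^2 := by
      rw [← Complex.normSq_eq_norm_sq, Complex.normSq_apply, hsre, hsim]
      have a1 := ht.1
      have a2 := ht.2
      have : (n:ℝ)^2 ≤ 2*t^2 + 2 := by nlinarith [sq_nonneg (2*t - n)]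
      nlinarith
    rw [norm_mul, mul_pow] at h4
    change ‖GZ Z s‖^2 ≤ 28 / (1 + (n:ℝ)^2) * (K^2 * L^2 + q t)
    rw [div_mul_eq_mul_div, le_div_iff₀ (by positivity)]
    calc ‖GZ Z s‖^2 * (1 + (n:ℝ)^2) ≤ ‖GZ Z s‖^2 * (14 * ‖s‖^2) := by gcongr
      _ = 14 * (‖s‖^2 * ‖GZ Z s‖^2) := by ring
      _ ≤ _ := by linarith
  refine key.trans ?_
  rw [integral_const_mul, integral_add (integrable_const _) q1]
  gcongr
  simp
end Zd
end

end

section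
open MeasureTheory Filter Topology

noncomputable section
namespace Zd

lemma log_sq_le {x : ℝ} (hx : 1 ≤ x) : Real.log x ^ 2 ≤ 64 * x ^ (1/4:ℝ) := by
  have h := Real.log_le_rpow_div (x := x) (by linarith) (show (0:ℝ) < 1/8 by norm_num)
  have h0 := Real.log_nonneg hx
  have e : (x ^ (1/8:ℝ))^2 = x ^ (1/4:ℝ) := by
    rw [← Real.rpow_natCast, ← Real.rpow_mul (by linarith)]; norm_num
  calc Real.log x ^ 2 ≤ (x ^ (1/8:ℝ) / (1/8))^2 := pow_le_pow_left₀ h0 h 2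
    _ = 64 * (x ^ (1/8:ℝ))^2 := by ring
    _ = _ := by rw [e]

lemma summable_x : Summable (fun n : ℤ => (|(n:ℝ)| + 4) ^ (-(3/2):ℝ)) := by
  have h := (Real.summable_one_div_int_add_rpow (1/2) (3/2)).2 (by norm_num)
  refine Summable.of_nonneg_of_le (fun n => by positivity) (fun n => ?_) h
  have h1 : (0:ℝ) < |(n:ℝ) + 1/2| := by
    rw [abs_pos]
    intro h0
    have : (2 * n + 1 : ℝ) = 0 := by linarith
    have : (2 * n + 1 : ℤ) = 0 := by exact_mod_cast this
    omega
  have h2 := abs_add_le (n:ℝ) (1/2)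
  rw [abs_of_pos (show (0:ℝ) < 1/2 by norm_num)] at h2
  rw [Real.rpow_neg (by positivity), one_div]
  gcongr
  linarith

lemma win_bound {N : ℕ} (hN : 1 ≤ N) {K : ℝ} (hK : 0 < K) (h : ∀ (τ : ℝ) (s : ℂ),
    1 / 2 ≤ s.re → s.re ≤ 2 → |s.im - τ| ≤ 1 / 2 → Fz s ≠ 0 →
    ‖s * GZ (Zn N) s‖ ≤ K * Real.log (|τ| + 3) + ‖∑ ρ ∈ Sw τ \ Zn N, (mz ρ : ℂ) / (s - ρ)‖) :
    ∃ K' ≥ 0, ∀ σ : ℝ, 0 < σ → σ ≤ 1/8 → ∀ n : ℤ,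
    ∫ t in Set.Ioc (n:ℝ) (n+1), ‖GZ (Zn N) ((betaZeta + σ : ℝ) + t * Complex.I)‖^2 ≤
      28 * 32 * 64 * (|(n:ℝ)| + 4) ^ (-(3/2):ℝ) * (K^2 + K' + Cw^2 * Real.pi * (N:ℝ) ^ (-(1/4):ℝ) / σ) := by
  set Kn : ℤ → ℝ := fun n => (∑ ρ ∈ Sw ((n:ℝ)+1/2) \ Zn N, (mz ρ : ℝ) / (betaZeta - ρ.re))^2 with hKn
  refine ⟨∑ n ∈ Finset.Icc (-(N:ℤ)) N, Kn n, Finset.sum_nonneg fun _ _ => sq_nonneg _, fun σ hσ hσ1 n => ?_⟩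
  set K' := ∑ n ∈ Finset.Icc (-(N:ℤ)) N, Kn n with hK'
  have hK'0 : 0 ≤ K' := Finset.sum_nonneg fun _ _ => sq_nonneg _
  set x : ℝ := |(n:ℝ)| + 4 with hx
  have hx4 : 4 ≤ x := by have := abs_nonneg (n:ℝ); linarith
  have hN0 : (0:ℝ) < N := by exact_mod_cast hN
  have hL := log_sq_le (x := x) (by linarith)
  set M := Cw^2 * Real.pi * (N:ℝ) ^ (-(1/4):ℝ) / σ with hM
  have hM0 : 0 ≤ M := by have := Cw_pos; positivity
  have hxx : x ^ (1/4:ℝ) ≤ x ^ (1/2:ℝ) := Real.rpow_le_rpow_of_exponent_le (by linarith) (by norm_num)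
  have hx1 : 1 ≤ x ^ (1/2:ℝ) := Real.one_le_rpow (by linarith) (by norm_num)
  have main : ∃ B, B ≤ 64 * x ^ (1/2:ℝ) * (K' + M) ∧
    ∃ q : ℝ → ℝ, IntegrableOn q (Set.Ioc (n:ℝ) (n+1)) ∧
    (∀ t : ℝ, ‖∑ ρ ∈ Sw ((n:ℝ)+1/2) \ Zn N, (mz ρ : ℂ) / (((betaZeta + σ : ℝ) + t * Complex.I) - ρ)‖ ^ 2 ≤ q t) ∧
    ∫ t in Set.Ioc (n:ℝ) (n+1), q t ≤ B := by
    by_cases hn : |(n:ℝ)| + 3 ≤ N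
    · refine ⟨Kn n, ?_, win_q2 hσ ?_ n⟩
      · have : Kn n ≤ K' := by
          refine Finset.single_le_sum (f := Kn) (fun _ _ => sq_nonneg _) ?_
          have h2 : |(n:ℝ)| ≤ N := by linarith
          rw [abs_le] at h2
          rw [Finset.mem_Icc]
          exact ⟨by exact_mod_cast h2.1, by exact_mod_cast h2.2⟩
        nlinarith
      · intro ρ hρ
        rw [Finset.mem_sdiff, mem_Zn] at hρ
        have h1 := Sw_mem hρ.1
        refine lt_of_le_of_ne h1.2.2.1 fun he => hρ.2 ⟨h1.1, he, ?_⟩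
        have h3 := h1.2.2.2
        have h4 : |ρ.im| ≤ |ρ.im - ((n:ℝ)+1/2)| + |(n:ℝ)+1/2| := by
          simpa using abs_add_le (ρ.im - ((n:ℝ)+1/2)) ((n:ℝ)+1/2)
        have h5 := abs_add_le (n:ℝ) (1/2)
        rw [abs_of_pos (show (0:ℝ) < 1/2 by norm_num)] at h5
        linarith
    · push Not at hn
      refine ⟨(∑ ρ ∈ Sw ((n:ℝ)+1/2) \ Zn N, (mz ρ : ℝ))^2 * (Real.pi / σ), ?_, win_q hσ ?_ n⟩
      · have c1 : ∑ ρ ∈ Sw ((n:ℝ)+1/2) \ Zn N, (mz ρ : ℝ) ≤ Cw * Real.log x := by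
          refine (Finset.sum_le_sum_of_subset_of_nonneg Finset.sdiff_subset fun _ _ _ => by positivity).trans ?_
          refine (Sw_count _).trans ?_
          have := abs_add_le (n:ℝ) (1/2)
          rw [abs_of_pos (show (0:ℝ) < 1/2 by norm_num)] at this
          exact mul_le_mul_of_nonneg_left (Real.log_le_log (by positivity) (by linarith)) Cw_pos.le
        have c2 : (∑ ρ ∈ Sw ((n:ℝ)+1/2) \ Zn N, (mz ρ : ℝ))^2 ≤ Cw^2 * (64 * x ^ (1/4:ℝ)) := by
          refine (pow_le_pow_left₀ (Finset.sum_nonneg fun _ _ => by positivity) c1 2).trans ?_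
          rw [mul_pow]; gcongr
        have c3 : x ^ (1/4:ℝ) ≤ x ^ (1/2:ℝ) * (N:ℝ) ^ (-(1/4):ℝ) := by
          rw [Real.rpow_neg hN0.le, ← div_eq_mul_inv, le_div_iff₀ (by positivity)]
          calc x ^ (1/4:ℝ) * (N:ℝ)^(1/4:ℝ) ≤ x ^ (1/4:ℝ) * x^(1/4:ℝ) := by
                gcongr; linarith
            _ = _ := by rw [← Real.rpow_add (by linarith)]; norm_num
        calc _ ≤ Cw^2 * (64 * x ^ (1/4:ℝ)) * (Real.pi / σ) := by gcongr
          _ ≤ Cw^2 * (64 * (x ^ (1/2:ℝ) * (N:ℝ) ^ (-(1/4):ℝ))) * (Real.pi / σ) := by gcongr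
          _ = 64 * x ^ (1/2:ℝ) * M := by rw [hM]; ring
          _ ≤ _ := by gcongr; linarith
      · intro ρ hρ
        rw [Finset.mem_sdiff] at hρ
        exact (Sw_mem hρ.1).2.2.1
  obtain ⟨B, hB, hq⟩ := main
  refine (win_int hK h hσ hσ1 n hq).trans ?_
  have d1 : 28 / (1 + (n:ℝ)^2) ≤ 28 * 32 * x ^ (-2:ℝ) := by
    rw [Real.rpow_neg (by linarith), Real.rpow_two, ← div_eq_mul_inv, div_le_div_iff₀ (by positivity) (by positivity), hx]
    nlinarith [sq_abs (n:ℝ), sq_nonneg (|(n:ℝ)| - 4)]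
  have d2 : K^2 * Real.log x ^2 + B ≤ 64 * x ^ (1/2:ℝ) * (K^2 + K' + M) := by
    have : K^2 * Real.log x ^2 ≤ K^2 * (64 * x ^ (1/2:ℝ)) := by gcongr; linarith
    linarith
  have d3 : x ^ (-(3/2):ℝ) = x ^ (-2:ℝ) * x ^ (1/2:ℝ) := by
    rw [← Real.rpow_add (by linarith)]; norm_num
  calc _ ≤ 28 / (1 + (n:ℝ)^2) * (64 * x ^ (1/2:ℝ) * (K^2 + K' + M)) := by gcongr
    _ ≤ 28 * 32 * x ^ (-2:ℝ) * (64 * x ^ (1/2:ℝ) * (K^2 + K' + M)) := by gcongr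
    _ = _ := by rw [d3]; ring

lemma GZn_int : ∃ C0 > 0, ∀ N : ℕ, 1 ≤ N → ∃ A, ∀ σ : ℝ, 0 < σ → σ ≤ 1/8 →
    ∫ t : ℝ, ‖GZ (Zn N) ((betaZeta + σ : ℝ) + t * Complex.I)‖^2 ≤ A + C0 * (N:ℝ)^(-(1/4):ℝ) / σ := by
  set S := ∑' n : ℤ, (|(n:ℝ)| + 4) ^ (-(3/2):ℝ) with hS
  have hS0 : 0 < S := summable_x.tsum_pos (fun n => by positivity) 0 (by positivity)
  have hC := Cw_pos
  refine ⟨28 * 32 * 64 * S * (Cw^2 * Real.pi), by positivity, fun N hN => ?_⟩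
  obtain ⟨K, hK, h⟩ := GZ_point (Z := Zn N) (fun ρ hρ => (mem_Zn.1 hρ).1)
  obtain ⟨K', hK', h'⟩ := win_bound hN hK h
  refine ⟨28 * 32 * 64 * S * (K^2 + K'), fun σ hσ hσ1 => ?_⟩
  have := int_split (f := fun t : ℝ => ‖GZ (Zn N) ((betaZeta + σ : ℝ) + t * Complex.I)‖^2)
    ((summable_x.mul_left (28 * 32 * 64)).mul_right (K^2 + K' + Cw^2 * Real.pi * (N:ℝ) ^ (-(1/4):ℝ) / σ))
    (h' σ hσ hσ1) (fun n => by positivity)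
  refine this.trans_eq ?_
  rw [tsum_mul_right, tsum_mul_left, ← hS]
  ring

lemma HZn_int : ∃ C0 > 0, ∀ N : ℕ, 1 ≤ N → ∃ A, 0 ≤ A ∧ ∀ Y : ℝ, 8 ≤ Y →
    IntegrableOn (fun y => ‖HZ (Zn N) y‖^2 * Real.exp (-2 * betaZeta * y)) (Set.Ioc 0 Y) ∧
    ∫ y in Set.Ioc 0 Y, ‖HZ (Zn N) y‖^2 * Real.exp (-2 * betaZeta * y) ≤ A + C0 * (N:ℝ)^(-(1/4):ℝ) * Y := by
  obtain ⟨C0, hC0, h⟩ := GZn_int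
  refine ⟨Real.exp 2 * (1 / (2*Real.pi) * C0), by positivity, fun N hN => ?_⟩
  obtain ⟨A, hA⟩ := h N hN
  refine ⟨Real.exp 2 * (1 / (2*Real.pi) * |A|), by positivity, fun Y hY => ?_⟩
  have hσ : 0 < 1 / Y := by positivity
  have hσ1 : 1 / Y ≤ 1/8 := one_div_le_one_div_of_le (by norm_num) hY
  have hle := beta_le
  obtain ⟨i1, i2⟩ := GZ_L2 (Z := Zn N) (σ := betaZeta + 1/Y)
    (fun ρ hρ => ⟨(mem_Zn.1 hρ).1, (mem_Zn.1 hρ).2.1⟩) (by linarith) (by linarith)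
  have i3 := hA (1/Y) hσ hσ1
  have hsub : Set.Ioc 0 Y ⊆ Set.Ioi (0:ℝ) := fun y hy => hy.1
  have hpt : ∀ y ∈ Set.Ioc 0 Y, ‖HZ (Zn N) y‖^2 * Real.exp (-2 * betaZeta * y) ≤
      Real.exp 2 * (‖HZ (Zn N) y‖^2 * Real.exp (-2 * (betaZeta + 1/Y) * y)) := by
    intro y hy
    rw [mul_left_comm, ← Real.exp_add]
    gcongr
    have : y / Y ≤ 1 := (div_le_one (by linarith)).2 hy.2
    have e : 2 + -2 * (betaZeta + 1/Y) * y = -2 * betaZeta * y + 2 * (1 - y / Y) := by ring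
    rw [e]; linarith
  have i4 := (i1.mono_set hsub).const_mul (Real.exp 2)
  have hInt : IntegrableOn (fun y => ‖HZ (Zn N) y‖^2 * Real.exp (-2 * betaZeta * y)) (Set.Ioc 0 Y) := by
    refine Integrable.mono' i4 ?_ ((ae_restrict_iff' measurableSet_Ioc).2 (ae_of_all _ fun y hy => ?_))
    · exact ((((HZ_meas (Zn N)).norm).pow_const 2).mul (by fun_prop)).aestronglyMeasurable
    · rw [Real.norm_of_nonneg (by positivity)]; exact hpt y hy
  refine ⟨hInt, ?_⟩
  calc _ ≤ ∫ y in Set.Ioc 0 Y, Real.exp 2 * (‖HZ (Zn N) y‖^2 * Real.exp (-2 * (betaZeta + 1/Y) * y)) :=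
        setIntegral_mono_on hInt i4 measurableSet_Ioc hpt
    _ = Real.exp 2 * ∫ y in Set.Ioc 0 Y, (‖HZ (Zn N) y‖^2 * Real.exp (-2 * (betaZeta + 1/Y) * y)) := integral_const_mul _ _
    _ ≤ Real.exp 2 * ∫ y in Set.Ioi 0, (‖HZ (Zn N) y‖^2 * Real.exp (-2 * (betaZeta + 1/Y) * y)) := by
        exact mul_le_mul_of_nonneg_left
          (setIntegral_mono_set i1 (ae_of_all _ fun y => by positivity) hsub.eventuallyLE) (by positivity)
    _ ≤ Real.exp 2 * (1 / (2*Real.pi) * (|A| + C0 * (N:ℝ)^(-(1/4):ℝ) * Y)) := by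
        rw [i2]
        gcongr
        refine i3.trans ?_
        rw [div_div_eq_mul_div, div_one]
        linarith [le_abs_self A]
    _ = _ := by ring

end Zd
end

end

section
open MeasureTheory Filter Topology

noncomputable section
namespace Zd

/-- normalised remainder -/
def fz (y : ℝ) : ℝ := Real.exp (-betaZeta * y) * hz y

/-- trigonometric polynomial -/
def QN (N : ℕ) (y : ℝ) : ℝ := (-(∑ ρ ∈ Zn N, (mz ρ : ℂ) / ρ * Complex.exp ((ρ.im * y : ℝ) * Complex.I))).re

lemma fz_meas : Measurable fz := by
  unfold fz
  exact (by fun_prop : Measurable fun y : ℝ => Real.exp (-betaZeta * y)).mul hz_meas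

lemma QN_cont (N : ℕ) : Continuous (QN N) := by
  unfold QN
  refine Complex.continuous_re.comp (Continuous.neg (continuous_finsetSum _ fun ρ _ => ?_))
  fun_prop

lemma QN_bound : ∃ C > 0, ∀ N y, |QN N y| ≤ C * Real.log (N + 4) ^ 2 := by
  obtain ⟨C, hC, h⟩ := Zn_sum
  refine ⟨C, hC, fun N y => le_trans ?_ (h N)⟩
  unfold QN
  refine (Complex.abs_re_le_norm _).trans ?_
  rw [norm_neg]
  refine (norm_sum_le _ _).trans (Finset.sum_le_sum fun ρ _ => ?_)
  rw [norm_mul, Complex.norm_exp_ofReal_mul_I, mul_one, norm_div, Complex.norm_natCast]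

lemma fz_bound {y : ℝ} (hy : 0 ≤ y) : |fz y| ≤ (Real.log 4 + 4) * Real.exp (y / 2) := by
  unfold fz
  have hb := beta_ge
  have h4 : 0 ≤ Real.log 4 := Real.log_nonneg (by norm_num)
  rw [abs_mul, Real.abs_exp]
  calc _ ≤ Real.exp (-betaZeta * y) * ((Real.log 4 + 4) * Real.exp y) := by
        gcongr; exact hz_bound y
    _ = (Real.log 4 + 4) * Real.exp (-betaZeta * y + y) := by rw [Real.exp_add]; ring
    _ ≤ _ := by gcongr; nlinarith

lemma fz_sub (N : ℕ) (y : ℝ) : (fz y - QN N y)^2 ≤ ‖HZ (Zn N) y‖^2 * Real.exp (-2 * betaZeta * y) := by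
  have e : fz y - QN N y = ((Real.exp (-betaZeta * y) : ℂ) * HZ (Zn N) y).re := by
    unfold fz QN HZ
    rw [mul_add, Finset.mul_sum, Complex.add_re, Complex.neg_re, sub_neg_eq_add]
    congr 1
    · rw [← Complex.ofReal_mul, Complex.ofReal_re]
    · congr 1
      refine Finset.sum_congr rfl fun ρ hρ => ?_
      obtain ⟨h1, h2, h3⟩ := mem_Zn.1 hρ
      rw [mul_left_comm, Complex.ofReal_exp, ← Complex.exp_add]
      congr 2
      conv_rhs => rw [← Complex.re_add_im ρ, h2]
      push_cast
      ring
  rw [e, ← sq_abs]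
  calc _ ≤ ‖(Real.exp (-betaZeta * y) : ℂ) * HZ (Zn N) y‖^2 :=
        pow_le_pow_left₀ (abs_nonneg _) (Complex.abs_re_le_norm _) 2
    _ = _ := by
      rw [norm_mul, Complex.norm_real, Real.norm_of_nonneg (by positivity), mul_pow, ← Real.exp_nat_mul, mul_comm]
      congr 2; push_cast; ring

lemma bdd_int {f : ℝ → ℝ} (hf : Measurable f) {a b M : ℝ} (h : ∀ y ∈ Set.Ioc a b, |f y| ≤ M) :
    IntegrableOn f (Set.Ioc a b) :=
  Measure.integrableOn_of_bounded (M := M) (by simp) hf.aestronglyMeasurable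
    ((ae_restrict_iff' measurableSet_Ioc).2 (ae_of_all _ h))

lemma fz_bdd {a b : ℝ} (ha : 0 ≤ a) : ∀ y ∈ Set.Ioc a b, |fz y| ≤ (Real.log 4 + 4) * Real.exp (b / 2) := by
  intro y hy
  have h4 : 0 ≤ Real.log 4 := Real.log_nonneg (by norm_num)
  refine (fz_bound (ha.trans hy.1.le)).trans ?_
  gcongr
  exact hy.2

lemma fz_L2 : ∃ C0 > 0, ∀ N : ℕ, 1 ≤ N → ∃ A, 0 ≤ A ∧ ∀ Y : ℝ, 8 ≤ Y →
    IntegrableOn (fun y => (fz y - QN N y)^2) (Set.Ioc 0 Y) ∧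
    ∫ y in Set.Ioc 0 Y, (fz y - QN N y)^2 ≤ A + C0 * (N:ℝ)^(-(1/4):ℝ) * Y := by
  obtain ⟨C0, hC0, h⟩ := HZn_int
  refine ⟨C0, hC0, fun N hN => ?_⟩
  obtain ⟨A, hA, h⟩ := h N hN
  refine ⟨A, hA, fun Y hY => ?_⟩
  obtain ⟨i1, i2⟩ := h Y hY
  have i3 : IntegrableOn (fun y => (fz y - QN N y)^2) (Set.Ioc 0 Y) := by
    refine Integrable.mono' i1 ?_ (ae_of_all _ fun y => ?_)
    · exact ((fz_meas.sub (QN_cont N).measurable).pow_const 2).aestronglyMeasurable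
    · rw [Real.norm_of_nonneg (by positivity)]; exact fz_sub N y
  exact ⟨i3, (integral_mono i3 i1 (fz_sub N)).trans i2⟩

lemma fz_sq : ∃ C > 0, ∀ Y : ℝ, 0 ≤ Y → ∫ y in Set.Ioc 0 Y, fz y ^ 2 ≤ C * (Y + 1) := by
  obtain ⟨C0, hC0, h⟩ := fz_L2
  obtain ⟨A, hA, h⟩ := h 1 le_rfl
  obtain ⟨C, hC, hQ⟩ := QN_bound
  set B := C * Real.log ((1:ℕ) + 4) ^ 2 with hB
  have hB0 : 0 ≤ B := by positivity
  have main : ∀ Y : ℝ, 8 ≤ Y → ∫ y in Set.Ioc 0 Y, fz y ^ 2 ≤ 2 * A + (2 * C0 + 2 * B^2) * Y := by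
    intro Y hY
    obtain ⟨i1, i2⟩ := h Y hY
    have i3 : IntegrableOn (fun y => 2 * (fz y - QN 1 y)^2 + 2 * B^2) (Set.Ioc 0 Y) :=
      (i1.const_mul 2).add (integrable_const _)
    calc _ ≤ ∫ y in Set.Ioc 0 Y, (2 * (fz y - QN 1 y)^2 + 2 * B^2) := by
          refine integral_mono_of_nonneg (ae_of_all _ fun _ => sq_nonneg _) i3 (ae_of_all _ fun y => ?_)
          have h1 : (QN 1 y)^2 ≤ B^2 := by rw [← sq_abs]; exact pow_le_pow_left₀ (abs_nonneg _) (hQ 1 y) 2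
          change fz y ^ 2 ≤ 2 * (fz y - QN 1 y)^2 + 2 * B^2
          nlinarith [sq_nonneg (fz y - 2 * QN 1 y)]
      _ = 2 * (∫ y in Set.Ioc 0 Y, (fz y - QN 1 y)^2) + 2 * B^2 * Y := by
          rw [integral_add (i1.const_mul 2) (integrable_const _), integral_const_mul]
          simp [max_eq_left (show (0:ℝ) ≤ Y by linarith)]
          ring
      _ ≤ _ := by
          simp only [Nat.cast_one, Real.one_rpow, mul_one] at i2
          linarith
  refine ⟨2 * A + (2 * C0 + 2 * B^2) * 8, by positivity, fun Y hY => ?_⟩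
  have hm : IntegrableOn (fun y => fz y ^ 2) (Set.Ioc 0 (Y + 8)) :=
    bdd_int (fz_meas.pow_const 2) (M := ((Real.log 4 + 4) * Real.exp ((Y+8) / 2))^2) fun y hy => by
      rw [abs_pow]; exact pow_le_pow_left₀ (abs_nonneg _) (fz_bdd le_rfl y hy) 2
  have hA2 : 0 ≤ 2 * C0 + 2 * B^2 := by positivity
  calc _ ≤ ∫ y in Set.Ioc 0 (Y + 8), fz y ^ 2 :=
        setIntegral_mono_set hm (ae_of_all _ fun _ => sq_nonneg _)
          (Set.Ioc_subset_Ioc_right (by linarith)).eventuallyLE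
    _ ≤ _ := main _ (by linarith)
    _ ≤ _ := by nlinarith [mul_nonneg hA hY, mul_nonneg hA2 hY]

lemma fz_mean : ∃ C1 > 0, ∀ N : ℕ, 1 ≤ N → ∀ ε > 0, ∀ᶠ Y : ℝ in atTop,
    (1 / Y) * ∫ y in Set.Ioc 2 Y, |fz y - QN N y| ≤ C1 * (N:ℝ)^(-(1/8):ℝ) + ε := by
  obtain ⟨C0, hC0, h⟩ := fz_L2
  refine ⟨(C0 + 1) / 2, by positivity, fun N hN ε hε => ?_⟩
  obtain ⟨A, hA, h⟩ := h N hN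
  have hN0 : (0:ℝ) < N := by exact_mod_cast hN
  set l := (N:ℝ)^(-(1/8):ℝ) with hl
  have hl0 : 0 < l := by positivity
  have hl2 : (N:ℝ)^(-(1/4):ℝ) = l^2 := by
    rw [hl, ← Real.rpow_natCast, ← Real.rpow_mul hN0.le]; norm_num
  have hev : ∀ᶠ Y : ℝ in atTop, A / (2 * l) / Y < ε :=
    (tendsto_const_nhds.div_atTop tendsto_id).eventually (gt_mem_nhds hε)
  filter_upwards [hev, eventually_ge_atTop 8] with Y hY1 hY
  obtain ⟨i1, i2⟩ := h Y hY
  rw [hl2] at i2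
  have i3 : IntegrableOn (fun y => 1 / (2*l) * (fz y - QN N y)^2 + l / 2) (Set.Ioc 0 Y) :=
    (i1.const_mul _).add (by simp)
  have hpt : ∀ y, |fz y - QN N y| ≤ 1 / (2*l) * (fz y - QN N y)^2 + l / 2 := by
    intro y
    rw [← sq_abs (fz y - QN N y)]
    set w := |fz y - QN N y|
    have : 1 / (2*l) * w^2 + l / 2 - w = (w - l)^2 / (2*l) := by field_simp; ring
    have : 0 ≤ (w - l)^2 / (2*l) := by positivity
    linarith
  have : ∫ y in Set.Ioc 2 Y, |fz y - QN N y| ≤ A / (2*l) + (C0 + 1)/2 * l * Y := by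
    calc _ ≤ ∫ y in Set.Ioc 2 Y, (1 / (2*l) * (fz y - QN N y)^2 + l / 2) :=
          integral_mono_of_nonneg (ae_of_all _ fun _ => abs_nonneg _)
            (i3.mono_set (Set.Ioc_subset_Ioc_left (by norm_num))) (ae_of_all _ hpt)
      _ ≤ ∫ y in Set.Ioc 0 Y, (1 / (2*l) * (fz y - QN N y)^2 + l / 2) :=
          setIntegral_mono_set i3 (ae_of_all _ fun _ => by positivity)
            (Set.Ioc_subset_Ioc_left (by norm_num)).eventuallyLE
      _ = 1 / (2*l) * (∫ y in Set.Ioc 0 Y, (fz y - QN N y)^2) + l / 2 * Y := by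
          rw [integral_add (i1.const_mul _) (by simp), integral_const_mul]
          simp [max_eq_left (show (0:ℝ) ≤ Y by linarith)]
          ring
      _ ≤ 1 / (2*l) * (A + C0 * l^2 * Y) + l / 2 * Y := by gcongr
      _ = _ := by field_simp; ring
  calc _ ≤ 1 / Y * (A / (2*l) + (C0 + 1)/2 * l * Y) := by gcongr
    _ = (C0 + 1)/2 * l + A / (2 * l) / Y := by field_simp; ring
    _ ≤ _ := by linarith

end Zd
end

end

section
open MeasureTheory Filter Topology

noncomputable section
namespace Zd

lemma log_pos_of_two_le {t : ℝ} (ht : 2 ≤ t) : 0 < Real.log t := Real.log_pos (by linarith)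

lemma int_inv_log {x : ℝ} (hx : 2 ≤ x) (k : ℕ) : IntervalIntegrable (fun t => 1 / Real.log t ^ k) volume 2 x := by
  refine ContinuousOn.intervalIntegrable fun t ht => ContinuousAt.continuousWithinAt ?_
  rw [Set.uIcc_of_le hx] at ht
  have h1 := (log_pos_of_two_le ht.1).ne'
  have h2 : t ≠ 0 := by linarith [ht.1]
  exact continuousAt_const.div ((Real.continuousAt_log h2).pow k) (pow_ne_zero k h1)

lemma Li_eq {x : ℝ} (hx : 2 ≤ x) :
    Li x = x / Real.log x - 2 / Real.log 2 + ∫ t in (2:ℝ)..x, 1 / Real.log t ^ 2 := by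
  have h1 := int_inv_log hx 1
  have h2 := int_inv_log hx 2
  simp only [pow_one] at h1
  have := intervalIntegral.integral_eq_sub_of_hasDerivAt (a := 2) (b := x) (f := fun t => t / Real.log t)
    (f' := fun t => 1 / Real.log t - 1 / Real.log t ^ 2) (fun t ht => ?_) (h1.sub h2)
  · rw [intervalIntegral.integral_sub h1 h2] at this
    unfold Li
    linarith
  · rw [Set.uIcc_of_le hx] at ht
    have h1 := (log_pos_of_two_le ht.1).ne'
    have h2 : t ≠ 0 := by linarith [ht.1]
    convert! (hasDerivAt_id t).div (Real.hasDerivAt_log h2) h1 using 1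
    simp; field_simp

/-- the integral remainder -/
def Jz (y : ℝ) : ℝ := ∫ t in (2:ℝ)..(Real.exp y), (Chebyshev.theta t - t) / (t * Real.log t ^ 2)

lemma two_le_exp {y : ℝ} (hy : 1 ≤ y) : 2 ≤ Real.exp y := by
  have := Real.add_one_le_exp y; linarith

lemma Ez_eq {y : ℝ} (hy : 1 ≤ y) : Ezeta (Real.exp y) =
    Real.exp (-betaZeta * y) * (Chebyshev.theta (Real.exp y) - Real.exp y) +
    y * Real.exp (-betaZeta * y) * (Jz y + 2 / Real.log 2) := by
  have h2 := two_le_exp hy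
  have hp : (primeCount (Real.exp y) : ℝ) = Nat.primeCounting ⌊Real.exp y⌋₊ := by
    unfold primeCount Nat.primeCounting Nat.primeCounting'
    rw [Nat.count_eq_card_filter_range]
  have hJ : Jz y = (∫ t in (2:ℝ)..(Real.exp y), Chebyshev.theta t / (t * Real.log t ^ 2)) -
      ∫ t in (2:ℝ)..(Real.exp y), 1 / Real.log t ^ 2 := by
    rw [← intervalIntegral.integral_sub _ (int_inv_log h2 2)]
    · unfold Jz
      refine intervalIntegral.integral_congr fun t ht => ?_
      rw [Set.uIcc_of_le h2] at ht
      have h1 := (log_pos_of_two_le ht.1).ne'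
      have h2 : t ≠ 0 := by linarith [ht.1]
      field_simp
    · rw [intervalIntegrable_iff_integrableOn_Icc_of_le h2]
      exact Chebyshev.integrableOn_theta_div_id_mul_log_sq _
  unfold Ezeta
  rw [hp, Chebyshev.primeCounting_eq_theta_div_log_add_integral h2, Li_eq h2, hJ, Real.log_exp,
    ← Real.exp_mul, neg_mul, Real.exp_neg, mul_comm betaZeta]
  have : y ≠ 0 := by linarith
  field_simp
  ring

lemma theta_dev : ∃ M > 0, ∀ u : ℝ, 0 ≤ u →
    Chebyshev.psi (Real.exp u) - Chebyshev.theta (Real.exp u) ≤ M * Real.exp (u / 2) ∧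
    |Chebyshev.theta (Real.exp u) - Real.exp u| ≤ Real.exp (betaZeta * u) * (|fz u| + M) := by
  obtain ⟨C, hC⟩ := Chebyshev.psi_sub_theta_le_mul_sqrt
  refine ⟨|C| + 1, by positivity, fun u hu => ?_⟩
  have hb := beta_ge
  have h1 : Chebyshev.psi (Real.exp u) - Chebyshev.theta (Real.exp u) ≤ (|C| + 1) * Real.exp (u / 2) := by
    refine (hC _).trans ?_
    rw [Real.exp_half]
    gcongr
    linarith [le_abs_self C]
  refine ⟨h1, ?_⟩
  have h2 := Chebyshev.theta_le_psi (Real.exp u)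
  have h3 : |hz u| = Real.exp (betaZeta * u) * |fz u| := by
    unfold fz
    rw [abs_mul, Real.abs_exp, ← mul_assoc, ← Real.exp_add]; simp
  have h4 : Real.exp (u / 2) ≤ Real.exp (betaZeta * u) := Real.exp_le_exp.2 (by nlinarith)
  have h5 : |Chebyshev.theta (Real.exp u) - Real.exp u| ≤ |hz u| + (|C| + 1) * Real.exp (u / 2) := by
    have e : Chebyshev.theta (Real.exp u) - Real.exp u =
      hz u - (Chebyshev.psi (Real.exp u) - Chebyshev.theta (Real.exp u)) := by unfold hz; ring
    rw [e]
    refine (abs_sub _ _).trans ?_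
    gcongr
    rw [abs_of_nonneg (by linarith)]; exact h1
  rw [h3] at h5
  have : (|C| + 1) * Real.exp (u / 2) ≤ (|C| + 1) * Real.exp (betaZeta * u) := by gcongr
  linarith

lemma weight {y u : ℝ} (hu : Real.log 2 < u) (huy : u ≤ y) :
    y * Real.exp (-betaZeta * y) * (Real.exp (betaZeta * u) / u^2) ≤ 256 / y * Real.exp (-(y - u)/4) := by
  have hl := Real.log_two_gt_d9
  have hb := beta_ge
  have hu0 : 0 < u := by linarith
  have hy0 : 0 < y := by linarith
  set v := y - u with hv
  have hv0 : 0 ≤ v := by linarith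
  have h1 : 1 + 2 * v ≤ 16 * Real.exp (v / 8) := by
    have := Real.add_one_le_exp (v/8); linarith
  have h2 : y ≤ u * (16 * Real.exp (v / 8)) := by nlinarith
  have h3 : y^2 ≤ u^2 * (256 * Real.exp (v/4)) := by
    calc y^2 ≤ (u * (16 * Real.exp (v / 8)))^2 := pow_le_pow_left₀ hy0.le h2 2
      _ = u^2 * (256 * (Real.exp (v/8))^2) := by ring
      _ = _ := by rw [← Real.exp_nat_mul]; congr 3; push_cast; ring
  have h4 : Real.exp (-betaZeta * y) * Real.exp (betaZeta * u) ≤ Real.exp (-v/2) := by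
    rw [← Real.exp_add]; exact Real.exp_le_exp.2 (by nlinarith)
  have h5 : Real.exp (v/4) * Real.exp (-v/2) = Real.exp (-v/4) := by rw [← Real.exp_add]; ring_nf
  rw [div_mul_eq_mul_div, le_div_iff₀ hy0]
  calc _ = y^2 * (Real.exp (-betaZeta * y) * Real.exp (betaZeta * u)) / u^2 := by ring
    _ ≤ (u^2 * (256 * Real.exp (v/4))) * Real.exp (-v/2) / u^2 := by gcongr
    _ = 256 * (Real.exp (v/4) * Real.exp (-v/2)) := by field_simp
    _ = _ := by rw [h5]

lemma Jz_eq {y : ℝ} (hy : 1 ≤ y) : Jz y = ∫ u in Set.Ioc (Real.log 2) y,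
    (Chebyshev.theta (Real.exp u) - Real.exp u) / u^2 := by
  have h2 := two_le_exp hy
  have him : Real.exp '' Set.Ioc (Real.log 2) y = Set.Ioc 2 (Real.exp y) := by
    ext t
    constructor
    · rintro ⟨u, hu, rfl⟩
      exact ⟨(Real.log_lt_iff_lt_exp (by norm_num)).1 hu.1, Real.exp_le_exp.2 hu.2⟩
    · intro ht
      have ht0 : 0 < t := by linarith [ht.1]
      exact ⟨Real.log t, ⟨Real.log_lt_log (by norm_num) ht.1, (Real.log_le_iff_le_exp ht0).2 ht.2⟩, Real.exp_log ht0⟩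
  unfold Jz
  rw [intervalIntegral.integral_of_le h2, ← him,
    integral_image_eq_integral_abs_deriv_smul measurableSet_Ioc
      (fun x _ => (Real.hasDerivAt_exp x).hasDerivWithinAt) Real.exp_injective.injOn]
  refine setIntegral_congr_fun measurableSet_Ioc fun u hu => ?_
  have hl := Real.log_two_gt_d9
  have hu0 : u ≠ 0 := by linarith [hu.1]
  simp only [Real.abs_exp, smul_eq_mul, Real.log_exp]
  have := (Real.exp_pos u).ne'
  field_simp

lemma exp_quarter_int (y : ℝ) (hy : 0 ≤ y) : ∫ u in Set.Ioc 0 y, Real.exp (-(y - u)/4) ≤ 4 := by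
  rw [← intervalIntegral.integral_of_le hy]
  rw [intervalIntegral.integral_eq_sub_of_hasDerivAt (f := fun u => 4 * Real.exp (-(y - u)/4))
    (fun u _ => ?_) (Continuous.intervalIntegrable (by fun_prop) _ _)]
  · simp; positivity
  · have h : HasDerivAt (fun u : ℝ => -(y - u)/4) (1/4) u := by
      have := (((hasDerivAt_id u).const_sub y).neg).div_const 4
      simpa using this
    convert! h.exp.const_mul 4 using 1
    ring

lemma Jz_bound : ∃ C > 0, ∀ y : ℝ, 1 ≤ y → |y * Real.exp (-betaZeta * y) * Jz y| ≤ C / Real.sqrt y := by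
  obtain ⟨M, hM, h⟩ := theta_dev
  obtain ⟨C, hC, hf⟩ := fz_sq
  refine ⟨256 * (4 + 2 * C + M^2), by positivity, fun y hy => ?_⟩
  have hl := Real.log_two_gt_d9
  have hy0 : 0 < y := by linarith
  set l := Real.sqrt y with hlam
  have hl0 : 0 < l := Real.sqrt_pos.2 hy0
  have hll : l * l = y := Real.mul_self_sqrt hy0.le
  have hfi : IntegrableOn (fun u => fz u ^ 2) (Set.Ioc 0 y) :=
    bdd_int (fz_meas.pow_const 2) (M := ((Real.log 4 + 4) * Real.exp (y / 2))^2) fun y hy => by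
      rw [abs_pow]; exact pow_le_pow_left₀ (abs_nonneg _) (fz_bdd le_rfl y hy) 2
  have hei : IntegrableOn (fun u => Real.exp (-(y - u)/4)) (Set.Ioc 0 y) :=
    (Continuous.integrableOn_Icc (by fun_prop)).mono_set Set.Ioc_subset_Icc_self
  have hgi : IntegrableOn (fun u => 256 / y * (l * Real.exp (-(y - u)/4) + 1 / l * (fz u ^ 2 + M^2))) (Set.Ioc 0 y) :=
    ((hei.const_mul l).add ((hfi.add (integrable_const _)).const_mul _)).const_mul _
  have hpt : ∀ u ∈ Set.Ioc (Real.log 2) y, ‖y * Real.exp (-betaZeta * y) *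
      ((Chebyshev.theta (Real.exp u) - Real.exp u) / u^2)‖ ≤
      256 / y * (l * Real.exp (-(y - u)/4) + 1 / l * (fz u ^ 2 + M^2)) := by
    intro u hu
    have h1 := (h u (by linarith [hu.1])).2
    have h2 := weight hu.1 hu.2
    rw [Real.norm_eq_abs, abs_mul, abs_of_pos (by positivity : 0 < y * Real.exp (-betaZeta * y)), abs_div,
      abs_of_nonneg (sq_nonneg u)]
    have hu0 : 0 < u := by linarith [hu.1]
    set e := Real.exp (-(y - u)/4) with he
    have he0 : 0 < e := Real.exp_pos _
    have he1 : e ≤ 1 := Real.exp_le_one_iff.2 (by linarith [hu.2])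
    set w := |fz u| + M with hw
    have hw2 : w^2 ≤ 2 * (fz u ^2 + M^2) := by
      rw [← sq_abs (fz u)]; nlinarith [sq_nonneg (|fz u| - M)]
    calc y * Real.exp (-betaZeta * y) * (|Chebyshev.theta (Real.exp u) - Real.exp u| / u^2)
        ≤ y * Real.exp (-betaZeta * y) * ((Real.exp (betaZeta * u) * w) / u^2) := by gcongr
      _ = y * Real.exp (-betaZeta * y) * (Real.exp (betaZeta * u) / u^2) * w := by ring
      _ ≤ 256 / y * e * w := by gcongr
      _ = 256 / y * (e * w) := by ring
      _ ≤ _ := by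
        gcongr
        have k1 : e * w ≤ l * e^2 / 2 + w^2 / (2 * l) := by
          have : l * e^2 / 2 + w^2 / (2 * l) - e * w = (l * e - w)^2 / (2*l) := by field_simp; ring
          have : 0 ≤ (l * e - w)^2 / (2*l) := by positivity
          linarith
        have k2 : l * e^2 / 2 ≤ l * e := by nlinarith [mul_pos hl0 he0]
        have k3 : w^2 / (2 * l) ≤ 1 / l * (fz u ^2 + M^2) := by
          rw [div_le_iff₀ (by positivity)]
          calc _ ≤ _ := hw2
            _ = _ := by field_simp
        linarith
  rw [Jz_eq hy, ← integral_const_mul, ← Real.norm_eq_abs]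
  have hsub : Set.Ioc (Real.log 2) y ⊆ Set.Ioc 0 y := Set.Ioc_subset_Ioc_left (by linarith)
  refine (norm_integral_le_integral_norm _).trans ?_
  calc _ ≤ ∫ u in Set.Ioc (Real.log 2) y, 256 / y * (l * Real.exp (-(y - u)/4) + 1 / l * (fz u ^ 2 + M^2)) :=
        integral_mono_of_nonneg (ae_of_all _ fun _ => norm_nonneg _) (hgi.mono_set hsub)
          ((ae_restrict_iff' measurableSet_Ioc).2 (ae_of_all _ hpt))
    _ ≤ ∫ u in Set.Ioc 0 y, 256 / y * (l * Real.exp (-(y - u)/4) + 1 / l * (fz u ^ 2 + M^2)) :=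
        setIntegral_mono_set hgi (ae_of_all _ fun _ => by positivity) hsub.eventuallyLE
    _ = 256 / y * (l * (∫ u in Set.Ioc 0 y, Real.exp (-(y - u)/4)) + 1 / l * ((∫ u in Set.Ioc 0 y, fz u ^ 2) + M^2 * y)) := by
        have hh : IntegrableOn (fun u => 1 / l * (fz u ^ 2 + M^2)) (Set.Ioc 0 y) :=
          (hfi.add (integrable_const _)).const_mul _
        rw [integral_const_mul, integral_add (hei.const_mul l) hh,
          integral_const_mul, integral_const_mul, integral_add hfi (integrable_const _)]
        simp [max_eq_left hy0.le, mul_comm]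
    _ ≤ 256 / y * (l * 4 + 1 / l * (C * (y + y) + M^2 * y)) := by
        gcongr
        · exact exp_quarter_int y hy0.le
        · exact (hf y hy0.le).trans (by gcongr)
    _ = _ := by
        rw [← hll]; field_simp; ring

end Zd
end

end

section
open MeasureTheory Filter Topology

noncomputable section
namespace Zd

/-- the mean shift -/
def cz : ℝ := if betaZeta = 1/2 then 1 else 0

lemma exp_le_inv_sqrt {d y : ℝ} (hd : 0 < d) (hy : 1 ≤ y) : Real.exp (-d * y) ≤ 1 / d / Real.sqrt y := by
  have h1 : Real.sqrt y ≤ y := Real.sqrt_le_iff.2 ⟨by linarith, by nlinarith⟩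
  have h2 := Real.add_one_le_exp (d * y)
  have h3 : 0 < Real.sqrt y := Real.sqrt_pos.2 (by linarith)
  rw [div_div, neg_mul, Real.exp_neg, ← one_div]
  refine one_div_le_one_div_of_le (by positivity) ?_
  nlinarith

lemma pp_rem : ∃ C > 0, ∀ y : ℝ, 1 ≤ y → |Real.exp (-betaZeta * y) *
    (Chebyshev.psi (Real.exp y) - Chebyshev.theta (Real.exp y)) - cz| ≤
      C / Real.sqrt y + Real.exp (-y/4) * |fz (y/2)| := by
  have h4 : 0 ≤ Real.log 4 := Real.log_nonneg (by norm_num)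
  by_cases hb : betaZeta = 1/2
  · refine ⟨2 * (Real.log 4 + 4) * (1 / (1/6)), by positivity, fun y hy => ?_⟩
    have hcz : cz = 1 := by simp [cz, hb]
    rw [hcz]
    have u1 := Chebyshev.psi_sub_theta_le_psi_add_psi_add_psi (Real.exp y)
    have u2 := Chebyshev.psi_sub_theta_ge_psi_add_psi_add_psi (Real.exp_pos y).le
    rw [← Real.exp_mul, ← Real.exp_mul, ← Real.exp_mul] at u1 u2
    rw [show y * 2⁻¹ = y / 2 by ring] at u1 u2
    have n3 := Chebyshev.psi_nonneg (Real.exp (y * 3⁻¹))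
    have n7 := Chebyshev.psi_nonneg (Real.exp (y * 7⁻¹))
    have p3 := Chebyshev.psi_le_const_mul_self (Real.exp_pos (y * 3⁻¹)).le
    have p5 := Chebyshev.psi_le_const_mul_self (Real.exp_pos (y * 5⁻¹)).le
    have e5 : Real.exp (y * 5⁻¹) ≤ Real.exp (y * 3⁻¹) := Real.exp_le_exp.2 (by linarith)
    have p5' : Chebyshev.psi (Real.exp (y * 5⁻¹)) ≤ (Real.log 4 + 4) * Real.exp (y * 3⁻¹) := p5.trans (by gcongr)
    set D := Chebyshev.psi (Real.exp y) - Chebyshev.theta (Real.exp y)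
    have hD : |D - Real.exp (y/2)| ≤ |hz (y/2)| + 2 * (Real.log 4 + 4) * Real.exp (y * 3⁻¹) := by
      have e : D - Real.exp (y/2) = hz (y/2) + (D - Chebyshev.psi (Real.exp (y/2))) := by unfold hz; ring
      rw [e]
      refine (abs_add_le _ _).trans ?_
      gcongr
      rw [abs_of_nonneg (by linarith)]
      linarith
    have hf : Real.exp (-y/4) * |fz (y/2)| = Real.exp (-y/2) * |hz (y/2)| := by
      unfold fz
      rw [abs_mul, Real.abs_exp, ← mul_assoc, ← Real.exp_add, hb]
      ring_nf
    have he : Real.exp (-y/2) * Real.exp (y/2) = 1 := by rw [← Real.exp_add]; ring_nf; simp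
    rw [hf]
    have : Real.exp (-betaZeta * y) * D - 1 = Real.exp (-y/2) * (D - Real.exp (y/2)) := by
      have ee : Real.exp (-betaZeta * y) = Real.exp (-y/2) := by rw [hb]; ring_nf
      rw [ee]
      linear_combination he
    rw [this, abs_mul, Real.abs_exp]
    have hq := exp_le_inv_sqrt (show (0:ℝ) < 1/6 by norm_num) hy
    have e6 : Real.exp (-y/2) * Real.exp (y * 3⁻¹) = Real.exp (-(1/6) * y) := by rw [← Real.exp_add]; ring_nf
    calc _ ≤ Real.exp (-y/2) * (|hz (y/2)| + 2 * (Real.log 4 + 4) * Real.exp (y * 3⁻¹)) := by gcongr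
      _ = 2 * (Real.log 4 + 4) * (Real.exp (-y/2) * Real.exp (y * 3⁻¹)) + Real.exp (-y/2) * |hz (y/2)| := by ring
      _ ≤ 2 * (Real.log 4 + 4) * (1 / (1/6) / Real.sqrt y) + Real.exp (-y/2) * |hz (y/2)| := by
        rw [e6]; gcongr
      _ = _ := by ring
  · obtain ⟨M, hM, h⟩ := theta_dev
    have hd : 0 < betaZeta - 1/2 := sub_pos.2 (lt_of_le_of_ne beta_ge (Ne.symm hb))
    refine ⟨M * (1 / (betaZeta - 1/2)), by positivity, fun y hy => ?_⟩
    have hcz : cz = 0 := by simp [cz]; intro h; exact hb (by rw [h]; norm_num)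
    have h1 := (h y (by linarith)).1
    have h2 := Chebyshev.theta_le_psi (Real.exp y)
    have hq := exp_le_inv_sqrt hd hy
    rw [hcz, sub_zero, abs_mul, Real.abs_exp, abs_of_nonneg (by linarith)]
    have h0 : 0 ≤ Real.exp (-y/4) * |fz (y/2)| := by positivity
    calc _ ≤ Real.exp (-betaZeta * y) * (M * Real.exp (y/2)) := by gcongr
      _ = M * Real.exp (-(betaZeta - 1/2) * y) := by
        rw [mul_left_comm, ← Real.exp_add]; ring_nf
      _ ≤ M * (1 / (betaZeta - 1/2) / Real.sqrt y) := by gcongr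
      _ = M * (1 / (betaZeta - 1/2)) / Real.sqrt y := by ring
      _ ≤ _ := by linarith

lemma Ez_rem : ∃ C > 0, ∀ y : ℝ, 1 ≤ y → |Ezeta (Real.exp y) - (fz y - cz)| ≤
      C / Real.sqrt y + Real.exp (-y/4) * |fz (y/2)| := by
  obtain ⟨C1, hC1, h1⟩ := pp_rem
  obtain ⟨C2, hC2, h2⟩ := Jz_bound
  refine ⟨C1 + C2 + 4 * (1/(1/4)) * (2 / Real.log 2), by have := Real.log_pos (one_lt_two : (1:ℝ) < 2); positivity, fun y hy => ?_⟩
  have hl := Real.log_pos (one_lt_two : (1:ℝ) < 2)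
  have hb := beta_ge
  have h3 : |y * Real.exp (-betaZeta * y) * (2 / Real.log 2)| ≤ 4 * (1/(1/4)/Real.sqrt y) * (2 / Real.log 2) := by
    rw [abs_of_nonneg (by positivity)]
    refine mul_le_mul_of_nonneg_right ?_ (by positivity)
    have hq := exp_le_inv_sqrt (show (0:ℝ) < 1/4 by norm_num) hy
    have e1 := Real.add_one_le_exp (y/4)
    calc y * Real.exp (-betaZeta * y) ≤ (4 * Real.exp (y/4)) * Real.exp (-y/2) := by
          refine mul_le_mul (by linarith) (Real.exp_le_exp.2 (by nlinarith)) (by positivity) (by positivity)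
      _ = 4 * Real.exp (-(1/4) * y) := by rw [mul_assoc, ← Real.exp_add]; ring_nf
      _ ≤ _ := mul_le_mul_of_nonneg_left hq (by norm_num)
  have e : Ezeta (Real.exp y) - (fz y - cz) = -(Real.exp (-betaZeta * y) *
    (Chebyshev.psi (Real.exp y) - Chebyshev.theta (Real.exp y)) - cz) +
    y * Real.exp (-betaZeta * y) * Jz y + y * Real.exp (-betaZeta * y) * (2 / Real.log 2) := by
    rw [Ez_eq hy]; unfold fz hz; ring
  rw [e]
  refine (abs_add_three _ _ _).trans ?_
  rw [abs_neg]
  have : (C1 + C2 + 4 * (1/(1/4)) * (2 / Real.log 2)) / Real.sqrt y =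
    C1 / Real.sqrt y + C2 / Real.sqrt y + 4 * (1/(1/4)/Real.sqrt y) * (2 / Real.log 2) := by ring
  rw [this]
  linarith [h1 y hy, h2 y hy]

/-- majorant of the remainder -/
def rz (C y : ℝ) : ℝ := C / Real.sqrt y + Real.exp (-y/4) * |fz (y/2)|

lemma rz_meas (C : ℝ) : Measurable (rz C) := by
  unfold rz
  exact (by fun_prop : Measurable fun y : ℝ => C / Real.sqrt y).add
    ((by fun_prop : Measurable fun y : ℝ => Real.exp (-y/4)).mul
      ((fz_meas.comp (measurable_id.div_const 2)).norm))

lemma rz_bdd {C : ℝ} (hC : 0 < C) {a b : ℝ} (ha : 1 ≤ a) : ∀ y ∈ Set.Ioc a b,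
    |rz C y| ≤ C + (Real.log 4 + 4) * Real.exp (b / 2) := by
  intro y hy
  have h4 : 0 ≤ Real.log 4 := Real.log_nonneg (by norm_num)
  have h1 : 1 ≤ y := by linarith [hy.1]
  have hs : 1 ≤ Real.sqrt y := Real.one_le_sqrt.2 h1
  rw [abs_of_nonneg (by unfold rz; positivity)]
  unfold rz
  refine add_le_add (div_le_self hC.le hs) ?_
  · calc _ ≤ 1 * |fz (y/2)| :=
          mul_le_mul_of_nonneg_right (Real.exp_le_one_iff.2 (by linarith)) (abs_nonneg _)
      _ ≤ _ := by
        rw [one_mul]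
        refine (fz_bound (by linarith)).trans ?_
        refine mul_le_mul_of_nonneg_left (Real.exp_le_exp.2 ?_) (by positivity)
        linarith [hy.2]

lemma rz_mean {C : ℝ} (hC : 0 < C) : Tendsto (fun Y : ℝ => (1/Y) * ∫ y in Set.Ioc 2 Y, rz C y) atTop (𝓝 0) := by
  obtain ⟨C3, hC3, hf⟩ := fz_sq
  have lim : Tendsto (fun Y : ℝ => (2 * C + 2 + 2 * C3) / Real.sqrt Y) atTop (𝓝 0) :=
    tendsto_const_nhds.div_atTop Real.tendsto_sqrt_atTop
  refine tendsto_of_tendsto_of_tendsto_of_le_of_le' tendsto_const_nhds lim ?_ ?_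
  · filter_upwards [eventually_ge_atTop 2] with Y hY
    refine mul_nonneg (by positivity) (integral_nonneg fun y => ?_)
    unfold rz; positivity
  · filter_upwards [eventually_ge_atTop 2] with Y hY
    have hY0 : 0 < Y := by linarith
    set l := Real.sqrt Y with hlam
    have hl0 : 0 < l := Real.sqrt_pos.2 hY0
    have hll : l * l = Y := Real.mul_self_sqrt hY0.le
    have i1 : IntervalIntegrable (fun y : ℝ => C / Real.sqrt y) volume 0 Y := by
      have : IntervalIntegrable (fun y : ℝ => C * y ^ (-(1/2):ℝ)) volume 0 Y :=
        (intervalIntegral.intervalIntegrable_rpow' (by norm_num)).const_mul C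
      refine this.congr ?_
      rw [Set.uIoc_of_le hY0.le]
      intro y hy
      change C * y ^ (-(1/2):ℝ) = C / Real.sqrt y
      rw [Real.rpow_neg hy.1.le, Real.sqrt_eq_rpow]
      ring
    have v1 : ∫ y in (0:ℝ)..Y, C / Real.sqrt y = 2 * C * l := by
      have : ∫ y in (0:ℝ)..Y, C / Real.sqrt y = ∫ y in (0:ℝ)..Y, C * y ^ (-(1/2):ℝ) := by
        refine intervalIntegral.integral_congr fun y hy => ?_
        rw [Set.uIcc_of_le hY0.le] at hy
        change C / Real.sqrt y = C * y ^ (-(1/2):ℝ)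
        rw [Real.rpow_neg hy.1, Real.sqrt_eq_rpow]
        ring
      rw [this, intervalIntegral.integral_const_mul, integral_rpow (Or.inl (by norm_num)), hlam, Real.sqrt_eq_rpow]
      norm_num
      ring
    have i2 : IntegrableOn (fun u => fz u ^ 2) (Set.Ioc 0 (Y/2)) :=
      bdd_int (fz_meas.pow_const 2) (M := ((Real.log 4 + 4) * Real.exp (Y/2 / 2))^2) fun y hy => by
        rw [abs_pow]; exact pow_le_pow_left₀ (abs_nonneg _) (fz_bdd le_rfl y hy) 2
    have i2' : IntervalIntegrable (fun u => fz u ^ 2) volume (0/2) (Y/2) := by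
      rw [zero_div, intervalIntegrable_iff_integrableOn_Ioc_of_le (by linarith)]; exact i2
    have i3 : IntervalIntegrable (fun y => fz (y/2) ^ 2) volume 0 Y := by
      have := IntervalIntegrable.comp_mul_right (c := (1/2:ℝ)) i2' 
      simpa [div_eq_mul_inv] using this
    have v3 : ∫ y in (0:ℝ)..Y, fz (y/2) ^ 2 ≤ 2 * (C3 * (Y/2 + 1)) := by
      rw [intervalIntegral.integral_comp_div (fun u => fz u ^ 2) (by norm_num : (2:ℝ) ≠ 0), zero_div,
        intervalIntegral.integral_of_le (by linarith), smul_eq_mul]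
      have := hf (Y/2) (by linarith)
      gcongr
    have i4 : IntervalIntegrable (fun y : ℝ => Real.exp (-y/2)) volume 0 Y :=
      Continuous.intervalIntegrable (by fun_prop) _ _
    have v4 : ∫ y in (0:ℝ)..Y, Real.exp (-y/2) ≤ 2 := by
      rw [intervalIntegral.integral_eq_sub_of_hasDerivAt (f := fun u => -2 * Real.exp (-u/2)) (fun u _ => ?_) i4]
      · simp; positivity
      · have h : HasDerivAt (fun u : ℝ => -u/2) (-1/2) u := ((hasDerivAt_id u).neg).div_const 2
        convert! h.exp.const_mul (-2) using 1
        ring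
    have i5 : IntervalIntegrable (fun y => C / Real.sqrt y + (l * Real.exp (-y/2) + 1 / (2 * l) * fz (y/2) ^ 2)) volume 0 Y :=
      i1.add ((i4.const_mul l).add (i3.const_mul _))
    have hpt : ∀ y, rz C y ≤ C / Real.sqrt y + (l * Real.exp (-y/2) + 1 / (2 * l) * fz (y/2) ^ 2) := by
      intro y
      unfold rz
      gcongr
      rw [← sq_abs (fz (y/2))]
      have e : Real.exp (-y/2) = Real.exp (-y/4)^2 := by rw [← Real.exp_nat_mul]; congr 1; push_cast; ring
      rw [e]
      set a := Real.exp (-y/4)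
      set w := |fz (y/2)|
      have : l * a^2 / 2 + 1 / (2 * l) * w^2 - a * w = (l * a - w)^2 / (2*l) := by field_simp; ring
      have : 0 ≤ (l * a - w)^2 / (2*l) := by positivity
      have : 0 ≤ l * a^2 := by positivity
      linarith
    have i5' := (intervalIntegrable_iff_integrableOn_Ioc_of_le hY0.le).1 i5
    have hb : ∫ y in Set.Ioc 2 Y, rz C y ≤ 2 * C * l + (l * 2 + 1 / (2 * l) * (2 * (C3 * (Y/2+1)))) := by
      calc _ ≤ ∫ y in Set.Ioc 2 Y, (C / Real.sqrt y + (l * Real.exp (-y/2) + 1 / (2 * l) * fz (y/2) ^ 2)) :=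
            integral_mono_of_nonneg (ae_of_all _ fun y => by change 0 ≤ rz C y; unfold rz; positivity)
              (i5'.mono_set (Set.Ioc_subset_Ioc_left (by norm_num))) (ae_of_all _ hpt)
        _ ≤ ∫ y in Set.Ioc 0 Y, (C / Real.sqrt y + (l * Real.exp (-y/2) + 1 / (2 * l) * fz (y/2) ^ 2)) :=
            setIntegral_mono_set i5' (ae_of_all _ fun _ => by positivity)
              (Set.Ioc_subset_Ioc_left (by norm_num)).eventuallyLE
        _ = 2 * C * l + (l * (∫ y in (0:ℝ)..Y, Real.exp (-y/2)) + 1 / (2 * l) * ∫ y in (0:ℝ)..Y, fz (y/2) ^ 2) := by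
            rw [← intervalIntegral.integral_of_le hY0.le, intervalIntegral.integral_add i1 ((i4.const_mul l).add (i3.const_mul _)),
              intervalIntegral.integral_add (i4.const_mul l) (i3.const_mul _), v1,
              intervalIntegral.integral_const_mul, intervalIntegral.integral_const_mul]
        _ ≤ _ := by gcongr
    have hY1 : Y / 2 + 1 ≤ 2 * Y := by linarith
    calc _ ≤ 1 / Y * (2 * C * l + (l * 2 + 1 / (2 * l) * (2 * (C3 * (2 * Y))))) := by
          refine mul_le_mul_of_nonneg_left (hb.trans ?_) (by positivity)
          gcongr
      _ = _ := by rw [← hll]; field_simp; ring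

lemma Ez_meas (Y : ℝ) : AEStronglyMeasurable (fun y => Ezeta (Real.exp y)) (volume.restrict (Set.Ioc 2 Y)) := by
  by_cases hY : 2 ≤ Y
  swap
  · rw [Set.Ioc_eq_empty (by linarith)]; simp
  have h2 := two_le_exp (show 1 ≤ Y by linarith)
  unfold Ezeta
  have hLi : AEStronglyMeasurable (fun y => Li (Real.exp y)) (volume.restrict (Set.Ioc 2 Y)) := by
    have h1 := int_inv_log h2 1
    simp only [pow_one] at h1
    have c1 := intervalIntegral.continuousOn_primitive_interval' h1 Set.left_mem_uIcc
    have c2 : ContinuousOn (fun y => Li (Real.exp y)) (Set.Ioc 2 Y) := by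
      unfold Li
      refine c1.comp Real.continuous_exp.continuousOn fun y hy => ?_
      rw [Set.uIcc_of_le h2]
      exact ⟨two_le_exp (by linarith [hy.1]), Real.exp_le_exp.2 hy.2⟩
    exact c2.aestronglyMeasurable measurableSet_Ioc
  have hp : Measurable (fun y : ℝ => (primeCount (Real.exp y) : ℝ)) := by
    refine Monotone.measurable fun a b hab => ?_
    unfold primeCount
    have : ⌊Real.exp a⌋₊ ≤ ⌊Real.exp b⌋₊ := Nat.floor_le_floor (Real.exp_le_exp.2 hab)
    exact_mod_cast Finset.card_le_card (Finset.filter_subset_filter _ (Finset.range_subset_range.2 (by omega)))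
  refine AEStronglyMeasurable.mul ?_ (hp.aestronglyMeasurable.sub hLi)
  exact Measurable.aestronglyMeasurable (by fun_prop)

end Zd
end

end

section
open MeasureTheory Filter Topology

noncomputable section
namespace Zd

/-- trigonometric polynomials -/
inductive TP : (ℝ → ℂ) → Prop
  | e (l : ℝ) (c : ℂ) : TP (fun y => c * Complex.exp (((l * y : ℝ) : ℂ) * Complex.I))
  | add {f g : ℝ → ℂ} : TP f → TP g → TP (fun y => f y + g y)

lemma TP.mul {f g : ℝ → ℂ} (hf : TP f) (hg : TP g) : TP (fun y => f y * g y) := by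
  induction hf with
  | e l c =>
    induction hg with
    | e l' c' =>
      have := TP.e (l + l') (c * c')
      refine cast ?_ this
      congr 1
      funext y
      have : (((l + l') * y : ℝ) : ℂ) * Complex.I = ((l * y : ℝ) : ℂ) * Complex.I + ((l' * y : ℝ) : ℂ) * Complex.I := by
        push_cast; ring
      rw [this, Complex.exp_add]; ring
    | add h1 h2 i1 i2 =>
      have := TP.add i1 i2
      simpa only [← mul_add] using this
  | add h1 h2 i1 i2 =>
    have := TP.add i1 i2
    simpa only [← add_mul] using this

lemma TP.const (c : ℂ) : TP (fun _ => c) := by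
  have := TP.e 0 c
  simpa using this

lemma TP.conj {f : ℝ → ℂ} (hf : TP f) : TP (fun y => (starRingEnd ℂ) (f y)) := by
  induction hf with
  | e l c =>
    have := TP.e (-l) ((starRingEnd ℂ) c)
    refine cast ?_ this
    congr 1
    funext y
    rw [map_mul, ← Complex.exp_conj, map_mul, Complex.conj_ofReal, Complex.conj_I]
    push_cast
    ring_nf
  | add h1 h2 i1 i2 =>
    have := TP.add i1 i2
    simpa only [map_add] using this

lemma TP.re {f : ℝ → ℂ} (hf : TP f) : TP (fun y => (((f y).re : ℝ) : ℂ)) := by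
  have := (TP.const (1/2)).mul (hf.add hf.conj)
  refine cast ?_ this
  congr 1
  funext y
  rw [Complex.re_eq_add_conj]; ring

lemma TP.sum {ι : Type*} (s : Finset ι) (f : ι → ℝ → ℂ) (h : ∀ i, TP (f i)) : TP (fun y => ∑ i ∈ s, f i y) := by
  classical
  induction s using Finset.induction_on with
  | empty => simpa using TP.const 0
  | insert a s ha ih =>
    simp only [Finset.sum_insert ha]
    exact (h a).add ih

lemma TP.pow {f : ℝ → ℂ} (hf : TP f) (n : ℕ) : TP (fun y => f y ^ n) := by
  induction n with
  | zero => simpa using TP.const 1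
  | succ n ih => simp only [pow_succ]; exact ih.mul hf

lemma TP.poly {P : ℝ → ℝ} (hP : TP (fun y => (P y : ℂ))) (p : Polynomial ℝ) :
    TP (fun y => ((p.eval (P y) : ℝ) : ℂ)) := by
  induction p using Polynomial.induction_on' with
  | add p q hp hq => simpa using hp.add hq
  | monomial n a => simpa using (TP.const a).mul (hP.pow n)

lemma TP.cont {f : ℝ → ℂ} (hf : TP f) : Continuous f := by
  induction hf with
  | e l c => fun_prop
  | add h1 h2 i1 i2 => exact i1.add i2

/-- f has mean m -/
def Mn (f : ℝ → ℂ) (m : ℂ) : Prop :=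
  Tendsto (fun Y : ℝ => ((1 / Y : ℝ) : ℂ) * ∫ y in (2:ℝ)..Y, f y) atTop (𝓝 m)

lemma Mn_e {l : ℝ} (hl : l ≠ 0) (c : ℂ) : Mn (fun y => c * Complex.exp (((l * y : ℝ) : ℂ) * Complex.I)) 0 := by
  unfold Mn
  have hc : (l : ℂ) * Complex.I ≠ 0 := mul_ne_zero (by exact_mod_cast hl) Complex.I_ne_zero
  have h : ∀ Y : ℝ, ∫ y in (2:ℝ)..Y, c * Complex.exp (((l * y : ℝ) : ℂ) * Complex.I) =
      c * ((Complex.exp (((l * Y : ℝ) : ℂ) * Complex.I) - Complex.exp (((l * 2 : ℝ) : ℂ) * Complex.I)) / ((l : ℂ) * Complex.I)) := by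
    intro Y
    rw [intervalIntegral.integral_const_mul]
    congr 1
    have := integral_exp_mul_complex (a := 2) (b := Y) hc
    rw [show (l : ℂ) * Complex.I * (Y : ℂ) = ((l * Y : ℝ) : ℂ) * Complex.I by push_cast; ring,
      show (l : ℂ) * Complex.I * ((2:ℝ) : ℂ) = ((l * 2 : ℝ) : ℂ) * Complex.I by push_cast; ring] at this
    rw [← this]
    refine intervalIntegral.integral_congr fun y _ => ?_
    push_cast; ring_nf
  simp_rw [h]
  refine squeeze_zero_norm' (a := fun Y : ℝ => (1 / Y) * (‖c‖ * (2 / ‖(l : ℂ) * Complex.I‖))) ?_ ?_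
  · filter_upwards [eventually_gt_atTop 0] with Y hY
    rw [norm_mul, norm_mul, norm_div, Complex.norm_real, Real.norm_of_nonneg (by positivity)]
    gcongr
    refine (norm_sub_le _ _).trans ?_
    rw [Complex.norm_exp_ofReal_mul_I, Complex.norm_exp_ofReal_mul_I]; norm_num
  · have := (tendsto_const_nhds (x := (1:ℝ)).div_atTop tendsto_id (l := atTop)).mul_const (‖c‖ * (2 / ‖(l : ℂ) * Complex.I‖))
    simpa using this

lemma Mn_const (c : ℂ) : Mn (fun _ => c) c := by
  unfold Mn
  have h1 : Tendsto (fun Y : ℝ => ((1 - 2 / Y : ℝ) : ℂ) * c) atTop (𝓝 (((1 - 0 : ℝ) : ℂ) * c)) := by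
    refine Tendsto.mul_const _ ((Complex.continuous_ofReal.tendsto _).comp ?_)
    exact tendsto_const_nhds.sub (tendsto_const_nhds.div_atTop tendsto_id)
  simp only [sub_zero, Complex.ofReal_one, one_mul] at h1
  refine h1.congr' ?_
  filter_upwards [eventually_gt_atTop 0] with Y hY
  rw [intervalIntegral.integral_const, Complex.real_smul, ← mul_assoc]
  congr 1
  rw [← Complex.ofReal_mul]
  congr 1
  field_simp

lemma Mn.add {f g : ℝ → ℂ} {a b : ℂ} (hf : Mn f a) (hg : Mn g b) (cf : Continuous f) (cg : Continuous g) :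
    Mn (fun y => f y + g y) (a + b) := by
  unfold Mn at *
  refine (Tendsto.add hf hg).congr fun Y => ?_
  rw [intervalIntegral.integral_add (cf.intervalIntegrable _ _) (cg.intervalIntegrable _ _)]
  ring

lemma Mn_sum {ι : Type*} (s : Finset ι) (f : ι → ℝ → ℂ) (h : ∀ i, TP (f i)) (h0 : ∀ i ∈ s, Mn (f i) 0) :
    Mn (fun y => ∑ i ∈ s, f i y) 0 := by
  classical
  induction s using Finset.induction_on with
  | empty => simpa using Mn_const 0
  | insert a s ha ih =>
    simp only [Finset.sum_insert ha]
    have := (h0 a (Finset.mem_insert_self _ _)).add (ih fun i hi => h0 i (Finset.mem_insert_of_mem hi)) (h a).cont (TP.sum s f h).cont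
    simpa using this

lemma TP.mean {f : ℝ → ℂ} (hf : TP f) : ∃ m, Mn f m := by
  induction hf with
  | e l c =>
    by_cases hl : l = 0
    · refine ⟨c, ?_⟩
      simpa [hl] using Mn_const c
    · exact ⟨0, Mn_e hl c⟩
  | add h1 h2 i1 i2 =>
    obtain ⟨a, ha⟩ := i1
    obtain ⟨b, hb⟩ := i2
    exact ⟨a + b, ha.add hb h1.cont h2.cont⟩

/-- real mean over [2,Y] -/
def MY (f : ℝ → ℝ) (Y : ℝ) : ℝ := (1 / Y) * ∫ y in (2:ℝ)..Y, f y

lemma Mn.re {f : ℝ → ℂ} {m : ℂ} (h : Mn f m) (cf : Continuous f) : Tendsto (MY fun y => (f y).re) atTop (𝓝 m.re) := by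
  have := (Complex.continuous_re.tendsto m).comp h
  refine this.congr fun Y => ?_
  simp only [Function.comp, MY]
  rw [Complex.re_ofReal_mul]
  congr 1
  exact (Complex.reCLM.intervalIntegral_comp_comm (cf.intervalIntegrable 2 Y)).symm

lemma conv_of_approx (u : ℝ → ℝ) (h : ∀ ε > 0, ∃ v : ℝ → ℝ, ∃ m, Tendsto v atTop (𝓝 m) ∧ ∀ᶠ Y in atTop, |u Y - v Y| ≤ ε) :
    ∃ m, Tendsto u atTop (𝓝 m) := by
  rw [← cauchy_map_iff_exists_tendsto, Metric.cauchy_iff]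
  refine ⟨inferInstance, fun ε hε => ?_⟩
  obtain ⟨v, m, hv, huv⟩ := h (ε/5) (by positivity)
  refine ⟨Metric.ball m (ε/2), ?_, fun x hx y hy => ?_⟩
  · rw [mem_map]
    filter_upwards [huv, Metric.tendsto_nhds.1 hv (ε/5) (by positivity)] with Y h1 h2
    rw [Real.dist_eq] at h2
    rw [Set.mem_preimage, Metric.mem_ball, Real.dist_eq]
    have := abs_sub_le (u Y) (v Y) m
    linarith
  · have := dist_triangle_right x y m
    rw [Metric.mem_ball] at hx hy
    linarith

lemma MY_close {f g : ℝ → ℝ} {Y K : ℝ} (hY : 2 ≤ Y) (hf : IntervalIntegrable f volume 2 Y) (hg : IntervalIntegrable g volume 2 Y)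
    {d : ℝ → ℝ} (hd : IntervalIntegrable d volume 2 Y) (h : ∀ y ∈ Set.Ioc 2 Y, |f y - g y| ≤ K * d y) :
    |MY f Y - MY g Y| ≤ K * MY d Y := by
  unfold MY
  rw [← mul_sub, ← intervalIntegral.integral_sub hf hg, abs_mul, abs_of_pos (by positivity), mul_left_comm,
    ← intervalIntegral.integral_const_mul]
  refine mul_le_mul_of_nonneg_left ?_ (by positivity)
  rw [← Real.norm_eq_abs]
  refine intervalIntegral.norm_integral_le_of_norm_le hY (ae_of_all _ fun y hy => ?_) (hd.const_mul K)
  exact h y hy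

lemma MY_one {Y : ℝ} (hY : 2 ≤ Y) : MY (fun _ => 1) Y ≤ 1 := by
  unfold MY
  rw [intervalIntegral.integral_const, smul_eq_mul, mul_one, one_div, inv_mul_le_iff₀ (by linarith)]
  linarith

lemma mean_cont {P : ℝ → ℝ} (hP : TP (fun y => (P y : ℂ))) {B : ℝ} (hB : ∀ y, |P y| ≤ B) {g : ℝ → ℝ} (hg : Continuous g) :
    ∃ m, Tendsto (MY fun y => g (P y)) atTop (𝓝 m) := by
  have cP : Continuous P := by
    have := Complex.continuous_re.comp hP.cont
    simpa [Function.comp_def] using this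
  refine conv_of_approx _ fun ε hε => ?_
  obtain ⟨p, hp⟩ := exists_polynomial_near_of_continuousOn (-B) B g hg.continuousOn ε hε
  have hT := hP.poly p
  obtain ⟨m, hm⟩ := hT.mean
  have h1 := hm.re hT.cont
  simp only [Complex.ofReal_re] at h1
  refine ⟨_, _, h1, ?_⟩
  filter_upwards [eventually_ge_atTop 2] with Y hY
  have hpc : Continuous fun y => p.eval (P y) := p.continuous.comp cP
  refine (MY_close (K := ε) (d := fun _ => 1) hY ((hg.comp cP).intervalIntegrable _ _) (hpc.intervalIntegrable _ _)
    (continuous_const.intervalIntegrable _ _) (fun y hy => ?_)).trans ?_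
  · rw [mul_one, abs_sub_comm]
    exact (hp _ (abs_le.1 (hB y))).le
  · have := MY_one hY
    nlinarith

/-- the approximants -/
def Pz (N : ℕ) (y : ℝ) : ℝ := QN N y - cz

lemma QN_TP (N : ℕ) : TP (fun y => -(∑ ρ ∈ Zn N, (mz ρ : ℂ) / ρ * Complex.exp (((ρ.im * y : ℝ) : ℂ) * Complex.I))) := by
  have h := (TP.const (-1)).mul (TP.sum (Zn N) (fun ρ y => (mz ρ : ℂ) / ρ * Complex.exp (((ρ.im * y : ℝ) : ℂ) * Complex.I))
    fun ρ => TP.e _ _)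
  simpa only [neg_one_mul] using h

lemma Pz_TP (N : ℕ) : TP (fun y => ((Pz N y : ℝ) : ℂ)) := by
  have := (QN_TP N).re.add (TP.const (-cz : ℂ))
  refine cast ?_ this
  congr 1
  funext y
  unfold Pz QN
  push_cast
  ring

lemma Pz_mean (N : ℕ) : Tendsto (MY (Pz N)) atTop (𝓝 (-cz)) := by
  have h1 : Mn (fun y => ∑ ρ ∈ Zn N, -((mz ρ : ℂ) / ρ) * Complex.exp (((ρ.im * y : ℝ) : ℂ) * Complex.I)) 0 := by
    refine Mn_sum (Zn N) (fun ρ y => -((mz ρ : ℂ) / ρ) * Complex.exp (((ρ.im * y : ℝ) : ℂ) * Complex.I)) (fun ρ => TP.e _ _) fun ρ hρ => Mn_e ?_ _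
    intro him
    rw [mem_Zn] at hρ
    have hb := beta_ge
    by_cases h1 : betaZeta < 1
    · refine Fz_real_ne (x := betaZeta) (by linarith) h1 ?_
      rw [show ((betaZeta : ℝ) : ℂ) = ρ from Complex.ext (by simp [hρ.2.1]) (by simp [him])]
      exact hρ.1
    · exact Fz_ne_of_one_le (by rw [hρ.2.1]; linarith) hρ.1
  have h2 := h1.add (Mn_const (-cz : ℂ)) (TP.sum (Zn N) (fun ρ y => -((mz ρ : ℂ) / ρ) * Complex.exp (((ρ.im * y : ℝ) : ℂ) * Complex.I)) (fun ρ => TP.e _ _)).cont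
    continuous_const
  have h3 := h2.re (((TP.sum (Zn N) (fun ρ y => -((mz ρ : ℂ) / ρ) * Complex.exp (((ρ.im * y : ℝ) : ℂ) * Complex.I)) (fun ρ => TP.e _ _)).cont).add continuous_const)
  have e : (0 + (-cz : ℂ)).re = -cz := by simp
  rw [e] at h3
  refine h3.congr fun Y => ?_
  congr 1
  funext y
  unfold Pz QN
  simp only [Complex.add_re, Complex.neg_re, Complex.ofReal_re, neg_mul, Finset.sum_neg_distrib]
  ring

end Zd
end

end

section
open MeasureTheory Filter Topology

noncomputable section
namespace Zd

/-- abstract approximation data -/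
structure Dat (F : ℝ → ℝ) (P D : ℕ → ℝ → ℝ) (B δ : ℕ → ℝ) (c : ℝ) : Prop where
  meas : ∀ Y, AEStronglyMeasurable F (volume.restrict (Set.Ioc 2 Y))
  pc : ∀ N, Continuous (P N)
  pb : ∀ N y, |P N y| ≤ B N
  di : ∀ N Y, 2 ≤ Y → IntervalIntegrable (D N) volume 2 Y
  dl : ∀ N y, 2 ≤ y → |F y - P N y| ≤ D N y
  dm : ∀ N : ℕ, 1 ≤ N → ∀ ε > 0, ∀ᶠ Y in atTop, MY (D N) Y ≤ δ N + ε
  d0 : Tendsto δ atTop (𝓝 0)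
  pm : ∀ N (g : ℝ → ℝ), Continuous g → ∃ m, Tendsto (MY fun y => g (P N y)) atTop (𝓝 m)
  p0 : ∀ N, Tendsto (MY (P N)) atTop (𝓝 (-c))

variable {F : ℝ → ℝ} {P D : ℕ → ℝ → ℝ} {B δ : ℕ → ℝ} {c : ℝ}

lemma Dat.gint (h : Dat F P D B δ c) {g : ℝ → ℝ} (hg : Continuous g) {M : ℝ} (hM : ∀ x, |g x| ≤ M) (Y : ℝ) :
    IntegrableOn (fun y => g (F y)) (Set.Ioc 2 Y) := by
  refine Integrable.mono' (g := fun _ => M) (integrableOn_const (by simp)) (hg.comp_aestronglyMeasurable (h.meas Y)) (ae_of_all _ fun y => hM _)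

lemma Dat.cmp (h : Dat F P D B δ c) {g : ℝ → ℝ} {K : NNReal} (hK : LipschitzWith K g) {M : ℝ} (hM : ∀ x, |g x| ≤ M)
    {N : ℕ} (hN : 1 ≤ N) {ε : ℝ} (hε : 0 < ε) :
    ∀ᶠ Y in atTop, |MY (fun y => g (F y)) Y - MY (fun y => g (P N y)) Y| ≤ K * (δ N + ε) := by
  filter_upwards [h.dm N hN ε hε, eventually_ge_atTop 2] with Y hY h2
  refine (MY_close (K := K) (d := D N) h2 ?_ ((hK.continuous.comp (h.pc N)).intervalIntegrable _ _) (h.di N Y h2) fun y hy => ?_).trans ?_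
  · rw [intervalIntegrable_iff_integrableOn_Ioc_of_le h2]
    exact h.gint hK.continuous hM Y
  · have := hK.dist_le_mul (F y) (P N y)
    rw [Real.dist_eq, Real.dist_eq] at this
    exact this.trans (mul_le_mul_of_nonneg_left (h.dl N y hy.1.le) K.2)
  · exact mul_le_mul_of_nonneg_left hY K.2

lemma Dat.lim (h : Dat F P D B δ c) {g : ℝ → ℝ} {K : NNReal} (hK : LipschitzWith K g) {M : ℝ} (hM : ∀ x, |g x| ≤ M) :
    ∃ L, Tendsto (MY fun y => g (F y)) atTop (𝓝 L) := by
  refine conv_of_approx _ fun ε hε => ?_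
  have hK0 : (0:ℝ) ≤ K := K.2
  have hk : 0 < ε / (2 * (K + 1)) := by positivity
  obtain ⟨N, h1, h2⟩ := ((eventually_ge_atTop 1).and (h.d0.eventually (gt_mem_nhds hk))).exists
  obtain ⟨m, hm⟩ := h.pm N g hK.continuous
  refine ⟨_, m, hm, ?_⟩
  filter_upwards [h.cmp hK hM h1 hk] with Y hY
  refine hY.trans ?_
  calc (K : ℝ) * (δ N + ε / (2 * (K + 1))) ≤ K * (ε / (2 * (K + 1)) + ε / (2 * (K + 1))) := by gcongr
    _ ≤ (K + 1) * (ε / (2 * (K + 1)) + ε / (2 * (K + 1))) := mul_le_mul_of_nonneg_right (by linarith) (by positivity)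
    _ = ε := by field_simp; ring

lemma Dat.limcmp (h : Dat F P D B δ c) {g : ℝ → ℝ} {K : NNReal} (hK : LipschitzWith K g) {M : ℝ} (hM : ∀ x, |g x| ≤ M)
    {L : ℝ} (hL : Tendsto (MY fun y => g (F y)) atTop (𝓝 L)) {N : ℕ} (hN : 1 ≤ N) {m : ℝ}
    (hm : Tendsto (MY fun y => g (P N y)) atTop (𝓝 m)) : |L - m| ≤ K * δ N := by
  have : ∀ ε > 0, |L - m| ≤ K * (δ N + ε) := fun ε hε => le_of_tendsto (hL.sub hm).abs (h.cmp hK hM hN hε)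
  have t : Tendsto (fun ε : ℝ => K * (δ N + ε)) (𝓝[>] 0) (𝓝 (K * (δ N + 0))) := by
    refine Tendsto.mono_left ?_ nhdsWithin_le_nhds
    exact Continuous.tendsto (by fun_prop) 0
  rw [add_zero] at t
  exact ge_of_tendsto t (eventually_mem_nhdsWithin.mono fun ε hε => this ε hε)

/-- tail test function -/
def gA (A t : ℝ) : ℝ := min 1 (max 0 (|t| - A + 1))

lemma gA_lip (A : ℝ) : LipschitzWith 1 (gA A) := by
  refine LipschitzWith.of_le_add fun x y => ?_
  have : |x| ≤ |y| + dist x y := by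
    rw [Real.dist_eq]; have := abs_sub_abs_le_abs_sub x y; linarith
  have := dist_nonneg (x := x) (y := y)
  unfold gA
  grind

lemma gA_nonneg (A t : ℝ) : 0 ≤ gA A t := by unfold gA; positivity
lemma gA_le (A t : ℝ) : gA A t ≤ 1 := min_le_left _ _
lemma gA_abs (A t : ℝ) : |gA A t| ≤ 1 := by rw [abs_of_nonneg (gA_nonneg _ _)]; exact gA_le _ _
lemma gA_zero {A t : ℝ} (h : |t| ≤ A - 1) : gA A t = 0 := by
  unfold gA; rw [max_eq_left (by linarith)]; norm_num
lemma gA_one {A t : ℝ} (h : A ≤ |t|) : gA A t = 1 := by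
  unfold gA; exact min_eq_left (le_max_of_le_right (by linarith))

lemma Dat.gAP (h : Dat F P D B δ c) {A : ℝ} {N : ℕ} (hA : B N ≤ A - 1) : Tendsto (MY fun y => gA A (P N y)) atTop (𝓝 0) := by
  have : (fun y => gA A (P N y)) = fun _ => 0 := funext fun y => gA_zero ((h.pb N y).trans hA)
  rw [this]
  refine tendsto_const_nhds.congr fun Y => ?_
  unfold MY
  rw [intervalIntegral.integral_zero, mul_zero]

lemma Dat.gAL (h : Dat F P D B δ c) {A : ℝ} {N : ℕ} (hN : 1 ≤ N) (hA : B N ≤ A - 1) {L : ℝ} 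
    (hL : Tendsto (MY fun y => gA A (F y)) atTop (𝓝 L)) : L ≤ δ N := by
  have := h.limcmp (gA_lip A) (gA_abs A) hL hN (h.gAP hA)
  simp at this
  exact (le_abs_self L).trans this

lemma tail_le (μ : Measure ℝ) [IsProbabilityMeasure μ] (A : ℝ) {S : Set ℝ} (hS : ∀ x ∈ S, A ≤ |x|) :
    μ S ≤ ENNReal.ofReal (∫ t, gA A t ∂μ) := by
  have hi : Integrable (gA A) μ := Integrable.mono' (integrable_const (1:ℝ)) (gA_lip A).continuous.aestronglyMeasurable
    (ae_of_all _ (gA_abs A))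
  rw [ofReal_integral_eq_lintegral_ofReal hi (ae_of_all _ (gA_nonneg A))]
  have h1 := mul_meas_ge_le_lintegral₀ (μ := μ) (f := fun t => ENNReal.ofReal (gA A t)) (by
    exact (gA_lip A).continuous.measurable.ennreal_ofReal.aemeasurable) 1
  rw [one_mul] at h1
  refine (measure_mono fun x hx => ?_).trans h1
  simp [gA_one (hS x hx)]

/-- empirical measures -/
def nun (F : ℝ → ℝ) (n : ℕ) : Measure ℝ :=
  Measure.map F ((ENNReal.ofReal (n + 1))⁻¹ • volume.restrict (Set.Ioc 2 ((n:ℝ) + 3)))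

lemma base_prob (n : ℕ) : IsProbabilityMeasure ((ENNReal.ofReal (n + 1))⁻¹ • (volume : Measure ℝ).restrict (Set.Ioc 2 ((n:ℝ) + 3))) := by
  constructor
  rw [Measure.smul_apply, Measure.restrict_apply_univ, Real.volume_Ioc, smul_eq_mul,
    show (n:ℝ) + 3 - 2 = n + 1 by ring]
  refine ENNReal.inv_mul_cancel ?_ ENNReal.ofReal_ne_top
  simp; positivity

lemma Dat.aem (h : Dat F P D B δ c) (n : ℕ) : AEMeasurable F ((ENNReal.ofReal (n + 1))⁻¹ • volume.restrict (Set.Ioc 2 ((n:ℝ) + 3))) :=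
  ((h.meas _).aemeasurable).smul_measure _

lemma Dat.nun_prob (h : Dat F P D B δ c) (n : ℕ) : IsProbabilityMeasure (nun F n) :=
  haveI := base_prob n
  Measure.isProbabilityMeasure_map (h.aem n)

lemma Dat.nun_int (h : Dat F P D B δ c) (n : ℕ) {g : ℝ → ℝ} (hg : Continuous g) :
    ∫ t, g t ∂(nun F n) = (((n:ℝ) + 3) / (n + 1)) * MY (fun y => g (F y)) ((n:ℝ) + 3) := by
  unfold nun MY
  rw [integral_map (h.aem n) hg.aestronglyMeasurable, integral_smul_measure, intervalIntegral.integral_of_le (by linarith [n.cast_nonneg (α := ℝ)]),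
    ENNReal.toReal_inv, ENNReal.toReal_ofReal (by positivity), smul_eq_mul]
  field_simp

lemma Dat.nun_lim (h : Dat F P D B δ c) {g : ℝ → ℝ} (hg : Continuous g) {L : ℝ}
    (hL : Tendsto (MY fun y => g (F y)) atTop (𝓝 L)) : Tendsto (fun n => ∫ t, g t ∂(nun F n)) atTop (𝓝 L) := by
  have t3 : Tendsto (fun n : ℕ => (n:ℝ) + 3) atTop atTop := tendsto_natCast_atTop_atTop.atTop_add tendsto_const_nhds
  have t1 : Tendsto (fun n : ℕ => (n:ℝ) + 1) atTop atTop := tendsto_natCast_atTop_atTop.atTop_add tendsto_const_nhds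
  have t : Tendsto (fun n : ℕ => ((n:ℝ) + 3) / (n + 1)) atTop (𝓝 1) := by
    have : Tendsto (fun n : ℕ => 1 + 2 / ((n:ℝ) + 1)) atTop (𝓝 (1 + 0)) :=
      tendsto_const_nhds.add (tendsto_const_nhds.div_atTop t1)
    rw [add_zero] at this
    refine this.congr fun n => ?_
    field_simp; ring
  have := t.mul (hL.comp t3)
  rw [one_mul] at this
  exact this.congr fun n => (h.nun_int n hg).symm

lemma Dat.tight (h : Dat F P D B δ c) : IsTightMeasureSet (Set.range (nun F)) := by
  haveI := h.nun_prob
  refine isTightMeasureSet_range_of_tendsto_limsup_measure_norm_gt ?_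
  rw [ENNReal.tendsto_nhds_zero]
  intro ε hε
  have hd : Tendsto (fun N => ENNReal.ofReal (δ N)) atTop (𝓝 0) := by
    simpa using ENNReal.tendsto_ofReal h.d0
  obtain ⟨N, h1, h2⟩ := ((eventually_ge_atTop 1).and (ENNReal.tendsto_nhds_zero.1 hd ε hε)).exists
  filter_upwards [eventually_ge_atTop (B N + 1)] with r hr
  refine le_trans ?_ h2
  obtain ⟨L, hL⟩ := h.lim (gA_lip r) (gA_abs r)
  have hLd := h.gAL h1 (by linarith) hL
  have t := ENNReal.tendsto_ofReal (h.nun_lim (gA_lip r).continuous hL)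
  calc _ ≤ limsup (fun n => ENNReal.ofReal (∫ t, gA r t ∂(nun F n))) atTop := by
        refine limsup_le_limsup (Eventually.of_forall fun n => ?_)
        haveI := h.nun_prob n
        exact tail_le _ r fun x hx => le_of_lt hx
    _ = ENNReal.ofReal L := t.limsup_eq
    _ ≤ _ := ENNReal.ofReal_le_ofReal hLd

lemma Dat.exists_mu (h : Dat F P D B δ c) : ∃ μ : Measure ℝ, IsProbabilityMeasure μ ∧ ∀ (g : ℝ → ℝ) (K : NNReal) (M : ℝ),
    LipschitzWith K g → (∀ x, |g x| ≤ M) → Tendsto (MY fun y => g (F y)) atTop (𝓝 (∫ t, g t ∂μ)) := by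
  let ν : ℕ → ProbabilityMeasure ℝ := fun n => ⟨nun F n, h.nun_prob n⟩
  have h_compact : IsCompact (closure (Set.range ν)) := by
    refine isCompact_closure_of_isTightMeasureSet ?_
    refine h.tight.subset ?_
    rintro _ ⟨_, ⟨n, rfl⟩, rfl⟩
    exact ⟨n, rfl⟩
  obtain ⟨U, hU⟩ := Ultrafilter.exists_le (atTop : Filter ℕ)
  obtain ⟨μ', -, hμ'⟩ := h_compact.ultrafilter_le_nhds (U.map ν) (by
    refine .trans ?_ (monotone_principal subset_closure)
    rw [le_principal_iff]
    exact Filter.mem_map.2 (Filter.univ_mem' fun n => ⟨n, rfl⟩))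
  have hμ2 : Tendsto ν U (𝓝 μ') := hμ'
  refine ⟨μ', inferInstance, fun g K M hK hM => ?_⟩
  obtain ⟨L, hL⟩ := h.lim hK hM
  have t1 := (h.nun_lim hK.continuous hL).mono_left hU
  rw [ProbabilityMeasure.tendsto_iff_forall_integral_tendsto] at hμ2
  have t2 := hμ2 (BoundedContinuousFunction.ofNormedAddCommGroup g hK.continuous M hM)
  have : L = ∫ t, g t ∂(μ' : Measure ℝ) := tendsto_nhds_unique t1 t2
  rw [← this]; exact hL

/-- clamp -/
def cl (K t : ℝ) : ℝ := max (-K) (min K t)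

lemma cl_lip (K : ℝ) : LipschitzWith 1 (cl K) := by
  refine LipschitzWith.of_le_add fun x y => ?_
  have : x ≤ y + dist x y := by rw [Real.dist_eq]; linarith [le_abs_self (x - y)]
  have := dist_nonneg (x := x) (y := y)
  unfold cl
  grind

lemma cl_abs {K : ℝ} (hK : 0 ≤ K) (t : ℝ) : |cl K t| ≤ K := by
  rw [abs_le]; unfold cl; grind
lemma cl_abs' {K : ℝ} (hK : 0 ≤ K) (t : ℝ) : |cl K t| ≤ |t| := by
  unfold cl; grind
lemma cl_eq {K t : ℝ} (h : |t| ≤ K) : cl K t = t := by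
  rw [abs_le] at h; unfold cl; grind
lemma abs_cl_lip (K : ℝ) : LipschitzWith 1 (fun t => |cl K t|) := by
  refine LipschitzWith.of_le_add fun x y => ?_
  have := (cl_lip K).dist_le_mul x y
  rw [Real.dist_eq (cl K x)] at this
  simp at this
  have := abs_sub_abs_le_abs_sub (cl K x) (cl K y)
  linarith

lemma Dat.mean (h : Dat F P D B δ c) {μ : Measure ℝ} [IsProbabilityMeasure μ] (hμ : ∀ (g : ℝ → ℝ) (K : NNReal) (M : ℝ),
    LipschitzWith K g → (∀ x, |g x| ≤ M) → Tendsto (MY fun y => g (F y)) atTop (𝓝 (∫ t, g t ∂μ))) :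
    ∫ t, t ∂μ = -c := by
  have hB0 : ∀ N, 0 ≤ B N := fun N => (abs_nonneg _).trans (h.pb N 0)
  have hcl : ∀ t : ℝ, Tendsto (fun n : ℕ => cl n t) atTop (𝓝 t) := fun t => by
    refine tendsto_const_nhds.congr' ?_
    filter_upwards [eventually_ge_atTop ⌈|t|⌉₊] with n hn
    exact (cl_eq ((Nat.le_ceil _).trans (by exact_mod_cast hn))).symm
  -- integrability
  have hb : ∀ n : ℕ, ∫ t, |cl n t| ∂μ ≤ B 1 + δ 1 := by
    intro n
    have hM : ∀ x, |(|cl n x|)| ≤ (n:ℝ) := fun x => by rw [abs_abs]; exact cl_abs n.cast_nonneg x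
    obtain ⟨m, hm⟩ := h.pm 1 (fun t => |cl n t|) (abs_cl_lip n).continuous
    have h1 := h.limcmp (abs_cl_lip n) hM (hμ _ _ _ (abs_cl_lip n) hM) le_rfl hm
    have h2 : m ≤ B 1 := by
      refine le_of_tendsto hm ?_
      filter_upwards [eventually_ge_atTop 2] with Y hY
      have := MY_close (f := fun y => |cl n (P 1 y)|) (g := fun _ => 0) (d := fun _ => 1) (K := B 1) hY
        (((abs_cl_lip n).continuous.comp (h.pc 1)).intervalIntegrable _ _) (continuous_const.intervalIntegrable _ _)
        (continuous_const.intervalIntegrable _ _) (fun y _ => by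
          rw [sub_zero, mul_one, abs_abs]; exact (cl_abs' n.cast_nonneg _).trans (h.pb 1 y))
      have h3 := MY_one hY
      have h4 : MY (fun _ => 0) Y = 0 := by simp [MY]
      rw [h4, sub_zero] at this
      have := le_abs_self (MY (fun y => |cl n (P 1 y)|) Y)
      nlinarith [hB0 1]
    have := le_abs_self ((∫ t, |cl n t| ∂μ) - m)
    simp at h1
    linarith
  have hInt : Integrable (fun t : ℝ => t) μ := by
    refine ⟨aestronglyMeasurable_id, ?_⟩
    have f := lintegral_liminf_le (μ := μ) (u := (atTop : Filter ℕ)) (f := fun (n : ℕ) t => ‖cl n t‖ₑ) (fun n => (cl_lip n).continuous.enorm.measurable)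
    have e : ∀ t : ℝ, liminf (fun n : ℕ => ‖cl n t‖ₑ) atTop = ‖t‖ₑ := fun t =>
      ((continuous_enorm.tendsto t).comp (hcl t)).liminf_eq
    simp_rw [e] at f
    refine lt_of_le_of_lt f (lt_of_le_of_lt (b := ENNReal.ofReal (B 1 + δ 1)) ?_ ENNReal.ofReal_lt_top)
    refine liminf_le_of_frequently_le' (Frequently.of_forall fun n => ?_)
    have hi : Integrable (cl n) μ := Integrable.mono' (integrable_const (n:ℝ)) (cl_lip n).continuous.aestronglyMeasurable
      (ae_of_all _ (cl_abs n.cast_nonneg))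
    rw [← ofReal_integral_norm_eq_lintegral_enorm hi]
    exact ENNReal.ofReal_le_ofReal (hb n)
  have hdct : Tendsto (fun n : ℕ => ∫ t, cl n t ∂μ) atTop (𝓝 (∫ t, t ∂μ)) := by
    refine tendsto_integral_filter_of_dominated_convergence (l := (atTop : Filter ℕ)) (F := fun (n : ℕ) (t : ℝ) => cl n t) (fun t : ℝ => |t|) (Eventually.of_forall fun n => (cl_lip n).continuous.aestronglyMeasurable) ?_ hInt.abs ?_
    · exact Eventually.of_forall fun n => ae_of_all _ fun t => cl_abs' n.cast_nonneg t
    · exact ae_of_all _ hcl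
  have hN : ∀ N : ℕ, 1 ≤ N → |∫ t, t ∂μ - (-c)| ≤ δ N := by
    intro N hN
    refine le_of_tendsto (hdct.sub_const (-c)).abs ?_
    filter_upwards [eventually_ge_atTop ⌈B N⌉₊] with n hn
    have e : (fun y => cl n (P N y)) = P N := funext fun y =>
      cl_eq ((h.pb N y).trans ((Nat.le_ceil _).trans (by exact_mod_cast hn)))
    have := h.limcmp (cl_lip n) (cl_abs n.cast_nonneg) (hμ _ _ _ (cl_lip n) (cl_abs n.cast_nonneg)) hN (m := -c) (by rw [e]; exact h.p0 N)
    simpa using this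
  have : |∫ t, t ∂μ - (-c)| ≤ 0 := ge_of_tendsto h.d0 ((eventually_ge_atTop 1).mono hN)
  exact sub_eq_zero.1 (abs_nonpos_iff.1 this)

lemma Dat.tail (h : Dat F P D B δ c) {μ : Measure ℝ} [IsProbabilityMeasure μ] (hμ : ∀ (g : ℝ → ℝ) (K : NNReal) (M : ℝ),
    LipschitzWith K g → (∀ x, |g x| ≤ M) → Tendsto (MY fun y => g (F y)) atTop (𝓝 (∫ t, g t ∂μ)))
    {A : ℝ} {N : ℕ} (hN : 1 ≤ N) (hA : B N ≤ A - 1) : μ ((Set.Icc (-A) A)ᶜ) ≤ ENNReal.ofReal (δ N) := by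
  refine (tail_le μ A fun x hx => ?_).trans (ENNReal.ofReal_le_ofReal (h.gAL hN hA (hμ _ _ _ (gA_lip A) (gA_abs A))))
  by_contra! hlt
  exact hx (abs_le.1 hlt.le)

lemma Dat.tail_exp {C C1 : ℝ} (hC : 0 < C) (hC1 : 0 < C1)
    (h : Dat F P D (fun N => C * Real.log (N + 4) ^ 2 + 1) (fun N => C1 * (N:ℝ) ^ (-(1/8):ℝ)) c)
    {μ : Measure ℝ} [IsProbabilityMeasure μ] (hμ : ∀ (g : ℝ → ℝ) (K : NNReal) (M : ℝ),
    LipschitzWith K g → (∀ x, |g x| ≤ M) → Tendsto (MY fun y => g (F y)) atTop (𝓝 (∫ t, g t ∂μ))) :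
    ∃ k > 0, ∃ K > 0, ∀ A > 0, μ ((Set.Icc (-A) A)ᶜ) ≤ ENNReal.ofReal (K * Real.exp (-k * Real.sqrt A)) := by
  set κ := Real.sqrt (1 / (4 * C)) with hκ
  have hκ0 : 0 < κ := Real.sqrt_pos.2 (by positivity)
  have hκ2 : κ ^ 2 = 1 / (4 * C) := Real.sq_sqrt (by positivity)
  set A0 := 2 * (8 * C + 2) with hA0
  refine ⟨κ / 8, by positivity, 2 * C1 + Real.exp (κ / 8 * Real.sqrt A0), by positivity, fun A hA => ?_⟩
  by_cases hAA : A < A0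
  · refine prob_le_one.trans ?_
    rw [← ENNReal.ofReal_one]
    refine ENNReal.ofReal_le_ofReal ?_
    have hs : Real.sqrt A ≤ Real.sqrt A0 := Real.sqrt_le_sqrt hAA.le
    calc (1:ℝ) ≤ Real.exp (κ / 8 * Real.sqrt A0) * Real.exp (-(κ / 8) * Real.sqrt A) := by
          rw [← Real.exp_add]; refine Real.one_le_exp ?_; nlinarith
      _ ≤ _ := mul_le_mul_of_nonneg_right (by linarith) (Real.exp_pos _).le
  · push Not at hAA
    set s := Real.sqrt A
    have hs0 : 0 < s := Real.sqrt_pos.2 hA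
    have hs2 : s ^ 2 = A := Real.sq_sqrt hA.le
    set N := ⌊Real.exp (κ * s)⌋₊ with hNdef
    have hE1 : 1 ≤ Real.exp (κ * s) := Real.one_le_exp (by positivity)
    have hN1 : 1 ≤ N := Nat.one_le_floor_iff _ |>.2 hE1
    have hNr : (1:ℝ) ≤ N := by exact_mod_cast hN1
    have hNle : (N:ℝ) ≤ Real.exp (κ * s) := Nat.floor_le (by positivity)
    have hNge : Real.exp (κ * s) / 2 ≤ N := by
      have := Nat.lt_floor_add_one (Real.exp (κ * s)); linarith
    have hlog : Real.log (N + 4) ≤ 2 + κ * s := by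
      rw [Real.log_le_iff_le_exp (by positivity), Real.exp_add]
      have : (5:ℝ) ≤ Real.exp 2 := by
        have := Real.exp_one_gt_d9
        have e : Real.exp 2 = Real.exp 1 * Real.exp 1 := by rw [← Real.exp_add]; norm_num
        rw [e]; nlinarith
      nlinarith
    have hlog0 : 0 ≤ Real.log ((N:ℝ) + 4) := Real.log_nonneg (by linarith)
    have hBA : C * Real.log (N + 4) ^ 2 + 1 ≤ A - 1 := by
      have h1 : Real.log ((N:ℝ) + 4) ^ 2 ≤ 8 + 2 * (κ ^ 2 * A) := by
        rw [← hs2]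
        have := pow_le_pow_left₀ hlog0 hlog 2
        nlinarith [sq_nonneg (2 - κ * s)]
      have h2 : C * (8 + 2 * (κ ^ 2 * A)) = 8 * C + A / 2 := by rw [hκ2]; field_simp; ring
      have h3 := mul_le_mul_of_nonneg_left h1 hC.le
      rw [hA0] at hAA
      linarith
    refine (h.tail hμ hN1 hBA).trans (ENNReal.ofReal_le_ofReal ?_)
    have h1 : (N:ℝ) ^ (-(1/8):ℝ) ≤ 2 * Real.exp (-(κ / 8) * s) := by
      calc (N:ℝ) ^ (-(1/8):ℝ) ≤ (Real.exp (κ * s) / 2) ^ (-(1/8):ℝ) :=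
            Real.rpow_le_rpow_of_nonpos (by positivity) hNge (by norm_num)
        _ = Real.exp (κ * s) ^ (-(1/8):ℝ) * (2:ℝ) ^ (1/8:ℝ) := by
            rw [Real.div_rpow (by positivity) (by norm_num), div_eq_mul_inv, ← Real.rpow_neg (by norm_num), neg_neg]
        _ ≤ Real.exp (-(κ / 8) * s) * (2:ℝ) ^ (1:ℝ) := by
            rw [← Real.exp_mul, show κ * s * (-(1/8)) = -(κ / 8) * s by ring]
            refine mul_le_mul_of_nonneg_left ?_ (Real.exp_pos _).le
            exact Real.rpow_le_rpow_of_exponent_le (by norm_num) (by norm_num)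
        _ = _ := by rw [Real.rpow_one]; ring
    calc C1 * (N:ℝ) ^ (-(1/8):ℝ) ≤ C1 * (2 * Real.exp (-(κ / 8) * s)) := mul_le_mul_of_nonneg_left h1 hC1.le
      _ = 2 * C1 * Real.exp (-(κ / 8) * s) := by ring
      _ ≤ _ := mul_le_mul_of_nonneg_right (by linarith [Real.exp_pos (κ / 8 * Real.sqrt A0)]) (Real.exp_pos _).le

end Zd
end

end

section
open MeasureTheory Filter Topology

noncomputable section
namespace Zd

lemma Ez_dat : ∃ C > 0, ∃ C1 > 0, ∃ D : ℕ → ℝ → ℝ, Dat (fun y => Ezeta (Real.exp y)) Pz D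
    (fun N => C * Real.log (N + 4) ^ 2 + 1) (fun N => C1 * (N:ℝ) ^ (-(1/8):ℝ)) cz := by
  obtain ⟨C, hC, hQ⟩ := QN_bound
  obtain ⟨C1, hC1, hf⟩ := fz_mean
  obtain ⟨C2, hC2, hr⟩ := Ez_rem
  have hcz : |cz| ≤ 1 := by unfold cz; split_ifs <;> simp
  have ri : ∀ Y, IntegrableOn (rz C2) (Set.Ioc 2 Y) := fun Y => bdd_int (rz_meas C2) (rz_bdd hC2 (by norm_num))
  have fi : ∀ N Y, IntegrableOn (fun y => |fz y - QN N y|) (Set.Ioc 2 Y) := fun N Y =>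
    ((bdd_int fz_meas (fz_bdd (by norm_num))).sub
      ((QN_cont N).continuousOn.integrableOn_Icc.mono_set Set.Ioc_subset_Icc_self)).abs
  have hpb : ∀ N y, |Pz N y| ≤ C * Real.log (N + 4) ^ 2 + 1 := fun N y => by
    unfold Pz
    exact (abs_sub _ _).trans (add_le_add (hQ N y) hcz)
  refine ⟨C, hC, C1, hC1, fun N y => |fz y - QN N y| + rz C2 y, ?_⟩
  refine ⟨Ez_meas, fun N => (QN_cont N).sub continuous_const, hpb, ?_, ?_, ?_, ?_, ?_, Pz_mean⟩
  · intro N Y hY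
    rw [intervalIntegrable_iff_integrableOn_Ioc_of_le hY]
    exact (fi N Y).add (ri Y)
  · intro N y hy
    have h1 := hr y (by linarith)
    have e : Ezeta (Real.exp y) - Pz N y = (fz y - QN N y) + (Ezeta (Real.exp y) - (fz y - cz)) := by unfold Pz; ring
    rw [e]
    exact (abs_add_le _ _).trans (add_le_add le_rfl h1)
  · intro N hN ε hε
    filter_upwards [hf N hN (ε/2) (by positivity), (rz_mean hC2).eventually (gt_mem_nhds (show (0:ℝ) < ε/2 by positivity)),
      eventually_ge_atTop 2] with Y h1 h2 hY
    unfold MY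
    rw [intervalIntegral.integral_of_le hY, integral_add (fi N Y) (ri Y), mul_add]
    linarith
  · have := ((tendsto_rpow_neg_atTop (show (0:ℝ) < 1/8 by norm_num)).comp tendsto_natCast_atTop_atTop).const_mul C1
    simpa [Function.comp_def] using this
  · intro N g hg
    exact mean_cont (Pz_TP N) (hpb N) hg

end Zd

end

end

/-- `E_ζ` admits a limiting logarithmic distribution `μ_ζ` which has exponential decay
`μ_ζ(ℝ ∖ [−A,A]) ≪ exp(−C√A)` and mean `−1` if `β_{ζ,0} = 1/2`, `0` otherwise. -/
theorem stmt7 :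
    ∃ μ : Measure ℝ, HasLimitingLogDistribution Ezeta μ ∧
      (∃ C > (0:ℝ), ∃ K > (0:ℝ), ∀ A > (0:ℝ),
        μ ((Set.Icc (-A) A)ᶜ) ≤ ENNReal.ofReal (K * Real.exp (-C * Real.sqrt A))) ∧
      (∫ t, t ∂μ) = (if betaZeta = 1 / 2 then (-1 : ℝ) else 0) := by
  obtain ⟨C, hC, C1, hC1, D, h⟩ := Zd.Ez_dat
  obtain ⟨μ, hp, hμ⟩ := h.exists_mu
  refine ⟨μ, ⟨hp, fun g ⟨K, hK⟩ ⟨M, hM⟩ => hμ g K M hK hM⟩, Zd.Dat.tail_exp hC hC1 h hμ, ?_⟩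
  rw [h.mean hμ]
  unfold Zd.cz
  split_ifs <;> simp

end
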